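/- arXiv:1306.4628 — 2 statements merged into one kernel-verified Lean document; each statement's English description precedes it below -/
import Mathlib

section
/- Let r₀(n) denote the total number of reduced set partitions of {1,…,n} of genus 1 (so r₀(n) = 0 for n < 4). Then in the formal power series ring ℤ[[x]] one has (∑_{n≥0} r₀(n)·xⁿ)·(1−2x)⁴ = x⁴·(1−x)³. -/
/-- The setoid on `Fin n` whose equivalence classes are the cycles (orbits) of the
permutation `α`. -/
def cycleSetoid {n : ℕ} (α : Equiv.Perm (Fin n)) : Setoid (Fin n) :=
  ⟨α.SameCycle,
    ⟨fun x => Equiv.Perm.SameCycle.refl α x, fun h => h.symm, fun h h' => h.trans h'⟩⟩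

/-- `zPerm α` is the number of cycles of `α`, i.e. the number of orbits of `⟨α⟩` acting
on `Fin n` (fixed points counting as cycles). -/
noncomputable def zPerm {n : ℕ} (α : Equiv.Perm (Fin n)) : ℕ :=
  Nat.card (Quotient (cycleSetoid α))

/-- `α` has genus one, i.e. `z(α) + z(α⁻¹ ∘ ζₙ) = n - 1` (written additively).
Here `finRotate n` plays the role of the cycle `ζₙ = (1, 2, …, n)`. -/
def IsGenusOne {n : ℕ} (α : Equiv.Perm (Fin n)) : Prop :=
  zPerm α + zPerm (α⁻¹ * finRotate n) + 2 = n + 1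

/-- `i` is a back point of `α`: `α i < i` and `α i` is not the smallest element of the
cycle (orbit) of `α` containing `i`. -/
def IsBackPoint {n : ℕ} (α : Equiv.Perm (Fin n)) (i : Fin n) : Prop :=
  α i < i ∧ ∃ j : Fin n, α.SameCycle i j ∧ j < α i

/-- The number of back points of `α`. -/
noncomputable def backPointCount {n : ℕ} (α : Equiv.Perm (Fin n)) : ℕ :=
  Nat.card {i : Fin n // IsBackPoint α i}

/-- `α` is the permutation associated with a set partition (each block of the partition
is a cycle of `α`, traversed in increasing order); equivalently, `α` has no back point. -/
def IsPartitionPerm {n : ℕ} (α : Equiv.Perm (Fin n)) : Prop :=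
  ∀ i : Fin n, ¬ IsBackPoint α i

/-- The points `i, ζ i, …, ζᵖ i` (where `ζ = finRotate n`) form a trivial cycle of `α`:
a cycle consisting of cyclically consecutive points, each sent to the cyclically next
one, the last back to the first. -/
def IsTrivialCycleAt {n : ℕ} (α : Equiv.Perm (Fin n)) (i : Fin n) (p : ℕ) : Prop :=
  p < n ∧ (∀ t : ℕ, t < p → α ((finRotate n ^ t) i) = (finRotate n ^ (t + 1)) i) ∧
    α ((finRotate n ^ p) i) = i

/-- `α` is reduced: it contains no trivial cycle. -/
def IsReducedPerm {n : ℕ} (α : Equiv.Perm (Fin n)) : Prop :=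
  ¬ ∃ (i : Fin n) (p : ℕ), IsTrivialCycleAt α i p

theorem finRotate_pow_val {n : ℕ} (i : Fin n) (t : ℕ) :
    ((finRotate n ^ t) i).val = (i.val + t) % n := by
  obtain ⟨m, rfl⟩ : ∃ m, n = m + 1 := ⟨n - 1, by have := i.isLt; omega⟩
  induction t with
  | zero => simp [Nat.mod_eq_of_lt i.isLt]
  | succ t ih =>
    rw [pow_succ', Equiv.Perm.mul_apply, finRotate_apply, Fin.val_add, ih]
    simp only [Fin.val_one', Nat.mod_add_mod, Nat.add_mod_mod, Nat.add_assoc]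

theorem finRotate_val {n : ℕ} (i : Fin n) : (finRotate n i).val = (i.val + 1) % n := by
  simpa using finRotate_pow_val i 1

/-- The number of elements of the cycle of `α` containing `i`. -/
noncomputable def cycleCard {n : ℕ} (α : Equiv.Perm (Fin n)) (i : Fin n) : ℕ :=
  Nat.card {j // α.SameCycle i j}

theorem zPerm_eq_sum {n : ℕ} (α : Equiv.Perm (Fin n)) :
    (zPerm α : ℚ) = ∑ i, (cycleCard α i : ℚ)⁻¹ := by
  classical
  have hfib : ∀ q : Quotient (cycleSetoid α),
      ∑ i with (Quotient.mk (cycleSetoid α) i) = q, (cycleCard α i : ℚ)⁻¹ = 1 := by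
    intro q
    induction q using Quotient.inductionOn with
    | h a =>
      have hmem : ∀ i, Quotient.mk (cycleSetoid α) i = Quotient.mk (cycleSetoid α) a ↔
          α.SameCycle a i := fun i => by
        rw [Quotient.eq]; exact Equiv.Perm.sameCycle_comm
      have hc : cycleCard α a = (Finset.univ.filter fun i =>
          Quotient.mk (cycleSetoid α) i = Quotient.mk (cycleSetoid α) a).card := by
        rw [cycleCard, Nat.card_eq_fintype_card, Fintype.card_subtype]
        congr 1; ext i; simp [hmem]
      have : ∀ i ∈ Finset.univ.filter fun i =>
          Quotient.mk (cycleSetoid α) i = Quotient.mk (cycleSetoid α) a,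
          (cycleCard α i : ℚ)⁻¹ = (cycleCard α a : ℚ)⁻¹ := by
        intro i hi
        have hi' := (hmem i).1 (Finset.mem_filter.1 hi).2
        have : cycleCard α i = cycleCard α a :=
          Nat.card_congr (Equiv.subtypeEquivRight fun j =>
            ⟨fun h => hi'.trans h, fun h => hi'.symm.trans h⟩)
        rw [this]
      rw [Finset.sum_congr rfl this, Finset.sum_const, ← hc, nsmul_eq_mul]
      apply mul_inv_cancel₀
      have : 0 < cycleCard α a := by
        rw [hc, Finset.card_pos]; exact ⟨a, by simp⟩
      exact_mod_cast this.ne'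
  rw [← Finset.sum_fiberwise (s := Finset.univ) (g := Quotient.mk (cycleSetoid α)),
    Finset.sum_congr rfl fun q _ => hfib q]
  simp [zPerm, Nat.card_eq_fintype_card]

theorem cycleCard_eq_of_forall {n : ℕ} {α : Equiv.Perm (Fin n)} {i : Fin n}
    (s : Finset (Fin n)) (h : ∀ j, α.SameCycle i j ↔ j ∈ s) : cycleCard α i = s.card := by
  rw [cycleCard, Nat.card_congr (Equiv.subtypeEquivRight h)]; simp

theorem sameCycle_iff_exists_lt {n : ℕ} {α : Equiv.Perm (Fin n)} {i j : Fin n} {r : ℕ}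
    (hr : 0 < r) (h : (α ^ r) i = i) : α.SameCycle i j ↔ ∃ t < r, (α ^ t) i = j := by
  constructor
  · rintro hs
    obtain ⟨k, -, hk⟩ := hs.exists_pow_eq'
    refine ⟨k % r, Nat.mod_lt _ hr, ?_⟩
    have h' : ∀ q : ℕ, (α ^ (r * q)) i = i := by
      intro q
      induction q with
      | zero => simp
      | succ q ih => rw [Nat.mul_succ, pow_add, Equiv.Perm.mul_apply, h, ih]
    rw [← hk]
    conv_rhs => rw [← Nat.mod_add_div k r, pow_add, Equiv.Perm.mul_apply, h']
  · rintro ⟨t, -, rfl⟩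
    exact ⟨t, by simp⟩

theorem cycleCard_of_two {n : ℕ} {α : Equiv.Perm (Fin n)} {i : Fin n}
    (h1 : α i ≠ i) (h2 : α (α i) = i) : cycleCard α i = 2 := by
  rw [cycleCard_eq_of_forall {i, α i}, Finset.card_pair h1.symm]
  intro j
  rw [sameCycle_iff_exists_lt (r := 2) (by norm_num) (by simpa [pow_two] using h2)]
  constructor
  · rintro ⟨t, ht, rfl⟩
    interval_cases t <;> simp
  · intro h
    rcases Finset.mem_insert.1 h with rfl | h
    · exact ⟨0, by simp⟩
    · exact ⟨1, by simpa using (Finset.mem_singleton.1 h).symm⟩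

theorem cycleCard_of_three {n : ℕ} {α : Equiv.Perm (Fin n)} {i : Fin n}
    (h1 : α i ≠ i) (h3 : α (α (α i)) = i) : cycleCard α i = 3 := by
  have h2 : α (α i) ≠ i := fun h => h1 (by rwa [h] at h3)
  rw [cycleCard_eq_of_forall {i, α i, α (α i)}]
  · refine Finset.card_eq_three.2 ⟨_, _, _, h1.symm, h2.symm, fun h => h1 ?_, rfl⟩
    exact (α.injective h).symm
  intro j
  rw [sameCycle_iff_exists_lt (r := 3) (by norm_num) (by simpa [pow_succ] using h3)]
  constructor
  · rintro ⟨t, ht, rfl⟩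
    interval_cases t <;> simp [pow_succ]
  · intro h
    simp only [Finset.mem_insert, Finset.mem_singleton] at h
    rcases h with rfl | rfl | rfl
    · exact ⟨0, by simp⟩
    · exact ⟨1, by simp⟩
    · exact ⟨2, by simp [pow_succ]⟩

theorem three_le_cycleCard {n : ℕ} {α : Equiv.Perm (Fin n)} {i : Fin n}
    (h1 : α i ≠ i) (h2 : α (α i) ≠ i) : 3 ≤ cycleCard α i := by
  classical
  have h3 : ({i, α i, α (α i)} : Finset (Fin n)).card = 3 :=
    Finset.card_eq_three.2 ⟨_, _, _, h1.symm, h2.symm, fun h => h1 (α.injective h).symm, rfl⟩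
  rw [cycleCard, Nat.card_eq_fintype_card, Fintype.card_subtype, ← h3]
  apply Finset.card_le_card
  intro j hj
  simp only [Finset.mem_insert, Finset.mem_singleton] at hj
  rw [Finset.mem_filter]
  refine ⟨Finset.mem_univ _, ?_⟩
  rcases hj with rfl | rfl | rfl
  · exact Equiv.Perm.SameCycle.refl _ _
  · exact ⟨1, by simp⟩
  · exact ⟨2, rfl⟩

theorem cycleCard_of_four {n : ℕ} {α : Equiv.Perm (Fin n)} {i : Fin n}
    (h2 : α (α i) ≠ i) (h4 : α (α (α (α i))) = i) : cycleCard α i = 4 := by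
  have h1 : α i ≠ i := fun h => h2 (by rw [h, h])
  have h3 : α (α (α i)) ≠ i := fun h => h1 (by rwa [h] at h4)
  rw [cycleCard_eq_of_forall {i, α i, α (α i), α (α (α i))}]
  · have e1 : α i ≠ α (α i) := fun h => h1 (α.injective h).symm
    have e2 : α (α i) ≠ α (α (α i)) := fun h => e1 (α.injective h)
    have e3 : α i ≠ α (α (α i)) := fun h => h2 (α.injective h).symm
    simp [h1.symm, h2.symm, h3.symm, e1, e2, e3]
  intro j
  rw [sameCycle_iff_exists_lt (r := 4) (by norm_num) (by simpa [pow_succ] using h4)]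
  constructor
  · rintro ⟨t, ht, rfl⟩
    interval_cases t <;> simp [pow_succ]
  · intro h
    simp only [Finset.mem_insert, Finset.mem_singleton] at h
    rcases h with rfl | rfl | rfl | rfl
    · exact ⟨0, by simp⟩
    · exact ⟨1, by simp⟩
    · exact ⟨2, by simp [pow_succ]⟩
    · exact ⟨3, by simp [pow_succ]⟩

/-- The points lying on cycles of length greater than two. -/
def longPoints {n : ℕ} (α : Equiv.Perm (Fin n)) : Finset (Fin n) :=
  Finset.univ.filter fun i => α (α i) ≠ i

theorem mem_longPoints {n : ℕ} {α : Equiv.Perm (Fin n)} {i : Fin n} :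
    i ∈ longPoints α ↔ α (α i) ≠ i := by
  simp [longPoints]

theorem six_mul_zPerm_add_card_longPoints_le {n : ℕ} {α : Equiv.Perm (Fin n)}
    (h : ∀ i, α i ≠ i) : 6 * zPerm α + (longPoints α).card ≤ 3 * n := by
  have key : ∀ i : Fin n, 6 * (cycleCard α i : ℚ)⁻¹ + (if α (α i) ≠ i then 1 else 0) ≤ 3 := by
    intro i
    split_ifs with h2
    · have : (3 : ℚ) ≤ cycleCard α i := by exact_mod_cast three_le_cycleCard (h i) h2
      have : (cycleCard α i : ℚ)⁻¹ ≤ 3⁻¹ := inv_anti₀ (by norm_num) this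
      linarith
    · rw [cycleCard_of_two (h i) (not_not.1 h2)]; norm_num
  have := Finset.sum_le_sum fun i (_ : i ∈ Finset.univ) => key i
  rw [Finset.sum_add_distrib, ← Finset.mul_sum, ← zPerm_eq_sum, Finset.sum_boole] at this
  simp only [Finset.sum_const, Finset.card_univ, Fintype.card_fin, nsmul_eq_mul] at this
  have : (6 * zPerm α + (longPoints α).card : ℚ) ≤ 3 * n := by
    rw [longPoints]; linarith
  exact_mod_cast this

theorem two_mul_zPerm_of_longPoints {n : ℕ} {α : Equiv.Perm (Fin n)} (h : ∀ i, α i ≠ i) (r : ℕ)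
    (hr : ∀ i ∈ longPoints α, cycleCard α i = r) :
    (2 * zPerm α : ℚ) + (longPoints α).card = n + 2 * (longPoints α).card * (r : ℚ)⁻¹ := by
  have key : ∀ i : Fin n, 2 * (cycleCard α i : ℚ)⁻¹ + (if α (α i) ≠ i then 1 else 0) =
      1 + (if α (α i) ≠ i then 1 else 0) * (2 * (r : ℚ)⁻¹) := by
    intro i
    split_ifs with h2
    · rw [hr i (mem_longPoints.2 h2)]; ring
    · rw [cycleCard_of_two (h i) (not_not.1 h2)]; norm_num
  have := Finset.sum_congr rfl fun i (_ : i ∈ Finset.univ) => key i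
  rw [Finset.sum_add_distrib, ← Finset.mul_sum, ← zPerm_eq_sum, Finset.sum_boole,
    Finset.sum_add_distrib, ← Finset.sum_mul, Finset.sum_boole] at this
  simp only [Finset.sum_const, Finset.card_univ, Fintype.card_fin, nsmul_eq_mul] at this
  rw [longPoints]; linarith

theorem two_mul_zPerm_of_involutive {n : ℕ} {α : Equiv.Perm (Fin n)} (h : ∀ i, α i ≠ i)
    (h2 : ∀ i, α (α i) = i) : 2 * zPerm α = n := by
  have h0 : longPoints α = ∅ := by ext i; simp [mem_longPoints, h2]
  have := two_mul_zPerm_of_longPoints h 1 (by simp [h0])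
  simp only [h0, Finset.card_empty] at this
  have : (2 * zPerm α : ℚ) = n := by simpa using this
  exact_mod_cast this

/-- The number of steps of `finRotate N` leading from `e k` to the cyclically next point of the
range of `e`. -/
def gap {K N : ℕ} (e : Fin K ↪o Fin N) (k : Fin K) : ℕ :=
  if (e k).val < (e (finRotate K k)).val then (e (finRotate K k)).val - (e k).val
  else N + (e (finRotate K k)).val - (e k).val

theorem gap_pos {K N : ℕ} (e : Fin K ↪o Fin N) (k : Fin K) : 0 < gap e k := by
  have := (e k).isLt
  unfold gap; split_ifs <;> omega

theorem gap_le {K N : ℕ} (e : Fin K ↪o Fin N) (k : Fin K) : gap e k ≤ N := by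
  have := (e k).isLt
  have := (e (finRotate K k)).isLt
  unfold gap; split_ifs <;> omega

theorem finRotate_pow_gap {K N : ℕ} (e : Fin K ↪o Fin N) (k : Fin K) :
    (finRotate N ^ gap e k) (e k) = e (finRotate K k) := by
  have h1 := (e k).isLt
  have h2 := (e (finRotate K k)).isLt
  apply Fin.ext
  rw [finRotate_pow_val]
  unfold gap
  split_ifs
  · rw [Nat.mod_eq_of_lt] <;> omega
  · rw [show (e k).val + (N + (e (finRotate K k)).val - (e k).val)
      = (e (finRotate K k)).val + N by omega, Nat.add_mod_right, Nat.mod_eq_of_lt h2]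

theorem finRotate_pow_ne_of_lt_gap {K N : ℕ} (e : Fin K ↪o Fin N) (k : Fin K) {s : ℕ}
    (hs : 0 < s) (hs' : s < gap e k) (j : Fin K) : (finRotate N ^ s) (e k) ≠ e j := by
  intro h
  have h1 := (e k).isLt
  have h3 := (e j).isLt
  have h2 := (e (finRotate K k)).isLt
  have hv := congrArg Fin.val h
  rw [finRotate_pow_val] at hv
  have hjk : j.val ≤ k.val → (e j).val ≤ (e k).val := fun h => e.monotone h
  have hkj : j.val < k.val → (e j).val < (e k).val := fun h => e.strictMono h
  have hσ := finRotate_val k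
  by_cases hk : k.val + 1 < K
  · rw [Nat.mod_eq_of_lt hk] at hσ
    have hlt : (e k).val < (e (finRotate K k)).val :=
      e.strictMono (show k.val < _ by omega)
    have hjs : k.val < j.val → (e (finRotate K k)).val ≤ (e j).val := fun h =>
      e.monotone (show (finRotate K k).val ≤ j.val by omega)
    rw [gap, if_pos hlt] at hs'
    rw [Nat.mod_eq_of_lt (by omega)] at hv
    by_cases hc : j.val ≤ k.val
    · have := hjk hc; omega
    · have := hjs (by omega); omega
  · have hk' : k.val + 1 = K := by omega
    rw [hk', Nat.mod_self] at hσ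
    have hle : (e (finRotate K k)).val ≤ (e k).val :=
      e.monotone (show (finRotate K k).val ≤ _ by omega)
    have hjs : (e (finRotate K k)).val ≤ (e j).val :=
      e.monotone (show (finRotate K k).val ≤ j.val by omega)
    have := hjk (by omega)
    rw [gap, if_neg (by omega)] at hs'
    by_cases hc : (e k).val + s < N
    · rw [Nat.mod_eq_of_lt hc] at hv; omega
    · rw [Nat.mod_eq_sub_mod (by omega), Nat.mod_eq_of_lt (by omega)] at hv; omega

/-- Between a point and its larger image, a permutation has, besides these two, two further
points on long cycles, of itself or of its complement with respect to `finRotate`. -/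
theorem exists_pair_longPoints {N : ℕ} {α : Equiv.Perm (Fin N)}
    (h1 : ∀ i, α i ≠ i) (h2 : ∀ i, α i ≠ finRotate N i) (d : ℕ) :
    ∀ x y : Fin N, α x = y → x < y → y.val - x.val ≤ d →
      (∃ u v, x ≤ u ∧ u < v ∧ v < y ∧ u ∈ longPoints (α⁻¹ * finRotate N) ∧
        v ∈ longPoints (α⁻¹ * finRotate N)) ∨
      (∃ u v, x < u ∧ u < v ∧ v < y ∧ u ∈ longPoints α ∧ v ∈ longPoints α) := by
  induction d with
  | zero => intro x y _ hxy hd; simp only [Fin.lt_def] at hxy; omega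
  | succ d ih =>
    intro x y hα hxy hd
    rw [Fin.lt_def] at hxy
    set β := α⁻¹ * finRotate N with hβ
    have hy := y.isLt
    obtain ⟨y', hy'⟩ : ∃ y' : Fin N, y'.val + 1 = y.val := ⟨⟨y.val - 1, by omega⟩, by simp; omega⟩
    obtain ⟨x', hx'⟩ : ∃ x' : Fin N, x'.val = x.val + 1 := ⟨⟨x.val + 1, by omega⟩, rfl⟩
    have ry : finRotate N y' = y := by
      apply Fin.ext; rw [finRotate_val, hy', Nat.mod_eq_of_lt hy]
    have rx : finRotate N x = x' := by
      apply Fin.ext; rw [finRotate_val, hx', Nat.mod_eq_of_lt (by omega)]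
    have hαβ : ∀ i, α (β i) = finRotate N i := fun i => by simp [hβ]
    have hβy : β y' = x := by apply α.injective; rw [hαβ, ry, hα]
    have hxy' : x.val ≠ y'.val := fun h => by
      have : x = y' := Fin.ext h
      exact h2 x (by rw [hα, this, ry])
    by_cases hb : y' ∈ longPoints β
    · left
      refine ⟨x, y', le_refl _, Fin.lt_def.2 (by omega), Fin.lt_def.2 (by omega), ?_, hb⟩
      rw [mem_longPoints] at hb ⊢
      intro h
      apply hb
      apply β.injective
      rw [hβy, h]
    · rw [mem_longPoints, not_not, hβy] at hb
      have hαy : α y' = x' := by rw [← hb, hαβ, rx]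
      have hxy'' : x'.val ≠ y'.val := fun h => by
        have : x' = y' := Fin.ext h
        exact h1 y' (by rw [hαy, this])
      by_cases ha : y' ∈ longPoints α
      · right
        refine ⟨x', y', Fin.lt_def.2 (by omega), Fin.lt_def.2 (by omega),
          Fin.lt_def.2 (by omega), ?_, ha⟩
        rw [mem_longPoints] at ha ⊢
        intro h
        apply ha
        apply α.injective
        rw [hαy, h]
      · rw [mem_longPoints, not_not, hαy] at ha
        rcases ih x' y' ha (Fin.lt_def.2 (by omega)) (by omega) with
          ⟨u, v, h3, h4, h5, h6⟩ | ⟨u, v, h3, h4, h5, h6⟩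
        · left
          rw [Fin.le_def] at h3
          rw [Fin.lt_def] at h5
          exact ⟨u, v, Fin.le_def.2 (by omega), h4, Fin.lt_def.2 (by omega), h6⟩
        · right
          rw [Fin.lt_def] at h3 h5
          exact ⟨u, v, Fin.lt_def.2 (by omega), h4, Fin.lt_def.2 (by omega), h6⟩

theorem IsPartitionPerm.exists_lt_lt {N : ℕ} {α : Equiv.Perm (Fin N)} (hP : IsPartitionPerm α)
    (h1 : ∀ i, α i ≠ i) {i : Fin N} (hi : i ∈ longPoints α) :
    ∃ μ, μ < α μ ∧ α μ < α (α μ) ∧ α (α (α μ)) ≠ α μ := by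
  classical
  set s := Finset.univ.filter fun j => α.SameCycle i j with hs
  have hne : s.Nonempty := ⟨i, by simp [hs, Equiv.Perm.SameCycle.refl]⟩
  obtain ⟨μ, hμ, hmin⟩ : ∃ μ ∈ s, ∀ j ∈ s, μ ≤ j :=
    ⟨s.min' hne, s.min'_mem hne, fun j hj => s.min'_le j hj⟩
  have hms : ∀ j, j ∈ s ↔ α.SameCycle i j := fun j => by simp [hs]
  rw [hms] at hμ
  have hμ1 : α.SameCycle i (α μ) := Equiv.Perm.sameCycle_apply_right.2 hμ
  have hμ2 : α.SameCycle i (α (α μ)) := Equiv.Perm.sameCycle_apply_right.2 hμ1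
  have hlong : α (α μ) ≠ μ := by
    intro h
    rw [mem_longPoints] at hi
    have hmem := (sameCycle_iff_exists_lt (r := 2) (by norm_num)
      (by simpa [pow_two] using h)).1 hμ.symm
    obtain ⟨t, ht, rfl⟩ := hmem
    apply hi
    interval_cases t
    · simpa using h
    · simp [h]
  have hlt : μ < α μ := lt_of_le_of_ne (hmin _ ((hms _).2 hμ1)) (h1 μ).symm
  have hlt2 : μ < α (α μ) := lt_of_le_of_ne (hmin _ ((hms _).2 hμ2)) hlong.symm
  refine ⟨μ, hlt, ?_, fun h => hlong (α.injective h)⟩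
  by_contra hc
  exact hP (α μ) ⟨lt_of_le_of_ne (not_lt.1 hc) (h1 _), μ, hμ1.symm.trans hμ, hlt2⟩

theorem length_le_card_of_isChain {N : ℕ} {l : List (Fin N)} {s : Finset (Fin N)}
    (hl : l.IsChain (· < ·)) (hs : ∀ x ∈ l, x ∈ s) : l.length ≤ s.card := by
  have hn : l.Nodup := (List.isChain_iff_pairwise.1 hl).imp fun h => h.ne
  rw [← List.toFinset_card_of_nodup hn]
  exact Finset.card_le_card fun x hx => hs x (List.mem_toFinset.1 hx)

/-- A genus one partition without trivial points and without consecutive points in a block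
is a fixed point free involution. -/
theorem IsPartitionPerm.involutive_of_isGenusOne {N : ℕ} {α : Equiv.Perm (Fin N)}
    (hP : IsPartitionPerm α) (hG : IsGenusOne α) (h1 : ∀ i, α i ≠ i)
    (h2 : ∀ i, α i ≠ finRotate N i) : ∀ i, α (α i) = i := by
  by_contra! hcon
  obtain ⟨i, hi⟩ := hcon
  set β := α⁻¹ * finRotate N with hβ
  have hβ1 : ∀ i, β i ≠ i := fun i h => h2 i (by
    rw [hβ, Equiv.Perm.mul_apply, Equiv.Perm.inv_eq_iff_eq] at h; exact h.symm)
  have e1 := six_mul_zPerm_add_card_longPoints_le h1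
  have e2 := six_mul_zPerm_add_card_longPoints_le hβ1
  have e3 : zPerm α + zPerm β + 2 = N + 1 := hG
  have hle : (longPoints α).card + (longPoints β).card ≤ 6 := by omega
  obtain ⟨μ, hμ1, hμ2, hμ3⟩ := hP.exists_lt_lt h1 (mem_longPoints.2 hi)
  have m1 : α μ ∈ longPoints α := mem_longPoints.2 hμ3
  have m0 : μ ∈ longPoints α := mem_longPoints.2 fun h => hμ3 (by rw [h])
  have m2 : α (α μ) ∈ longPoints α := mem_longPoints.2 fun h => hμ3 (α.injective h)
  have p1 := exists_pair_longPoints h1 h2 _ μ (α μ) rfl hμ1 le_rfl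
  have p2 := exists_pair_longPoints h1 h2 _ (α μ) (α (α μ)) rfl hμ2 le_rfl
  rw [← hβ] at p1 p2
  clear_value β
  clear hβ
  rcases p1 with ⟨u, v, a1, a2, a3, a4, a5⟩ | ⟨u, v, a1, a2, a3, a4, a5⟩ <;>
  rcases p2 with ⟨w, z, b1, b2, b3, b4, b5⟩ | ⟨w, z, b1, b2, b3, b4, b5⟩
  · have c1 := length_le_card_of_isChain (l := [μ, α μ, α (α μ)]) (s := longPoints α)
      (by simp [*]) (by simp [*])
    have c2 := length_le_card_of_isChain (l := [u, v, w, z]) (s := longPoints β)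
      (by simp [*, a3.trans_le b1]) (by simp [*])
    simp only [List.length_cons, List.length_nil] at c1 c2
    omega
  · have c1 := length_le_card_of_isChain (l := [μ, α μ, w, z, α (α μ)]) (s := longPoints α)
      (by simp [*]) (by simp [*])
    have c2 := length_le_card_of_isChain (l := [u, v]) (s := longPoints β)
      (by simp [*]) (by simp [*])
    simp only [List.length_cons, List.length_nil] at c1 c2
    omega
  · have c1 := length_le_card_of_isChain (l := [μ, u, v, α μ, α (α μ)]) (s := longPoints α)
      (by simp [*]) (by simp [*])
    have c2 := length_le_card_of_isChain (l := [w, z]) (s := longPoints β)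
      (by simp [*]) (by simp [*])
    simp only [List.length_cons, List.length_nil] at c1 c2
    omega
  · have c1 := length_le_card_of_isChain (l := [μ, u, v, α μ, w, z, α (α μ)])
      (s := longPoints α) (by simp [*]) (by simp [*])
    simp only [List.length_cons, List.length_nil] at c1
    omega

/-- The arcs cut out by the long cycles of `α⁻¹ * finRotate N`, for a fixed point free
involution `α`, are matched by a fixed point free involution `π`, and `α` reverses them. -/
theorem exists_arc_matching {K N : ℕ} {α : Equiv.Perm (Fin N)} (hα : ∀ i, α (α i) = i)
    (h1 : ∀ i, α i ≠ i) (h2 : ∀ i, α i ≠ finRotate N i) (e : Fin K ↪o Fin N)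
    (he : ∀ x, x ∈ longPoints (α⁻¹ * finRotate N) ↔ ∃ k, e k = x) :
    ∃ π : Fin K → Fin K, (∀ k, π (π k) = k) ∧ (∀ k, π k ≠ k) ∧
      (∀ k, finRotate K (π k) ≠ k) ∧ (∀ k, finRotate K (π (finRotate K (π k))) ≠ k) ∧
      (∀ k, gap e (π k) = gap e k) ∧
      ∀ k s, s < gap e k →
        (finRotate N ^ s) (α ((finRotate N ^ (s + 1)) (e k))) = e (finRotate K (π k)) := by
  set ζ := finRotate N with hζ
  have hinv : α⁻¹ = α := by
    ext i; rw [Equiv.Perm.inv_eq_iff_eq.2 (hα i).symm]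
  set β := α⁻¹ * ζ with hβ
  have hβa : ∀ x, β x = α (ζ x) := fun x => by rw [hβ, hinv]; rfl
  have hζs : ∀ (s : ℕ) x, (ζ ^ (s + 1)) x = ζ ((ζ ^ s) x) := fun s x => by rw [pow_succ']; rfl
  have hζs' : ∀ (s : ℕ) x, (ζ ^ (s + 1)) x = (ζ ^ s) (ζ x) := fun s x => by rw [pow_succ]; rfl
  have hβT : ∀ x, x ∈ longPoints β ↔ β x ∈ longPoints β := fun x => by
    simp only [mem_longPoints, ne_eq, β.injective.eq_iff]
  have hb : ∀ k, ∃ j, e j = β (e k) := fun k => (he _).1 ((hβT _).1 ((he _).2 ⟨k, rfl⟩))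
  choose b hb using hb
  have hpi : ∀ k, ∃ j, finRotate K j = b k := fun k => (finRotate K).surjective _
  choose π hπ using hpi
  have hmem : ∀ k, e k ∈ longPoints β := fun k => (he _).2 ⟨k, rfl⟩
  have hinterior : ∀ k s, 0 < s → s < gap e k → (ζ ^ s) (e k) ∉ longPoints β := by
    intro k s hs hs' h
    obtain ⟨j, hj⟩ := (he _).1 h
    exact finRotate_pow_ne_of_lt_gap e k hs hs' j hj.symm
  have hdesc : ∀ k s, s < gap e k → (ζ ^ s) (α ((ζ ^ (s + 1)) (e k))) = e (b k) := by
    intro k s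
    induction s with
    | zero => intro _; rw [hb, hβa]; simp
    | succ s ih =>
      intro hs
      have hx := hinterior k (s + 1) (by omega) hs
      rw [mem_longPoints, not_not, hβa, hβa] at hx
      have hx' : ζ (α (ζ ((ζ ^ (s + 1)) (e k)))) = α ((ζ ^ (s + 1)) (e k)) := by
        rw [← hx, hα, hx]
      rw [hζs' s (α _), hζs (s + 1), hx', ih (by omega)]
  have hdesc_not : ∀ k s, 0 < s → s < gap e k → α ((ζ ^ (s + 1)) (e k)) ∉ longPoints β := by
    intro k s h0 hs
    rw [hζs, ← hβa, ← hβT]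
    exact hinterior k s h0 hs
  have hcancel : ∀ (s t : ℕ) x y, (ζ ^ s) x = (ζ ^ (s + t)) y → x = (ζ ^ t) y := by
    intro s t x y h
    rw [pow_add, Equiv.Perm.mul_apply] at h
    exact (ζ ^ s).injective h
  have hgπ : ∀ k, (ζ ^ gap e (π k)) (e (π k)) = e (b k) := fun k => by
    rw [hζ, finRotate_pow_gap, hπ]
  have hle1 : ∀ k, gap e k ≤ gap e (π k) := by
    intro k
    by_contra! hlt
    apply hdesc_not k _ (gap_pos e (π k)) hlt
    have := hdesc k _ hlt
    rw [← hgπ k] at this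
    rw [(ζ ^ _).injective this]
    exact hmem _
  have hend : ∀ k, ∃ y, y ∈ longPoints β ∧ β y = e (finRotate K k) ∧
      (ζ ^ gap e k) y = e (b k) := by
    intro k
    obtain ⟨g, hg⟩ : ∃ g, gap e k = g + 1 := ⟨gap e k - 1, by have := gap_pos e k; omega⟩
    have hd := hdesc k g (by omega)
    rw [← hg, hζ, finRotate_pow_gap, ← hζ] at hd
    obtain ⟨y, hy⟩ := ζ.surjective (α (e (finRotate K k)))
    have hby : β y = e (finRotate K k) := by rw [hβa, hy, hα]
    refine ⟨y, ?_, hby, ?_⟩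
    · rw [hβT, hby]; exact hmem _
    · rw [hg, hζs', hy, hd]
  have hgap : ∀ k, gap e (π k) = gap e k := by
    intro k
    by_contra hne
    have hlt : gap e k < gap e (π k) := lt_of_le_of_ne (hle1 k) (Ne.symm hne)
    obtain ⟨y, hy, -, hy2⟩ := hend k
    obtain ⟨t, ht⟩ : ∃ t, gap e (π k) = gap e k + t := ⟨_, (Nat.add_sub_cancel' hlt.le).symm⟩
    rw [← hgπ k, ht] at hy2
    rw [hcancel _ _ _ _ hy2] at hy
    exact hinterior (π k) t (by omega) (by have := gap_pos e k; omega) hy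
  have hππ : ∀ k, π (π k) = k := by
    intro k
    obtain ⟨y, hy, hy1, hy2⟩ := hend k
    rw [← hgπ k, hgap k] at hy2
    rw [(ζ ^ _).injective hy2, ← hb] at hy1
    have := e.injective hy1
    rw [← hπ] at this
    exact (finRotate K).injective this
  refine ⟨π, hππ, ?_, ?_, ?_, hgap, fun k s hs => by rw [hdesc k s hs, hπ]⟩
  · intro k hk
    have hbk := hgπ k
    rw [hk] at hbk
    have hpos := gap_pos e k
    rcases Nat.even_or_odd' (gap e k) with ⟨c, hc | hc⟩
    · have hd := hdesc k (c - 1) (by omega)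
      rw [← hbk, show gap e k = (c - 1) + (c + 1) by omega] at hd
      have := hcancel _ _ _ _ hd
      rw [show c - 1 + 1 = c by omega, hζs] at this
      exact h2 _ this
    · have hd := hdesc k c (by omega)
      rw [← hbk, show gap e k = c + (c + 1) by omega] at hd
      exact h1 _ (hcancel _ _ _ _ hd)
  · intro k hk
    rw [hπ] at hk
    have hl := mem_longPoints.1 (hmem k)
    rw [← hb, hk, ← hb, hk] at hl
    exact hl rfl
  · intro k hk
    rw [hπ, hπ] at hk
    have hl := mem_longPoints.1 (hmem k)
    rw [← hb, ← hb, hk] at hl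
    exact hl rfl

theorem involution_three_not_fixedPointFree (π : Fin 3 → Fin 3) (h1 : ∀ k, π (π k) = k)
    (h2 : ∀ k, π k ≠ k) : False := by
  have key : ∀ a b c : Fin 3,
      ¬((∀ k, ![a, b, c] k ≠ k) ∧ ∀ k, ![a, b, c] (![a, b, c] k) = k) := by
    decide +kernel
  have hf : π = ![π 0, π 1, π 2] := by
    funext k; fin_cases k <;> rfl
  apply key (π 0) (π 1) (π 2)
  rw [← hf]
  exact ⟨h2, h1⟩

theorem involution_five_not_fixedPointFree (π : Fin 5 → Fin 5) (h1 : ∀ k, π (π k) = k)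
    (h2 : ∀ k, π k ≠ k) : False := by
  have key : ∀ a b c d e : Fin 5,
      ¬((∀ k, ![a, b, c, d, e] k ≠ k) ∧ ∀ k, ![a, b, c, d, e] (![a, b, c, d, e] k) = k) := by
    decide +kernel
  have hf : π = ![π 0, π 1, π 2, π 3, π 4] := by
    funext k; fin_cases k <;> rfl
  apply key (π 0) (π 1) (π 2) (π 3) (π 4)
  rw [← hf]
  exact ⟨h2, h1⟩

theorem arc_matching_four (π : Fin 4 → Fin 4) (h1 : ∀ k, π (π k) = k)
    (h2 : ∀ k, π k ≠ k) (h3 : ∀ k, π k + 1 ≠ k) : ∀ k, π k = k + 2 := by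
  have key : ∀ a b c d : Fin 4, (∀ k, ![a, b, c, d] k ≠ k) → (∀ k, ![a, b, c, d] k + 1 ≠ k) →
      (∀ k, ![a, b, c, d] (![a, b, c, d] k) = k) → ∀ k, ![a, b, c, d] k = k + 2 := by
    decide +kernel
  have hf : π = ![π 0, π 1, π 2, π 3] := by
    funext k; fin_cases k <;> rfl
  have := key (π 0) (π 1) (π 2) (π 3)
  rw [← hf] at this
  exact this h2 h3 h1

theorem arc_matching_six (π : Fin 6 → Fin 6) (h1 : ∀ k, π (π k) = k) (h2 : ∀ k, π k ≠ k)
    (h3 : ∀ k, π k + 1 ≠ k) (h4 : ∀ k, π (π k + 1) + 1 ≠ k) : ∀ k, π k = k + 3 := by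
  let ι : Fin 3 → Fin 6 := Fin.castLE (by decide)
  have key : ∀ a b c d e g : Fin 3,
      let f : Fin 6 → Fin 6 := ![2 + ι a, 3 + ι b, 4 + ι c, 5 + ι d, ι e, 1 + ι g]
      (∀ k, f (f k) = k) → (∀ k, f (f k + 1) + 1 ≠ k) → ∀ k, f k = k + 3 := by
    decide +kernel
  have hc : ∀ k, ∃ c : Fin 3, π k = k + 2 + ι c := by
    have h : ∀ k x : Fin 6, x ≠ k → x + 1 ≠ k → x ≠ k + 1 → ∃ c : Fin 3, x = k + 2 + ι c := by
      decide
    exact fun k => h k _ (h2 k) (h3 k) fun h => h3 (π k) (by rw [h1, h])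
  choose c hc using hc
  have hf : π = ![2 + ι (c 0), 3 + ι (c 1), 4 + ι (c 2), 5 + ι (c 3), ι (c 4), 1 + ι (c 5)] := by
    funext k
    fin_cases k <;> simp [hc]
  have := key (c 0) (c 1) (c 2) (c 3) (c 4) (c 5)
  simp only [← hf] at this
  exact this h1 h4

theorem arc_matching_antipodal {K : ℕ} (h0 : 0 < K) (h6 : K ≤ 6) (π : Fin K → Fin K)
    (h1 : ∀ k, π (π k) = k) (h2 : ∀ k, π k ≠ k) (h3 : ∀ k, finRotate K (π k) ≠ k)
    (h4 : ∀ k, finRotate K (π (finRotate K (π k))) ≠ k) :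
    (K = 4 ∨ K = 6) ∧ ∀ k, (π k).val = (k.val + K / 2) % K := by
  interval_cases K
  · exact absurd (Subsingleton.elim _ _) (h2 0)
  · have := h2 0
    have := h3 0
    rw [finRotate_apply] at this
    exact absurd this (by generalize π 0 = x at *; revert x; decide)
  · exact (involution_three_not_fixedPointFree π h1 h2).elim
  · simp only [finRotate_apply] at h3
    refine ⟨Or.inl rfl, fun k => ?_⟩
    rw [arc_matching_four π h1 h2 h3 k, Fin.val_add]
    rfl
  · exact (involution_five_not_fixedPointFree π h1 h2).elim
  · simp only [finRotate_apply] at h3 h4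
    refine ⟨Or.inr rfl, fun k => ?_⟩
    rw [arc_matching_six π h1 h2 h3 h4 k, Fin.val_add]
    rfl

/-- The involution of `{0, …, 2m - 1}` reversing the arcs cut out by the antipodal points
`a, b, c, a + m, b + m, c + m`. -/
def arcReversal (m a b c x : ℕ) : ℕ :=
  if x ≤ a then a + c + 1 - x
  else if x ≤ b then a + b + 1 + m - x
  else if x ≤ c then b + c + 1 + m - x
  else if x ≤ a + m then (if x ≤ a + c + 1 then a + c + 1 - x else a + c + 1 + 2 * m - x)
  else if x ≤ b + m then a + b + 1 + m - x
  else if x ≤ c + m then b + c + 1 + m - x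
  else a + c + 1 + 2 * m - x

theorem longPoints_card_mem_Icc {N : ℕ} {α : Equiv.Perm (Fin N)} (hG : IsGenusOne α)
    (hα : ∀ i, α (α i) = i) (h1 : ∀ i, α i ≠ i) (h2 : ∀ i, α i ≠ finRotate N i) :
    0 < (longPoints (α⁻¹ * finRotate N)).card ∧ (longPoints (α⁻¹ * finRotate N)).card ≤ 6 := by
  have hβ : ∀ i, (α⁻¹ * finRotate N) i ≠ i := fun i h => by
    rw [Equiv.Perm.mul_apply, Equiv.Perm.inv_eq_iff_eq] at h
    exact h2 i h.symm
  have hz := two_mul_zPerm_of_involutive h1 hα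
  have hz' := six_mul_zPerm_add_card_longPoints_le hβ
  unfold IsGenusOne at hG
  refine ⟨?_, by omega⟩
  by_contra! h
  have h0 : longPoints (α⁻¹ * finRotate N) = ∅ := Finset.card_eq_zero.1 (by omega)
  have := two_mul_zPerm_of_involutive hβ fun i => by
    by_contra hi
    have := mem_longPoints.2 hi
    simp [h0] at this
  omega

theorem eq_arcReversal {m a b c x y : ℕ} (hab : a < b) (hbc : b ≤ c) (_hcm : c < m)
    (hx : x < 2 * m) (hy : y < 2 * m)
    (v0 : a < x → x ≤ b → y + x = a + (b + m) + 1 ∨ y + x = a + (b + m) + 1 + 2 * m)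
    (v1 : b < x → x ≤ c → y + x = b + (c + m) + 1 ∨ y + x = b + (c + m) + 1 + 2 * m)
    (v2 : c < x → x ≤ a + m → y + x = c + a + 1 ∨ y + x = c + a + 1 + 2 * m)
    (v3 : a + m < x → x ≤ b + m → y + x = a + m + b + 1 ∨ y + x = a + m + b + 1 + 2 * m)
    (v4 : b + m < x → x ≤ c + m → y + x = b + m + c + 1 ∨ y + x = b + m + c + 1 + 2 * m)
    (v5 : c + m < x →
      y + x = c + m + (a + m) + 1 ∨ y + x = c + m + (a + m) + 1 + 2 * m)
    (v6 : x ≤ a →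
      y + (x + 2 * m) = c + m + (a + m) + 1 ∨ y + (x + 2 * m) = c + m + (a + m) + 1 + 2 * m) :
    y = arcReversal m a b c x := by
  unfold arcReversal
  split_ifs
  · replace v6 := v6 (by omega)
    clear v0 v1 v2 v3 v4 v5
    omega
  · replace v0 := v0 (by omega) (by omega)
    clear v1 v2 v3 v4 v5 v6
    omega
  · replace v1 := v1 (by omega) (by omega)
    clear v0 v2 v3 v4 v5 v6
    omega
  · replace v2 := v2 (by omega) (by omega)
    clear v0 v1 v3 v4 v5 v6
    omega
  · replace v2 := v2 (by omega) (by omega)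
    clear v0 v1 v3 v4 v5 v6
    omega
  · replace v3 := v3 (by omega) (by omega)
    clear v0 v1 v2 v4 v5 v6
    omega
  · replace v4 := v4 (by omega) (by omega)
    clear v0 v1 v2 v3 v5 v6
    omega
  · replace v5 := v5 (by omega)
    clear v0 v1 v2 v3 v4 v6
    omega

theorem exists_eq_arcReversal {N : ℕ} {α : Equiv.Perm (Fin N)} (hG : IsGenusOne α)
    (hP : IsPartitionPerm α) (h1 : ∀ i, α i ≠ i) (h2 : ∀ i, α i ≠ finRotate N i) :
    ∃ m a b c, N = 2 * m ∧ a < b ∧ b ≤ c ∧ c < m ∧ ∀ x, (α x).val = arcReversal m a b c x := by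
  have hα := hP.involutive_of_isGenusOne hG h1 h2
  obtain ⟨h0, h6⟩ := longPoints_card_mem_Icc hG hα h1 h2
  obtain ⟨K, hK⟩ : ∃ K, (longPoints (α⁻¹ * finRotate N)).card = K := ⟨_, rfl⟩
  rw [hK] at h0 h6
  let e : Fin K ↪o Fin N := (longPoints (α⁻¹ * finRotate N)).orderEmbOfFin hK
  have he : ∀ x, x ∈ longPoints (α⁻¹ * finRotate N) ↔ ∃ k, e k = x := fun x => by
    have := Finset.range_orderEmbOfFin (longPoints (α⁻¹ * finRotate N)) hK
    rw [← Finset.mem_coe, ← this]; rfl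
  obtain ⟨π, p1, p2, p3, p4, hgap, hdesc⟩ := exists_arc_matching hα h1 h2 e he
  obtain ⟨hK', hπ⟩ := arc_matching_antipodal h0 h6 π p1 p2 p3 p4
  have hmono : ∀ i j : Fin K, i < j → (e i).val < (e j).val := fun i j h => e.strictMono h
  have hval : ∀ (k : Fin K) (x : Fin N) (w : ℕ), (e k).val < w → w ≤ (e k).val + gap e k →
      (w = x ∨ w = x + N) →
      ((α x).val + w = (e k).val + (e (finRotate K (π k))).val + 1 ∨
        (α x).val + w = (e k).val + (e (finRotate K (π k))).val + 1 + N) := by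
    intro k x w hw hw' hx
    obtain ⟨s, rfl⟩ : ∃ s, w = (e k).val + s + 1 := ⟨w - (e k).val - 1, by omega⟩
    have hd := congrArg Fin.val (hdesc k s (by omega))
    have hxe : (finRotate N ^ (s + 1)) (e k) = x := by
      apply Fin.ext
      rw [finRotate_pow_val, ← add_assoc]
      rcases hx with hx | hx
      · rw [hx, Nat.mod_eq_of_lt x.isLt]
      · rw [hx, Nat.add_mod_right, Nat.mod_eq_of_lt x.isLt]
    rw [hxe, finRotate_pow_val] at hd
    have hgl := gap_le e k
    have hl := (α x).isLt
    rcases lt_or_ge ((α x).val + s) N with h | h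
    · rw [Nat.mod_eq_of_lt h] at hd; omega
    · rw [Nat.mod_eq_sub_mod h, Nat.mod_eq_of_lt (by omega)] at hd; omega
  have hlt : ∀ k, (e k).val < N := fun k => (e k).isLt
  rcases hK' with rfl | rfl
  · have hπ0 : π 0 = 2 := Fin.ext (hπ 0)
    have hπ1 : π 1 = 3 := Fin.ext (hπ 1)
    have hπ2 : π 2 = 0 := Fin.ext (hπ 2)
    have hπ3 : π 3 = 1 := Fin.ext (hπ 3)
    have l0 := hmono 0 1 (by decide)
    have l1 := hmono 1 2 (by decide)
    have l2 := hmono 2 3 (by decide)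
    have l3 := hlt 3
    have g0 : gap e 0 = (e 1).val - e 0 := by
      unfold gap; rw [show finRotate 4 0 = 1 from by decide, if_pos l0]
    have g1 : gap e 1 = (e 2).val - e 1 := by
      unfold gap; rw [show finRotate 4 1 = 2 from by decide, if_pos l1]
    have g2 : gap e 2 = (e 3).val - e 2 := by
      unfold gap; rw [show finRotate 4 2 = 3 from by decide, if_pos l2]
    have g3 : gap e 3 = N + (e 0).val - e 3 := by
      unfold gap; rw [show finRotate 4 3 = 0 from by decide, if_neg (by omega)]
    have q0 := hgap 0
    have q1 := hgap 1
    rw [hπ0, g0, g2] at q0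
    rw [hπ1, g1, g3] at q1
    obtain ⟨m, hm⟩ : ∃ m, (e 2).val = e 0 + m := ⟨(e 2).val - e 0, by omega⟩
    have e3 : (e 3).val = e 1 + m := by omega
    obtain rfl : N = 2 * m := by omega
    refine ⟨m, e 0, e 1, e 1, rfl, l0, le_rfl, by omega, fun x => ?_⟩
    have v0 := hval 0 x x
    have v2 := hval 1 x x
    have v3 := hval 2 x x
    have v5 := hval 3 x x
    have v6 := hval 3 x (x + 2 * m)
    rw [hπ0, show finRotate 4 2 = 3 from by decide, g0, e3] at v0
    rw [hπ1, show finRotate 4 3 = 0 from by decide, g1] at v2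
    rw [hπ2, show finRotate 4 0 = 1 from by decide, g2, hm] at v3
    rw [hπ3, show finRotate 4 1 = 2 from by decide, g3, e3, hm] at v5 v6
    have hx := x.isLt
    exact eq_arcReversal l0 le_rfl (by omega) hx (α x).isLt
      (fun h h' => v0 h (by omega) (.inl rfl)) (fun h h' => by omega)
      (fun h h' => v2 h (by omega) (.inl rfl)) (fun h h' => v3 h (by omega) (.inl rfl))
      (fun h h' => by omega) (fun h => v5 h (by omega) (.inl rfl))
      (fun h => v6 (by omega) (by omega) (.inr rfl))
  · have hπ0 : π 0 = 3 := Fin.ext (hπ 0)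
    have hπ1 : π 1 = 4 := Fin.ext (hπ 1)
    have hπ2 : π 2 = 5 := Fin.ext (hπ 2)
    have hπ3 : π 3 = 0 := Fin.ext (hπ 3)
    have hπ4 : π 4 = 1 := Fin.ext (hπ 4)
    have hπ5 : π 5 = 2 := Fin.ext (hπ 5)
    have l0 := hmono 0 1 (by decide)
    have l1 := hmono 1 2 (by decide)
    have l2 := hmono 2 3 (by decide)
    have l3 := hmono 3 4 (by decide)
    have l4 := hmono 4 5 (by decide)
    have l5 := hlt 5
    have g0 : gap e 0 = (e 1).val - e 0 := by
      unfold gap; rw [show finRotate 6 0 = 1 from by decide, if_pos l0]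
    have g1 : gap e 1 = (e 2).val - e 1 := by
      unfold gap; rw [show finRotate 6 1 = 2 from by decide, if_pos l1]
    have g2 : gap e 2 = (e 3).val - e 2 := by
      unfold gap; rw [show finRotate 6 2 = 3 from by decide, if_pos l2]
    have g3 : gap e 3 = (e 4).val - e 3 := by
      unfold gap; rw [show finRotate 6 3 = 4 from by decide, if_pos l3]
    have g4 : gap e 4 = (e 5).val - e 4 := by
      unfold gap; rw [show finRotate 6 4 = 5 from by decide, if_pos l4]
    have g5 : gap e 5 = N + (e 0).val - e 5 := by
      unfold gap; rw [show finRotate 6 5 = 0 from by decide, if_neg (by omega)]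
    have q0 := hgap 0
    have q1 := hgap 1
    have q2 := hgap 2
    rw [hπ0, g0, g3] at q0
    rw [hπ1, g1, g4] at q1
    rw [hπ2, g2, g5] at q2
    obtain ⟨m, hm⟩ : ∃ m, (e 3).val = e 0 + m := ⟨(e 3).val - e 0, by omega⟩
    have e4 : (e 4).val = e 1 + m := by omega
    have e5 : (e 5).val = e 2 + m := by omega
    obtain rfl : N = 2 * m := by omega
    refine ⟨m, e 0, e 1, e 2, rfl, l0, l1.le, by omega, fun x => ?_⟩
    have v0 := hval 0 x x
    have v1 := hval 1 x x
    have v2 := hval 2 x x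
    have v3 := hval 3 x x
    have v4 := hval 4 x x
    have v5 := hval 5 x x
    have v6 := hval 5 x (x + 2 * m)
    rw [hπ0, show finRotate 6 3 = 4 from by decide, g0, e4] at v0
    rw [hπ1, show finRotate 6 4 = 5 from by decide, g1, e5] at v1
    rw [hπ2, show finRotate 6 5 = 0 from by decide, g2] at v2
    rw [hπ3, show finRotate 6 0 = 1 from by decide, g3, hm] at v3
    rw [hπ4, show finRotate 6 1 = 2 from by decide, g4, e4] at v4
    rw [hπ5, show finRotate 6 2 = 3 from by decide, g5, e5, hm] at v5 v6
    have hx := x.isLt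
    exact eq_arcReversal l0 l1.le (by omega) hx (α x).isLt
      (fun h h' => v0 h (by omega) (.inl rfl)) (fun h h' => v1 h (by omega) (.inl rfl))
      (fun h h' => v2 h (by omega) (.inl rfl)) (fun h h' => v3 h (by omega) (.inl rfl))
      (fun h h' => v4 h (by omega) (.inl rfl)) (fun h => v5 h (by omega) (.inl rfl))
      (fun h => v6 (by omega) (by omega) (.inr rfl))

/-- The composition of `arcReversal m a b c` with the cyclic shift of `{0, …, 2m - 1}`. -/
def arcStep (m a b c x : ℕ) : ℕ :=
  if x < a then a + c - x
  else if x < b then a + b + m - x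
  else if x < c then b + c + m - x
  else if x < a + m then (if x ≤ a + c then a + c - x else a + c + 2 * m - x)
  else if x < b + m then a + b + m - x
  else if x < c + m then b + c + m - x
  else a + c + 2 * m - x

section
variable {m a b c x : ℕ}

theorem arcReversal_lt (hab : a < b) (hbc : b ≤ c) (hcm : c < m) (hx : x < 2 * m) :
    arcReversal m a b c x < 2 * m := by
  unfold arcReversal; split_ifs <;> omega

set_option maxHeartbeats 1000000 in
theorem arcReversal_arcReversal (hab : a < b) (hbc : b ≤ c) (hcm : c < m) (hx : x < 2 * m) :
    arcReversal m a b c (arcReversal m a b c x) = x := by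
  obtain ⟨y, hy⟩ : ∃ y, arcReversal m a b c x = y := ⟨_, rfl⟩
  rw [hy]
  unfold arcReversal at hy ⊢
  split_ifs at hy <;> split_ifs <;> omega

theorem arcReversal_ne_self (hab : a < b) (hbc : b ≤ c) (hcm : c < m) (hx : x < 2 * m) :
    arcReversal m a b c x ≠ x := by
  unfold arcReversal; split_ifs <;> omega

theorem arcReversal_ne_succ (hab : a < b) (hbc : b ≤ c) (hcm : c < m) (hx : x < 2 * m) :
    arcReversal m a b c x ≠ (x + 1) % (2 * m) := by
  rcases eq_or_ne (x + 1) (2 * m) with h | h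
  · rw [h, Nat.mod_self]
    unfold arcReversal; split_ifs <;> omega
  · rw [Nat.mod_eq_of_lt (by omega)]
    unfold arcReversal; split_ifs <;> omega

set_option maxHeartbeats 1000000 in
theorem arcReversal_succ (hab : a < b) (hbc : b ≤ c) (hcm : c < m) (hx : x < 2 * m) :
    arcReversal m a b c ((x + 1) % (2 * m)) = arcStep m a b c x := by
  rcases eq_or_ne (x + 1) (2 * m) with h | h
  · rw [h, Nat.mod_self]
    unfold arcReversal arcStep; split_ifs <;> omega
  · rw [Nat.mod_eq_of_lt (by omega)]
    unfold arcReversal arcStep; split_ifs <;> omega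

set_option maxHeartbeats 1000000 in
theorem arcStep_arcStep_eq_iff (hab : a < b) (hbc : b ≤ c) (hcm : c < m) (hx : x < 2 * m) :
    arcStep m a b c (arcStep m a b c x) ≠ x ↔
      x = a ∨ x = b ∨ x = c ∨ x = a + m ∨ x = b + m ∨ x = c + m := by
  obtain ⟨y, hy⟩ : ∃ y, arcStep m a b c x = y := ⟨_, rfl⟩
  rw [hy]
  unfold arcStep at hy ⊢
  split_ifs at hy <;> split_ifs <;> omega

theorem arcStep_pow_three (hab : a < b) (hbc : b < c) (hcm : c < m)
    (hx : x = a ∨ x = b ∨ x = c ∨ x = a + m ∨ x = b + m ∨ x = c + m) :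
    arcStep m a b c (arcStep m a b c (arcStep m a b c x)) = x := by
  have h1 : arcStep m a b c a = b + m := by unfold arcStep; split_ifs <;> omega
  have h2 : arcStep m a b c (b + m) = c := by unfold arcStep; split_ifs <;> omega
  have h3 : arcStep m a b c c = a := by unfold arcStep; split_ifs <;> omega
  have h4 : arcStep m a b c (a + m) = b := by unfold arcStep; split_ifs <;> omega
  have h5 : arcStep m a b c b = c + m := by unfold arcStep; split_ifs <;> omega
  have h6 : arcStep m a b c (c + m) = a + m := by unfold arcStep; split_ifs <;> omega
  rcases hx with rfl | rfl | rfl | rfl | rfl | rfl <;> simp only [h1, h2, h3, h4, h5, h6]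

theorem arcStep_pow_four (hab : a < b) (hbm : b < m)
    (hx : x = a ∨ x = b ∨ x = a + m ∨ x = b + m) :
    arcStep m a b b (arcStep m a b b (arcStep m a b b (arcStep m a b b x))) = x := by
  have h1 : arcStep m a b b a = b + m := by unfold arcStep; split_ifs <;> omega
  have h2 : arcStep m a b b (b + m) = a + m := by unfold arcStep; split_ifs <;> omega
  have h3 : arcStep m a b b (a + m) = b := by unfold arcStep; split_ifs <;> omega
  have h4 : arcStep m a b b b = a := by unfold arcStep; split_ifs <;> omega
  rcases hx with rfl | rfl | rfl | rfl <;> simp only [h1, h2, h3, h4]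

end

/-- `arcReversal m a b c` as a permutation. -/
def arcPerm {m a b c : ℕ} (hab : a < b) (hbc : b ≤ c) (hcm : c < m) :
    Equiv.Perm (Fin (2 * m)) :=
  Function.Involutive.toPerm
    (fun x => ⟨arcReversal m a b c x, arcReversal_lt hab hbc hcm x.isLt⟩)
    fun x => Fin.ext (arcReversal_arcReversal hab hbc hcm x.isLt)

theorem isPartitionPerm_of_involutive {n : ℕ} {α : Equiv.Perm (Fin n)}
    (h : ∀ i, α (α i) = i) : IsPartitionPerm α := by
  rintro i ⟨hi, j, hj, hji⟩
  rw [sameCycle_iff_exists_lt (r := 2) (by norm_num) (by simpa [pow_two] using h i)] at hj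
  obtain ⟨t, ht, rfl⟩ := hj
  interval_cases t
  · exact absurd hi (not_lt.2 hji.le)
  · exact absurd hji (lt_irrefl _)

section
variable {m a b c : ℕ} (hab : a < b) (hbc : b ≤ c) (hcm : c < m)

theorem arcPerm_val (x : Fin (2 * m)) :
    (arcPerm hab hbc hcm x).val = arcReversal m a b c x := rfl

theorem arcPerm_arcPerm (x : Fin (2 * m)) :
    arcPerm hab hbc hcm (arcPerm hab hbc hcm x) = x :=
  Fin.ext (arcReversal_arcReversal hab hbc hcm x.isLt)

theorem arcPerm_ne_self (x : Fin (2 * m)) : arcPerm hab hbc hcm x ≠ x := fun h =>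
  arcReversal_ne_self hab hbc hcm x.isLt (congrArg Fin.val h)

theorem arcPerm_ne_finRotate (x : Fin (2 * m)) :
    arcPerm hab hbc hcm x ≠ finRotate (2 * m) x := fun h =>
  arcReversal_ne_succ hab hbc hcm x.isLt (by rw [← arcPerm_val hab hbc hcm, h, finRotate_val])

theorem arcPerm_inv_mul_finRotate_val (x : Fin (2 * m)) :
    (((arcPerm hab hbc hcm)⁻¹ * finRotate (2 * m)) x).val = arcStep m a b c x := by
  have hinv : (arcPerm hab hbc hcm)⁻¹ = arcPerm hab hbc hcm := by
    ext i; rw [Equiv.Perm.inv_eq_iff_eq.2 (arcPerm_arcPerm hab hbc hcm i).symm]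
  rw [hinv, Equiv.Perm.mul_apply, arcPerm_val, finRotate_val, arcReversal_succ hab hbc hcm x.isLt]

theorem mem_longPoints_arcPerm (x : Fin (2 * m)) :
    x ∈ longPoints ((arcPerm hab hbc hcm)⁻¹ * finRotate (2 * m)) ↔
      x.val = a ∨ x.val = b ∨ x.val = c ∨ x.val = a + m ∨ x.val = b + m ∨ x.val = c + m := by
  rw [mem_longPoints, ← arcStep_arcStep_eq_iff hab hbc hcm x.isLt, ne_eq, Fin.ext_iff,
    arcPerm_inv_mul_finRotate_val, arcPerm_inv_mul_finRotate_val]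

theorem isGenusOne_arcPerm : IsGenusOne (arcPerm hab hbc hcm) := by
  have hz := two_mul_zPerm_of_involutive (arcPerm_ne_self hab hbc hcm)
    (arcPerm_arcPerm hab hbc hcm)
  have hmem := mem_longPoints_arcPerm hab hbc hcm
  have hval := arcPerm_inv_mul_finRotate_val hab hbc hcm
  unfold IsGenusOne
  set β := (arcPerm hab hbc hcm)⁻¹ * finRotate (2 * m) with hβdef
  have hβ : ∀ i, β i ≠ i := fun i h => by
    rw [hβdef, Equiv.Perm.mul_apply, Equiv.Perm.inv_eq_iff_eq] at h
    exact arcPerm_ne_finRotate hab hbc hcm i h.symm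
  have hcard : (longPoints β).card = (({a, b, c, a + m, b + m, c + m} : Finset ℕ)).card := by
    rw [← Finset.card_map Fin.valEmbedding]
    congr 1
    ext y
    simp only [Finset.mem_map, hmem, Fin.valEmbedding_apply, Finset.mem_insert,
      Finset.mem_singleton]
    constructor
    · rintro ⟨x, hx, rfl⟩; exact hx
    · intro hy; exact ⟨⟨y, by omega⟩, hy, rfl⟩
  rcases hbc.eq_or_lt with rfl | hlt
  · have h4 : (longPoints β).card = 4 := by
      rw [hcard, show ({a, b, b, a + m, b + m, b + m} : Finset ℕ) = {a, b, a + m, b + m} by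
        ext y; simp]
      rw [Finset.card_insert_of_notMem, Finset.card_insert_of_notMem, Finset.card_pair] <;>
      simp <;> omega
    have := two_mul_zPerm_of_longPoints hβ 4 fun i hi =>
      cycleCard_of_four (mem_longPoints.1 hi) (Fin.ext (by
        rw [hval, hval, hval, hval]
        have := (hmem i).1 hi
        exact arcStep_pow_four hab hcm (by omega)))
    rw [h4] at this
    have h' : (2 * zPerm β : ℚ) + 4 = (2 * m + 2 : ℕ) := by push_cast at *; linarith
    have : 2 * zPerm β + 4 = 2 * m + 2 := by exact_mod_cast h'
    omega
  · have h6 : (longPoints β).card = 6 := by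
      rw [hcard]
      rw [Finset.card_insert_of_notMem, Finset.card_insert_of_notMem,
        Finset.card_insert_of_notMem, Finset.card_insert_of_notMem, Finset.card_pair] <;>
      simp <;> omega
    have := two_mul_zPerm_of_longPoints hβ 3 fun i hi =>
      cycleCard_of_three (hβ i) (Fin.ext (by
        rw [hval, hval, hval]
        exact arcStep_pow_three hab hlt hcm ((hmem i).1 hi)))
    rw [h6] at this
    have h' : (2 * zPerm β : ℚ) + 6 = (2 * m + 4 : ℕ) := by push_cast at *; linarith
    have : 2 * zPerm β + 6 = 2 * m + 4 := by exact_mod_cast h'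
    omega

theorem arcPerm_injective {a' b' c' : ℕ} (hab' : a' < b') (hbc' : b' ≤ c') (hcm' : c' < m)
    (h : arcPerm hab hbc hcm = arcPerm hab' hbc' hcm') : a = a' ∧ b = b' ∧ c = c' := by
  have key : ∀ x < m, (x = a ∨ x = b ∨ x = c) ↔ (x = a' ∨ x = b' ∨ x = c') := by
    intro x hx
    have h1 := mem_longPoints_arcPerm hab hbc hcm ⟨x, by omega⟩
    have h2 := mem_longPoints_arcPerm hab' hbc' hcm' ⟨x, by omega⟩
    rw [h] at h1
    have := h1.symm.trans h2
    simp only at this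
    omega
  have ka := key a (by omega)
  have kb := key b (by omega)
  have kc := key c (by omega)
  have ka' := key a' (by omega)
  have kb' := key b' (by omega)
  have kc' := key c' (by omega)
  omega

end

theorem card_arc_triples (m : ℕ) :
    Nat.card {p : ℕ × ℕ × ℕ // p.1 < p.2.1 ∧ p.2.1 ≤ p.2.2 ∧ p.2.2 < m} =
      (m + 1).choose 3 := by
  let s : Finset (Σ _ : ℕ, Σ _ : ℕ, ℕ) :=
    (Finset.range m).sigma fun c => (Finset.range (c + 1)).sigma fun b => Finset.range b
  have hs : ∀ x, x ∈ s ↔ x.2.2 < x.2.1 ∧ x.2.1 ≤ x.1 ∧ x.1 < m := fun x => by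
    simp only [s, Finset.mem_sigma, Finset.mem_range]; omega
  let F : {p : ℕ × ℕ × ℕ // p.1 < p.2.1 ∧ p.2.1 ≤ p.2.2 ∧ p.2.2 < m} ≃ s :=
    { toFun := fun p => ⟨⟨p.1.2.2, p.1.2.1, p.1.1⟩, (hs _).2 p.2⟩
      invFun := fun x => ⟨⟨x.1.2.2, x.1.2.1, x.1.1⟩, (hs _).1 x.2⟩
      left_inv := fun p => rfl
      right_inv := fun x => rfl }
  have h2 : ∀ n, ∑ b ∈ Finset.range n, b = n.choose 2 := fun n => by
    induction n with
    | zero => rfl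
    | succ n ih => rw [Finset.sum_range_succ, ih, Nat.choose_succ_succ' n 1]; simp [add_comm]
  have h3 : ∀ m, ∑ c ∈ Finset.range m, (c + 1).choose 2 = (m + 1).choose 3 := fun m => by
    induction m with
    | zero => rfl
    | succ n ih => rw [Finset.sum_range_succ, ih, Nat.choose_succ_succ' (n + 1) 2, add_comm]
  rw [Nat.card_congr F, Nat.card_eq_fintype_card, Fintype.card_coe]
  simp only [s, Finset.card_sigma, Finset.card_range, h2, h3]

/-- The number of genus one partitions whose blocks all
have at least two points and in which no point is followed by its successor. -/
noncomputable def reducedCount (N : ℕ) : ℕ :=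
  Nat.card {α : Equiv.Perm (Fin N) // (IsGenusOne α ∧ IsPartitionPerm α ∧ ∀ i, α i ≠ i) ∧
    ∀ i, α i ≠ finRotate N i}

theorem reducedCount_odd (m : ℕ) : reducedCount (2 * m + 1) = 0 := by
  rw [reducedCount, Nat.card_eq_zero]
  refine Or.inl ⟨fun α => ?_⟩
  obtain ⟨m', a, b, c, h, -⟩ := exists_eq_arcReversal α.2.1.1 α.2.1.2.1 α.2.1.2.2 α.2.2
  omega

theorem reducedCount_even (m : ℕ) : reducedCount (2 * m) = (m + 1).choose 3 := by
  let T := {p : ℕ × ℕ × ℕ // p.1 < p.2.1 ∧ p.2.1 ≤ p.2.2 ∧ p.2.2 < m}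
  let F : T → {α : Equiv.Perm (Fin (2 * m)) //
      (IsGenusOne α ∧ IsPartitionPerm α ∧ ∀ i, α i ≠ i) ∧ ∀ i, α i ≠ finRotate (2 * m) i} :=
    fun p => ⟨arcPerm p.2.1 p.2.2.1 p.2.2.2,
      ⟨isGenusOne_arcPerm _ _ _, isPartitionPerm_of_involutive (arcPerm_arcPerm _ _ _),
        arcPerm_ne_self _ _ _⟩, arcPerm_ne_finRotate _ _ _⟩
  have hF : Function.Bijective F := by
    constructor
    · rintro ⟨⟨a, b, c⟩, h1, h2, h3⟩ ⟨⟨a', b', c'⟩, h1', h2', h3'⟩ h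
      obtain ⟨h, h', h''⟩ := arcPerm_injective h1 h2 h3 h1' h2' h3' (congrArg Subtype.val h)
      simp only at h h' h''
      subst h h' h''
      rfl
    · rintro ⟨α, ⟨hG, hP, h1⟩, h2⟩
      obtain ⟨m', a, b, c, h, hab, hbc, hcm, hα⟩ := exists_eq_arcReversal hG hP h1 h2
      obtain rfl : m = m' := by omega
      exact ⟨⟨⟨a, b, c⟩, hab, hbc, hcm⟩, Subtype.ext (Equiv.ext fun x => Fin.ext (hα x).symm)⟩
  rw [reducedCount, ← Nat.card_congr (Equiv.ofBijective F hF)]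
  exact card_arc_triples m

/-- `α` is obtained from `α'` by inserting, outside the range of `e`, points which are sent
to their cyclic successor. -/
structure IsExpansion {N n : ℕ} (e : Fin N ↪o Fin n) (α' : Equiv.Perm (Fin N))
    (α : Equiv.Perm (Fin n)) : Prop where
  apply_of_forall_ne : ∀ x, (∀ k, e k ≠ x) → α x = finRotate n x
  apply_of_finRotate_eq : ∀ k k', finRotate N k' = α' k → α (e k) = finRotate n (e k')

namespace IsExpansion

variable {N n : ℕ} {e : Fin N ↪o Fin n} {α' : Equiv.Perm (Fin N)} {α : Equiv.Perm (Fin n)}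

theorem pow_apply (h : IsExpansion e α' α) {k k' : Fin N} (hk : finRotate N k' = α' k) {s : ℕ}
    (hs : s + 1 ≤ gap e k') : (α ^ (s + 1)) (e k) = (finRotate n ^ (s + 1)) (e k') := by
  induction s with
  | zero => simpa using h.apply_of_finRotate_eq k k' hk
  | succ s ih =>
    rw [pow_succ' α, Equiv.Perm.mul_apply, ih (by omega), h.apply_of_forall_ne,
      ← Equiv.Perm.mul_apply, ← pow_succ']
    intro j
    exact (finRotate_pow_ne_of_lt_gap e k' (by omega) (by omega) j).symm

theorem pow_gap_apply (h : IsExpansion e α' α) {k k' : Fin N} (hk : finRotate N k' = α' k) :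
    (α ^ gap e k') (e k) = e (α' k) := by
  have hg := gap_pos e k'
  have := h.pow_apply hk (s := gap e k' - 1) (by omega)
  rw [show gap e k' - 1 + 1 = gap e k' by omega] at this
  rw [this, finRotate_pow_gap, hk]

theorem sameCycle_step (h : IsExpansion e α' α) (k : Fin N) :
    α.SameCycle (e k) (e (α' k)) := by
  obtain ⟨k', hk⟩ := (finRotate N).surjective (α' k)
  exact ⟨gap e k', by rw [zpow_natCast]; exact h.pow_gap_apply hk⟩

theorem sameCycle_iff (h : IsExpansion e α' α) {k l : Fin N} :
    α.SameCycle (e k) (e l) ↔ α'.SameCycle k l := by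
  constructor
  · intro hkl
    obtain ⟨t, -, ht⟩ := hkl.exists_pow_eq'
    induction t using Nat.strong_induction_on generalizing k with
    | _ t ih =>
      rcases Nat.eq_zero_or_pos t with rfl | h0
      · rw [show k = l from e.injective (by simpa using ht)]
      obtain ⟨k', hk⟩ := (finRotate N).surjective (α' k)
      rcases lt_or_ge t (gap e k') with hlt | hge
      · have := h.pow_apply hk (s := t - 1) (by omega)
        rw [show t - 1 + 1 = t by omega, ht] at this
        exact absurd this.symm (finRotate_pow_ne_of_lt_gap e k' h0 hlt l)
      · obtain ⟨s, rfl⟩ := Nat.exists_eq_add_of_le hge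
        rw [add_comm, pow_add, Equiv.Perm.mul_apply, h.pow_gap_apply hk] at ht
        have hg := gap_pos e k'
        have := ih s (by omega) ⟨s, by rw [zpow_natCast]; exact ht⟩ ht
        exact Equiv.Perm.sameCycle_apply_left.1 this
  · intro hkl
    obtain ⟨t, -, ht⟩ := hkl.exists_pow_eq'
    clear hkl
    induction t generalizing k with
    | zero => rw [show k = l by simpa using ht]
    | succ t ih =>
      rw [pow_succ, Equiv.Perm.mul_apply] at ht
      exact (h.sameCycle_step k).trans (ih ht)

theorem exists_sameCycle (h : IsExpansion e α' α) (hN : 0 < N) (x : Fin n) :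
    ∃ k, α.SameCycle x (e k) := by
  obtain ⟨s, k, hs⟩ : ∃ (s : ℕ) (k : Fin N), (finRotate n ^ s) x = e k := by
    refine ⟨(e ⟨0, hN⟩).val + (n - x.val), ⟨0, hN⟩, Fin.ext ?_⟩
    rw [finRotate_pow_val, show x.val + ((e ⟨0, hN⟩).val + (n - x.val)) = (e ⟨0, hN⟩).val + n by
      omega, Nat.add_mod_right, Nat.mod_eq_of_lt (Fin.isLt _)]
  induction s generalizing x with
  | zero => exact ⟨k, by rw [show x = e k by simpa using hs]⟩
  | succ s ih =>
    by_cases hx : ∃ l, e l = x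
    · obtain ⟨l, rfl⟩ := hx
      exact ⟨l, .refl _ _⟩
    · push Not at hx
      rw [pow_succ, Equiv.Perm.mul_apply, ← h.apply_of_forall_ne x hx] at hs
      obtain ⟨l, hl⟩ := ih _ hs
      exact ⟨l, Equiv.Perm.sameCycle_apply_left.1 hl⟩

theorem zPerm_eq (h : IsExpansion e α' α) (hN : 0 < N) : zPerm α = zPerm α' := by
  let F : Quotient (cycleSetoid α') → Quotient (cycleSetoid α) :=
    Quotient.map e fun k l hkl => h.sameCycle_iff.2 hkl
  refine (Nat.card_congr (Equiv.ofBijective F ⟨?_, ?_⟩)).symm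
  · rintro ⟨k⟩ ⟨l⟩ hkl
    exact Quotient.sound (h.sameCycle_iff.1 (Quotient.exact hkl))
  · rintro ⟨x⟩
    obtain ⟨k, hk⟩ := h.exists_sameCycle hN x
    exact ⟨Quotient.mk _ k, Quotient.sound hk.symm⟩

theorem isReducedPerm_iff (h : IsExpansion e α' α) (hN : 0 < N)
    (hne : ∀ k, α' k ≠ finRotate N k) : IsReducedPerm α ↔ ∀ k, α' k ≠ k := by
  constructor
  · intro hr k hk
    obtain ⟨k', hk'⟩ := (finRotate N).surjective (α' k)
    have hg := gap_pos e k'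
    have hgl := gap_le e k'
    have hpow : ∀ t, (finRotate n ^ t) (finRotate n (e k')) = (finRotate n ^ (t + 1)) (e k') :=
      fun t => by rw [pow_succ]; rfl
    refine hr ⟨finRotate n (e k'), gap e k' - 1, by omega, fun t ht => ?_, ?_⟩
    · rw [hpow, h.apply_of_forall_ne, hpow, pow_succ' _ (t + 1)]
      · rfl
      · exact fun j => (finRotate_pow_ne_of_lt_gap e k' (by omega) (by omega) j).symm
    · rw [hpow, show gap e k' - 1 + 1 = gap e k' by omega, finRotate_pow_gap, hk', hk]
      exact h.apply_of_finRotate_eq k k' hk'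
  · rintro hf ⟨i, p, -, hstep, hlast⟩
    have hpow : ∀ t ≤ p, (α ^ t) i = (finRotate n ^ t) i := by
      intro t
      induction t with
      | zero => simp
      | succ t ih =>
        intro ht
        rw [pow_succ', Equiv.Perm.mul_apply, ih (by omega), hstep t (by omega)]
    have horb : ∀ k, α.SameCycle i (e k) → e k = (finRotate n ^ p) i := by
      intro k hk
      rw [sameCycle_iff_exists_lt (r := p + 1) (by omega)
        (by rw [pow_succ', Equiv.Perm.mul_apply, hpow p le_rfl, hlast])] at hk
      obtain ⟨t, ht, hk⟩ := hk
      rw [hpow t (by omega)] at hk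
      rcases (Nat.lt_succ_iff.1 ht).eq_or_lt with rfl | hlt
      · exact hk.symm
      · have hs := hstep t hlt
        obtain ⟨k', hk'⟩ := (finRotate N).surjective (α' k)
        rw [hk, h.apply_of_finRotate_eq k k' hk', pow_succ', Equiv.Perm.mul_apply, hk,
          (finRotate n).injective.eq_iff, e.injective.eq_iff] at hs
        exact absurd (by rw [← hk', hs]) (hne k)
    obtain ⟨k, hk⟩ := h.exists_sameCycle hN i
    exact hf k (e.injective ((horb _ (hk.trans (h.sameCycle_step k))).trans (horb k hk).symm))

theorem isPartitionPerm_iff (h : IsExpansion e α' α) (hf : ∀ k, α' k ≠ k) :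
    IsPartitionPerm α ↔ IsPartitionPerm α' := by
  constructor
  · rintro hP k ⟨hk, l, hkl, hl⟩
    obtain ⟨k', hk'⟩ := (finRotate N).surjective (α' k)
    have hv := congrArg Fin.val hk'
    rw [finRotate_val] at hv
    have hlt : k'.val + 1 < N := by
      rcases lt_or_ge (k'.val + 1) N with hc | hc
      · exact hc
      · rw [show k'.val + 1 = N by omega, Nat.mod_self] at hv
        rw [Fin.lt_def] at hl; omega
    rw [Nat.mod_eq_of_lt hlt] at hv
    have h1 : e k' < e (α' k) := e.strictMono (by rw [Fin.lt_def]; omega)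
    have h2 : e (α' k) < e k := e.strictMono hk
    have h3 : e l ≤ e k' := e.monotone (by rw [Fin.lt_def] at hl; rw [Fin.le_def]; omega)
    have hval : (α (e k)).val = e k' + 1 := by
      rw [h.apply_of_finRotate_eq k k' hk', finRotate_val, Nat.mod_eq_of_lt]
      rw [Fin.lt_def] at h1; omega
    refine hP (e k) ⟨?_, e l, h.sameCycle_iff.2 hkl, ?_⟩
    · rw [Fin.lt_def] at *; omega
    · rw [Fin.le_def] at h3; rw [Fin.lt_def]; omega
  · rintro hP i ⟨hi, j, hij, hj⟩
    rw [Fin.lt_def] at hi hj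
    have hnz : ∀ x, α i = finRotate n x → (α i).val = x + 1 := by
      intro x hx
      have hv := congrArg Fin.val hx
      rw [finRotate_val] at hv
      rcases lt_or_ge (x.val + 1) n with hc | hc
      · rw [hv, Nat.mod_eq_of_lt hc]
      · rw [show x.val + 1 = n by omega, Nat.mod_self] at hv; omega
    by_cases hx : ∃ l, e l = i
    · obtain ⟨k, rfl⟩ := hx
      obtain ⟨k', hk'⟩ := (finRotate N).surjective (α' k)
      have hv := hnz _ (h.apply_of_finRotate_eq k k' hk')
      have hlt : k' < k := e.lt_iff_lt.1 (by rw [Fin.lt_def]; omega)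
      have hv' := congrArg Fin.val hk'
      rw [finRotate_val, Nat.mod_eq_of_lt (by rw [Fin.lt_def] at hlt; omega)] at hv'
      have key : ∀ (d : ℕ) (x : Fin n), x.val + d = e k' → ∃ l ≤ k', α.SameCycle x (e l) := by
        intro d
        induction d with
        | zero => exact fun x hx => ⟨k', le_rfl, by rw [show x = e k' from Fin.ext hx]⟩
        | succ d ih =>
          intro x hx
          by_cases hr : ∃ l, e l = x
          · obtain ⟨l, rfl⟩ := hr
            exact ⟨l, e.le_iff_le.1 (by rw [Fin.le_def]; omega), .refl _ _⟩
          · push Not at hr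
            obtain ⟨l, hl, hl'⟩ := ih (α x) (by
              rw [h.apply_of_forall_ne x hr, finRotate_val, Nat.mod_eq_of_lt] <;> omega)
            exact ⟨l, hl, Equiv.Perm.sameCycle_apply_left.1 hl'⟩
      obtain ⟨l, hl, hl'⟩ := key (e k' - j) j (by omega)
      have hne : (α' k).val ≠ k := fun hc => hf k (Fin.ext hc)
      rw [Fin.lt_def] at hlt
      rw [Fin.le_def] at hl
      exact hP k ⟨by rw [Fin.lt_def]; omega, l, h.sameCycle_iff.1 (hij.trans hl'),
        by rw [Fin.lt_def]; omega⟩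
    · push Not at hx
      have := hnz i (h.apply_of_forall_ne i hx)
      omega

end IsExpansion

theorem zPerm_viaEmbedding {N n : ℕ} (e : Fin N ↪o Fin n) (β : Equiv.Perm (Fin N)) :
    zPerm (β.viaEmbedding e.toEmbedding) + N = zPerm β + n := by
  classical
  set B := β.viaEmbedding e.toEmbedding with hB
  have hpow : ∀ (t : ℤ) k, (B ^ t) (e k) = e ((β ^ t) k) := fun t k => by
    rw [hB, ← Equiv.Perm.viaEmbeddingHom_apply, ← map_zpow]
    exact Equiv.Perm.viaEmbedding_apply _ e.toEmbedding k
  have hon : ∀ k, cycleCard B (e k) = cycleCard β k := by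
    intro k
    refine (Nat.card_congr (Equiv.ofBijective
      (fun l : {l // β.SameCycle k l} => (⟨e l, ?_⟩ : {y // B.SameCycle (e k) y}))
      ⟨?_, ?_⟩)).symm
    · obtain ⟨t, ht⟩ := l.2
      exact ⟨t, by rw [hpow, ht]⟩
    · intro l l' h
      exact Subtype.ext (e.injective (congrArg Subtype.val h))
    · rintro ⟨y, t, rfl⟩
      exact ⟨⟨(β ^ t) k, t, rfl⟩, Subtype.ext (hpow t k).symm⟩
  have hoff : ∀ x ∈ (Finset.univ.map e.toEmbedding)ᶜ, (cycleCard B x : ℚ)⁻¹ = 1 := by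
    intro x hx
    have hfix : B x = x := Equiv.Perm.viaEmbedding_apply_of_notMem _ _ x (by simpa using hx)
    rw [cycleCard_eq_of_forall {x}]
    · simp
    · intro j
      rw [sameCycle_iff_exists_lt (r := 1) one_pos (by simpa using hfix)]
      simp [eq_comm]
  have hsum := zPerm_eq_sum B
  rw [← Finset.sum_add_sum_compl (Finset.univ.map e.toEmbedding), Finset.sum_map,
    Finset.sum_congr rfl hoff, Finset.sum_congr rfl (g := fun k => (cycleCard β k : ℚ)⁻¹)
      (fun k _ => by rw [← hon]; rfl), ← zPerm_eq_sum, Finset.sum_const, Finset.card_compl,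
    Finset.card_map] at hsum
  have hNn : N ≤ n := by simpa using Fintype.card_le_of_embedding e.toEmbedding
  simp only [Finset.card_univ, Fintype.card_fin, nsmul_eq_mul, mul_one] at hsum
  have : zPerm B = zPerm β + (n - N) := by exact_mod_cast hsum
  omega

/-- Insertion, outside the range of `e`, of points sent to their cyclic successor. -/
noncomputable def expand {N n : ℕ} (e : Fin N ↪o Fin n) (α : Equiv.Perm (Fin N)) :
    Equiv.Perm (Fin n) :=
  finRotate n * ((α⁻¹ * finRotate N).viaEmbedding e.toEmbedding)⁻¹

section
variable {N n : ℕ} (e : Fin N ↪o Fin n) (α : Equiv.Perm (Fin N))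

theorem expand_inv_mul_finRotate :
    (expand e α)⁻¹ * finRotate n = (α⁻¹ * finRotate N).viaEmbedding e.toEmbedding := by
  simp [expand]

theorem isExpansion_expand : IsExpansion e α (expand e α) where
  apply_of_forall_ne x hx := by
    rw [expand, Equiv.Perm.mul_apply, (Equiv.Perm.inv_eq_iff_eq (y := x)).2]
    exact (Equiv.Perm.viaEmbedding_apply_of_notMem _ _ x (by simpa using hx)).symm
  apply_of_finRotate_eq k k' hk := by
    rw [expand, Equiv.Perm.mul_apply, (Equiv.Perm.inv_eq_iff_eq (y := e k')).2]
    refine ((Equiv.Perm.viaEmbedding_apply _ e.toEmbedding k').trans ?_).symm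
    rw [Equiv.Perm.mul_apply, hk, Equiv.Perm.inv_eq_iff_eq.2 rfl]
    rfl

theorem IsGenusOne.pos {α : Equiv.Perm (Fin N)} (h : IsGenusOne α) : 0 < N := by
  unfold IsGenusOne at h; omega

theorem isGenusOne_expand_iff : IsGenusOne (expand e α) ↔ IsGenusOne α := by
  have hz := zPerm_viaEmbedding e (α⁻¹ * finRotate N)
  unfold IsGenusOne
  rw [expand_inv_mul_finRotate]
  rcases Nat.eq_zero_or_pos N with rfl | hN
  · omega
  · rw [(isExpansion_expand e α).zPerm_eq hN]; omega

theorem expand_injective : Function.Injective (expand e) := by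
  intro α α' h
  have h' := congrArg (fun γ => γ⁻¹ * finRotate n) h
  simp only [expand_inv_mul_finRotate, ← Equiv.Perm.viaEmbeddingHom_apply] at h'
  simpa using Equiv.Perm.viaEmbeddingHom_injective _ h'

theorem viaEmbedding_ne_iff (β : Equiv.Perm (Fin N)) (hβ : ∀ k, β k ≠ k) (x : Fin n) :
    β.viaEmbedding e.toEmbedding x ≠ x ↔ ∃ k, e k = x := by
  constructor
  · intro h
    by_contra hx
    exact h (Equiv.Perm.viaEmbedding_apply_of_notMem _ _ x (by simpa using hx))
  · rintro ⟨k, rfl⟩ h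
    exact hβ k (e.injective ((Equiv.Perm.viaEmbedding_apply _ e.toEmbedding k).symm.trans h))

theorem exists_viaEmbedding_eq (B : Equiv.Perm (Fin n)) (hB : ∀ x, B x ≠ x ↔ ∃ k, e k = x) :
    ∃ β : Equiv.Perm (Fin N), β.viaEmbedding e.toEmbedding = B := by
  have h : ∀ k, ∃ l, e l = B (e k) := fun k =>
    (hB _).1 fun h => (hB (e k)).2 ⟨k, rfl⟩ (B.injective h)
  choose g hg using h
  have hinj : Function.Injective g := fun k l hkl =>
    e.injective (B.injective (by rw [← hg, ← hg, hkl]))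
  refine ⟨Equiv.ofBijective g (Finite.injective_iff_bijective.1 hinj), Equiv.ext fun x => ?_⟩
  by_cases hx : ∃ k, e k = x
  · obtain ⟨k, rfl⟩ := hx
    exact (Equiv.Perm.viaEmbedding_apply _ e.toEmbedding k).trans (hg k)
  · rw [Equiv.Perm.viaEmbedding_apply_of_notMem _ _ x (by simpa using hx)]
    exact (not_not.1 (mt (hB x).1 hx)).symm

end

theorem card_reduced_support_eq {n : ℕ} (S : Finset (Fin n)) :
    Nat.card {α : Equiv.Perm (Fin n) // (IsGenusOne α ∧ IsPartitionPerm α ∧ IsReducedPerm α) ∧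
      (α⁻¹ * finRotate n).support = S} = reducedCount S.card := by
  let e : Fin S.card ↪o Fin n := S.orderEmbOfFin rfl
  have he : ∀ x, x ∈ S ↔ ∃ k, e k = x := fun x => by
    rw [← Finset.mem_coe, ← Finset.range_orderEmbOfFin S rfl]; rfl
  have hβ : ∀ α' : Equiv.Perm (Fin S.card), (∀ i, α' i ≠ finRotate _ i) ↔
      ∀ k, (α'⁻¹ * finRotate S.card) k ≠ k := fun α' =>
    forall_congr' fun k => not_congr (by
      rw [Equiv.Perm.mul_apply, Equiv.Perm.inv_eq_iff_eq, eq_comm])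
  symm
  refine Nat.card_congr (Equiv.ofBijective
    (fun α' => ⟨expand e α'.1, ⟨(isGenusOne_expand_iff e _).2 α'.2.1.1, ?_, ?_⟩, ?_⟩) ⟨?_, ?_⟩)
  · exact ((isExpansion_expand e α'.1).isPartitionPerm_iff α'.2.1.2.2).2 α'.2.1.2.1
  · exact ((isExpansion_expand e α'.1).isReducedPerm_iff α'.2.1.1.pos α'.2.2).2 α'.2.1.2.2
  · ext x
    rw [Equiv.Perm.mem_support, expand_inv_mul_finRotate,
      viaEmbedding_ne_iff e _ ((hβ _).1 α'.2.2), he]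
  · intro α α' h
    exact Subtype.ext (expand_injective e (congrArg Subtype.val h))
  · rintro ⟨α, ⟨hG, hP, hR⟩, hS⟩
    have hB : ∀ x, (α⁻¹ * finRotate n) x ≠ x ↔ ∃ k, e k = x := fun x => by
      rw [← he, ← hS, Equiv.Perm.mem_support]
    obtain ⟨β, hβB⟩ := exists_viaEmbedding_eq e _ hB
    obtain ⟨α', rfl⟩ : ∃ α' : Equiv.Perm (Fin S.card), β = α'⁻¹ * finRotate S.card :=
      ⟨finRotate _ * β⁻¹, by simp⟩
    have hne : ∀ i, α' i ≠ finRotate _ i := (hβ α').2 fun k hk =>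
      (hB (e k)).2 ⟨k, rfl⟩ (by
        rw [← hβB]
        exact (Equiv.Perm.viaEmbedding_apply _ e.toEmbedding k).trans (congrArg e hk))
    obtain rfl : expand e α' = α := by
      rw [← expand_inv_mul_finRotate] at hβB
      simpa using hβB
    have hG' := (isGenusOne_expand_iff e α').1 hG
    have hf := ((isExpansion_expand e α').isReducedPerm_iff hG'.pos hne).1 hR
    exact ⟨⟨α', ⟨hG', ((isExpansion_expand e α').isPartitionPerm_iff hf).1 hP, hf⟩, hne⟩, rfl⟩

theorem card_reduced_eq_sum (n : ℕ) :
    Nat.card {α : Equiv.Perm (Fin n) // IsGenusOne α ∧ IsPartitionPerm α ∧ IsReducedPerm α} =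
      ∑ N ∈ Finset.range (n + 1), n.choose N * reducedCount N := by
  classical
  have h := Finset.card_eq_sum_card_fiberwise (f := fun α => (α⁻¹ * finRotate n).support)
    (s := Finset.univ.filter fun α : Equiv.Perm (Fin n) =>
      IsGenusOne α ∧ IsPartitionPerm α ∧ IsReducedPerm α)
    (t := (Finset.univ : Finset (Fin n)).powerset) (fun _ _ => by simp)
  rw [Nat.card_eq_fintype_card, Fintype.card_subtype, h]
  have h' : ∀ S ∈ (Finset.univ : Finset (Fin n)).powerset,
      ((Finset.univ.filter fun α : Equiv.Perm (Fin n) =>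
        IsGenusOne α ∧ IsPartitionPerm α ∧ IsReducedPerm α).filter
          fun α => (α⁻¹ * finRotate n).support = S).card = reducedCount S.card := fun S _ => by
    rw [← card_reduced_support_eq, Nat.card_eq_fintype_card, Fintype.card_subtype,
      Finset.filter_filter]
  rw [Finset.sum_congr rfl h', Finset.sum_powerset_apply_card]
  simp

/-- The generating function of the binomial transform of `f`. -/
noncomputable def binomialTransformSeries (f : ℕ → ℤ) : PowerSeries ℤ :=
  PowerSeries.mk fun n => ∑ N ∈ Finset.range (n + 1), (n.choose N : ℤ) * f N

theorem binomialTransformSeries_eq (f : ℕ → ℤ) :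
    (1 - PowerSeries.X) * binomialTransformSeries f =
      PowerSeries.C (f 0) + PowerSeries.X * binomialTransformSeries fun N => f (N + 1) := by
  suffices h : binomialTransformSeries f = PowerSeries.C (f 0) +
      PowerSeries.X * (binomialTransformSeries f + binomialTransformSeries fun N => f (N + 1)) by
    linear_combination h
  ext n
  cases n with
  | zero => simp [binomialTransformSeries]
  | succ n =>
    rw [map_add, PowerSeries.coeff_succ_X_mul, map_add, PowerSeries.coeff_C, if_neg (by omega)]
    simp only [binomialTransformSeries, PowerSeries.coeff_mk]
    have h := Finset.sum_range_succ' (fun N => (n.choose N : ℤ) * f N) (n + 1)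
    rw [Finset.sum_range_succ, Nat.choose_succ_self] at h
    rw [Nat.cast_zero, zero_mul, add_zero] at h
    rw [Finset.sum_range_succ', h]
    simp only [Nat.choose_succ_succ', Nat.cast_add, add_mul, Finset.sum_add_distrib]
    simp
    ring

/-- The sequence `j ↦ (j + 1).choose i` placed at the even indices. -/
def evenChoose (i N : ℕ) : ℤ :=
  if Even N then ((N / 2 + 1).choose i : ℤ) else 0

theorem evenChoose_succ (i N : ℕ) :
    evenChoose (i + 1) (N + 1 + 1) = evenChoose (i + 1) N + evenChoose i N := by
  have h : Even (N + 1 + 1) ↔ Even N := by simp [Nat.even_add_one]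
  simp only [evenChoose, h]
  split_ifs
  · rw [show (N + 1 + 1) / 2 = N / 2 + 1 by omega, Nat.choose_succ_succ']; push_cast; ring
  · rfl

theorem evenChoose_zero (N : ℕ) : evenChoose 0 (N + 1 + 1) = evenChoose 0 N := by
  have h : Even (N + 1 + 1) ↔ Even N := by simp [Nat.even_add_one]
  simp only [evenChoose, h, Nat.choose_zero_right]

theorem binomialTransformSeries_add (f g : ℕ → ℤ) :
    binomialTransformSeries (fun N => f N + g N) = binomialTransformSeries f + binomialTransformSeries g := by
  ext n; simp [binomialTransformSeries, mul_add, Finset.sum_add_distrib]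

theorem binomialTransformSeries_evenChoose (i : ℕ) :
    (1 - PowerSeries.X) ^ 2 * binomialTransformSeries (evenChoose i) =
      (1 - PowerSeries.X) * PowerSeries.C (Nat.choose 1 i : ℤ) +
        PowerSeries.X ^ 2 * binomialTransformSeries fun N => evenChoose i (N + 1 + 1) := by
  have h0 : evenChoose i 0 = Nat.choose 1 i := by simp [evenChoose]
  have h1 : evenChoose i (0 + 1) = 0 := by simp [evenChoose]
  have e0 := binomialTransformSeries_eq (evenChoose i)
  have e1 := binomialTransformSeries_eq fun N => evenChoose i (N + 1)
  rw [h0] at e0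
  rw [h1, map_zero] at e1
  linear_combination (1 - PowerSeries.X) * e0 + PowerSeries.X * e1

theorem binomialTransformSeries_evenChoose_three :
    binomialTransformSeries (evenChoose 3) * (1 - 2 * PowerSeries.X) ^ 4 =
      PowerSeries.X ^ 4 * (1 - PowerSeries.X) ^ 3 := by
  have h0 := binomialTransformSeries_evenChoose 0
  have h1 := binomialTransformSeries_evenChoose 1
  have h2 := binomialTransformSeries_evenChoose 2
  have h3 := binomialTransformSeries_evenChoose 3
  simp only [evenChoose_succ, evenChoose_zero, binomialTransformSeries_add] at h0 h1 h2 h3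
  rw [Nat.choose_eq_zero_of_lt (by norm_num)] at h3
  norm_num at h0 h1 h2 h3
  set X : PowerSeries ℤ := PowerSeries.X
  linear_combination (1 - 2 * X) ^ 3 * h3 + X ^ 2 * (1 - 2 * X) ^ 2 * h2 +
    X ^ 4 * (1 - 2 * X) * h1 + X ^ 6 * h0

theorem reducedCount_eq (N : ℕ) : (reducedCount N : ℤ) = evenChoose 3 N := by
  rcases Nat.even_or_odd' N with ⟨m, rfl | rfl⟩
  · simp [reducedCount_even, evenChoose]
  · simp [reducedCount_odd, evenChoose]

/-- If `r₀(n)` is the number of reduced genus-one set partitions of `{1,…,n}`, then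
in `ℤ[[x]]` one has `(∑ r₀(n)·xⁿ)·(1−2x)⁴ = x⁴·(1−x)³`. -/
theorem reduced_genus_one_partition_gf :
    (PowerSeries.mk fun n =>
        (Nat.card {α : Equiv.Perm (Fin n) //
            IsGenusOne α ∧ IsPartitionPerm α ∧ IsReducedPerm α} : ℤ)) *
        (1 - 2 * PowerSeries.X) ^ 4 =
      PowerSeries.X ^ 4 * (1 - PowerSeries.X) ^ 3 := by
  rw [← binomialTransformSeries_evenChoose_three, binomialTransformSeries]
  simp only [card_reduced_eq_sum, Nat.cast_sum, Nat.cast_mul, reducedCount_eq]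
end

section
/- For all integers n ≥ 0 and k ≥ 1, the number r_*(n,k) of reduced permutations of {1,…,n} of genus 1 having exactly k cycles is r_*(n,k) = C(n+2,2k+2)·C(k+1,3) + C(n+1,2k+2)·C(k+1,2), where C(a,b) denotes the binomial coefficient. -/
namespace GenusOne

open Function Equiv

/-- The number of cycles of a permutation, fixed points included. -/
noncomputable def numCycles {X : Type*} (σ : Perm X) : ℕ :=
  Nat.card (Quotient (Perm.SameCycle.setoid σ))

theorem zPerm_eq_numCycles {n : ℕ} (α : Perm (Fin n)) : zPerm α = numCycles α := rfl

theorem minimalPeriod_eq_card_sameCycle {X : Type*} [Finite X] (σ : Perm X) (x : X) :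
    minimalPeriod σ x = Nat.card {y // σ.SameCycle x y} := by
  classical
  have := Fintype.ofFinite X
  have h := MulAction.minimalPeriod_eq_card (α := Perm X) σ x
  have h' : minimalPeriod σ x = minimalPeriod (fun y => σ • y) x := rfl
  rw [h', h, ← Nat.card_eq_fintype_card]
  refine Nat.card_congr (Equiv.subtypeEquivRight fun y => ?_)
  rw [MulAction.mem_orbit_iff]
  constructor
  · rintro ⟨⟨_, i, rfl⟩, rfl⟩
    exact ⟨i, rfl⟩
  · rintro ⟨i, rfl⟩
    exact ⟨⟨σ ^ i, i, rfl⟩, rfl⟩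

theorem minimalPeriod_pos {X : Type*} [Finite X] (σ : Perm X) (x : X) :
    0 < minimalPeriod σ x := by
  rw [minimalPeriod_eq_card_sameCycle]
  have : Nonempty {y // σ.SameCycle x y} := ⟨⟨x, Perm.SameCycle.refl σ x⟩⟩
  exact Nat.card_pos

theorem numCycles_eq_sum {X : Type*} [Fintype X] (σ : Perm X) :
    (numCycles σ : ℚ) = ∑ x, (1 : ℚ) / minimalPeriod σ x := by
  classical
  rw [← Finset.sum_fiberwise Finset.univ (Quotient.mk (Perm.SameCycle.setoid σ)),
    numCycles, Nat.card_eq_fintype_card, ← Finset.card_univ, Finset.card_eq_sum_ones]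
  push_cast
  refine Finset.sum_congr rfl fun q _ => ?_
  induction q using Quotient.inductionOn with
  | h x =>
    have key : ∀ y, σ.SameCycle x y → minimalPeriod σ y =
        (Finset.univ.filter fun y => Quotient.mk (Perm.SameCycle.setoid σ) y =
          Quotient.mk (Perm.SameCycle.setoid σ) x).card := by
      intro y hy
      rw [minimalPeriod_eq_card_sameCycle, Nat.card_eq_fintype_card, Fintype.card_subtype]
      congr 1
      ext z
      simp only [Finset.mem_filter, Finset.mem_univ, true_and]
      rw [Quotient.eq]
      exact ⟨fun h => (hy.trans h).symm, fun h => hy.symm.trans (Perm.SameCycle.symm h)⟩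
    rw [Finset.sum_congr rfl (g := fun _ => (1 : ℚ) / (Finset.univ.filter fun y =>
      Quotient.mk (Perm.SameCycle.setoid σ) y = Quotient.mk (Perm.SameCycle.setoid σ) x).card)]
    · rw [Finset.sum_const, nsmul_eq_mul, mul_one_div, div_self]
      rw [← key x (Perm.SameCycle.refl σ x)]
      exact_mod_cast (minimalPeriod_pos σ x).ne'
    · intro y hy
      simp only [Finset.mem_filter, Finset.mem_univ, true_and] at hy
      rw [Quotient.eq] at hy
      rw [key y (Perm.SameCycle.symm hy)]

theorem sameCycle_map {X Y : Type*} {σ : Perm X} {τ : Perm Y} (φ : X → Y)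
    (h : ∀ x, τ.SameCycle (φ x) (φ (σ x))) {x y : X} (hxy : σ.SameCycle x y) :
    τ.SameCycle (φ x) (φ y) := by
  obtain ⟨i, rfl⟩ := hxy
  induction i using Int.induction_on with
  | zero => exact Perm.SameCycle.refl _ _
  | succ i ih =>
    have := h ((σ ^ (i : ℤ)) x)
    rw [← Perm.mul_apply, ← zpow_one_add, add_comm] at this
    exact ih.trans this
  | pred i ih =>
    have := h ((σ ^ (-(i : ℤ) - 1)) x)
    rw [← Perm.mul_apply, ← zpow_one_add, add_sub_cancel] at this
    exact ih.trans this.symm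

theorem numCycles_eq_of_retract {X Y : Type*} {σ : Perm X} {τ : Perm Y} (φ : X → Y) (ψ : Y → X)
    (hφ : ∀ x, τ.SameCycle (φ x) (φ (σ x))) (hψ : ∀ y, σ.SameCycle (ψ y) (ψ (τ y)))
    (hφψ : ∀ y, τ.SameCycle (φ (ψ y)) y) (hψφ : ∀ x, σ.SameCycle (ψ (φ x)) x) :
    numCycles σ = numCycles τ :=
  Nat.card_congr
    { toFun := Quotient.map φ fun _ _ h => sameCycle_map φ hφ h
      invFun := Quotient.map ψ fun _ _ h => sameCycle_map ψ hψ h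
      left_inv := fun q => Quotient.inductionOn q fun x => Quotient.sound (hψφ x)
      right_inv := fun q => Quotient.inductionOn q fun y => Quotient.sound (hφψ y) }

theorem sameCycle_permCongr {X Y : Type*} (e : X ≃ Y) (σ : Perm X) (x y : X) :
    (e.permCongr σ).SameCycle (e x) (e y) ↔ σ.SameCycle x y := by
  constructor
  · intro h
    have := sameCycle_map (τ := σ) e.symm (fun z => ⟨1, by simp⟩) h
    simpa using this
  · exact sameCycle_map e fun z => ⟨1, by simp⟩

theorem numCycles_permCongr {X Y : Type*} (e : X ≃ Y) (σ : Perm X) :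
    numCycles (e.permCongr σ) = numCycles σ :=
  numCycles_eq_of_retract e.symm e (fun x => ⟨1, by simp⟩) (fun x => ⟨1, by simp⟩)
    (fun y => by simpa using Perm.SameCycle.refl σ y)
    (fun y => by simpa using Perm.SameCycle.refl _ y)

theorem minimalPeriod_semiconj {X Y : Type*} {f : X → X} {g : Y → Y} (φ : X → Y)
    (hφ : Injective φ) (h : ∀ x, g (φ x) = φ (f x)) (x : X) :
    minimalPeriod g (φ x) = minimalPeriod f x := by
  have hs : Semiconj φ f g := fun x => (h x).symm
  rw [minimalPeriod_eq_minimalPeriod_iff]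
  intro n
  rw [IsPeriodicPt, IsFixedPt, ← (hs.iterate_right n).eq, hφ.eq_iff]
  rfl

theorem numCycles_optionCongr {X : Type*} [Finite X] (σ : Perm X) :
    numCycles (optionCongr σ) = numCycles σ + 1 := by
  have := Fintype.ofFinite X
  have h : (numCycles (optionCongr σ) : ℚ) = (numCycles σ + 1 : ℕ) := by
    push_cast
    rw [numCycles_eq_sum, numCycles_eq_sum, Fintype.sum_option, add_comm]
    congr 1
    · refine Finset.sum_congr rfl fun x _ => ?_
      rw [minimalPeriod_semiconj (f := σ) some (Option.some_injective X) (fun _ => rfl) x]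
    · rw [minimalPeriod_eq_one_iff_isFixedPt.2 (by rfl)]
      norm_num
  exact_mod_cast h

/-- The permutation `α` has a cycle along which it agrees with `ζ` except possibly at one point. -/
def HasTrivialCycle {X : Type*} (ζ α : Perm X) : Prop :=
  ∃ l, ∀ y, α.SameCycle l y → y ≠ l → (α⁻¹ * ζ) y = y

theorem inv_mul_apply_eq_self_iff {X : Type*} {ζ α : Perm X} {y : X} :
    (α⁻¹ * ζ) y = y ↔ ζ y = α y := by
  rw [Perm.mul_apply, Perm.inv_eq_iff_eq]

theorem isReducedPerm_iff {n : ℕ} (α : Perm (Fin n)) :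
    IsReducedPerm α ↔ ¬ HasTrivialCycle (finRotate n) α := by
  refine not_congr ⟨?_, ?_⟩
  · rintro ⟨i, p, -, hlt, hp⟩
    refine ⟨(finRotate n ^ p) i, fun y hy hne => ?_⟩
    have key : ∀ j : ℕ, ∃ t ≤ p, (α ^ j) ((finRotate n ^ p) i) = (finRotate n ^ t) i := by
      intro j
      induction j with
      | zero => exact ⟨p, le_rfl, rfl⟩
      | succ j ih =>
        obtain ⟨t, ht, h⟩ := ih
        rw [pow_succ', Perm.mul_apply, h]
        rcases ht.lt_or_eq with ht | rfl
        · exact ⟨t + 1, ht, hlt t ht⟩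
        · exact ⟨0, Nat.zero_le _, by rw [hp]; rfl⟩
    obtain ⟨j, rfl⟩ := hy.exists_nat_pow_eq
    obtain ⟨t, ht, h⟩ := key j
    rw [h] at hne ⊢
    have ht : t < p := lt_of_le_of_ne ht fun h => hne (by rw [h])
    rw [inv_mul_apply_eq_self_iff, hlt t ht, pow_succ', Perm.mul_apply]
  · rintro ⟨l, hl⟩
    have hpos := minimalPeriod_pos α l
    have key : ∀ t < minimalPeriod α l, (α ^ t) (α l) = (finRotate n ^ t) (α l) ∧
        (t + 1 < minimalPeriod α l →
          α ((finRotate n ^ t) (α l)) = (finRotate n ^ (t + 1)) (α l)) := by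
      intro t
      induction t with
      | zero =>
        intro ht
        refine ⟨rfl, fun h1 => ?_⟩
        have := hl (α l) ⟨1, rfl⟩ fun h => by
          have := (minimalPeriod_eq_one_iff_isFixedPt (f := α)).2 h
          omega
        rw [inv_mul_apply_eq_self_iff] at this
        simp only [pow_zero, zero_add, pow_one, Perm.one_apply]
        exact this.symm
      | succ t ih =>
        intro ht
        obtain ⟨h1, h2⟩ := ih (by omega)
        have h3 : (α ^ (t + 1)) (α l) = (finRotate n ^ (t + 1)) (α l) := by
          rw [← h2 ht, ← h1, pow_succ', Perm.mul_apply]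
        refine ⟨h3, fun h4 => ?_⟩
        have := hl ((α ^ (t + 1)) (α l)) ⟨(t + 2 : ℕ), by
          rw [zpow_natCast, pow_succ, Perm.mul_apply]⟩ fun h => by
          have h5 : IsPeriodicPt α (t + 2) l := by
            rw [IsPeriodicPt, IsFixedPt, ← Perm.coe_pow, pow_succ, Perm.mul_apply, h]
          have := h5.minimalPeriod_le (by omega)
          omega
        rw [inv_mul_apply_eq_self_iff, h3] at this
        rw [← this, pow_succ' _ (t + 1), Perm.mul_apply]
    refine ⟨α l, minimalPeriod α l - 1, ?_, fun t ht => (key t (by omega)).2 (by omega), ?_⟩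
    · have : minimalPeriod α l ≤ n := by
        rw [minimalPeriod_eq_card_sameCycle]
        simpa using Finite.card_subtype_le (α.SameCycle l)
      omega
    · rw [← (key (minimalPeriod α l - 1) (by omega)).1, ← Perm.mul_apply, ← pow_succ',
        Nat.sub_add_cancel hpos, ← Perm.mul_apply, ← pow_succ, pow_succ', Perm.mul_apply,
        Perm.coe_pow, iterate_minimalPeriod]

/-- With respect to the cycle `ζ`, the permutation `α` has genus one, `k` cycles and no trivial
cycle, and it agrees with `ζ` at exactly `f` points. -/
structure IsReducedGenusOne {X : Type*} (ζ α : Perm X) (k f : ℕ) : Prop where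
  numCycles_eq : numCycles α = k
  genus : numCycles α + numCycles (α⁻¹ * ζ) + 1 = Nat.card X
  reduced : ¬ HasTrivialCycle ζ α
  card_fixed : Nat.card {x // (α⁻¹ * ζ) x = x} = f

theorem permCongr_inv_mul {X Y : Type*} (e : X ≃ Y) (ζ α : Perm X) :
    (e.permCongr α)⁻¹ * e.permCongr ζ = e.permCongr (α⁻¹ * ζ) := by
  ext x
  simp [Perm.inv_def, Equiv.permCongr_def]

theorem isReducedGenusOne_permCongr {X Y : Type*} (e : X ≃ Y) {ζ α : Perm X} {k f : ℕ} :
    IsReducedGenusOne (e.permCongr ζ) (e.permCongr α) k f ↔ IsReducedGenusOne ζ α k f := by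
  have h3 : HasTrivialCycle (e.permCongr ζ) (e.permCongr α) ↔ HasTrivialCycle ζ α := by
    unfold HasTrivialCycle
    rw [permCongr_inv_mul, ← e.exists_congr_right]
    refine exists_congr fun l => ?_
    rw [← e.forall_congr_right]
    refine forall_congr' fun y => ?_
    rw [sameCycle_permCongr]
    simp
  have h4 : Nat.card {x // (e.permCongr (α⁻¹ * ζ)) x = x} =
      Nat.card {x // (α⁻¹ * ζ) x = x} := by
    refine (Nat.card_congr (e.subtypeEquiv fun x => ?_)).symm
    simp
  constructor
  · rintro ⟨h, h', h'', h'''⟩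
    rw [permCongr_inv_mul] at h' h'''
    rw [numCycles_permCongr] at h h'
    rw [numCycles_permCongr, ← Nat.card_congr e] at h'
    exact ⟨h, h', fun h => h'' (h3.2 h), h4 ▸ h'''⟩
  · rintro ⟨h, h', h'', h'''⟩
    refine ⟨by rwa [numCycles_permCongr], ?_, fun h => h'' (h3.1 h), ?_⟩
    · rwa [permCongr_inv_mul, numCycles_permCongr, numCycles_permCongr, ← Nat.card_congr e]
    · rwa [permCongr_inv_mul, h4]

/-- Extend a permutation of `X` to `Option X` by inserting `none` just before `some a`. -/
noncomputable def insertBefore {X : Type*} (a : X) (σ : Perm X) : Perm (Option X) :=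
  let := Classical.decEq X
  Equiv.swap none (some a) * optionCongr σ

section insertBefore

variable {X : Type*} (a : X) (σ τ : Perm X)

theorem insertBefore_none : insertBefore a σ none = some a := by
  simp [insertBefore]

theorem insertBefore_some_of_eq {x : X} (h : σ x = a) : insertBefore a σ (some x) = none := by
  simp [insertBefore, h]

theorem insertBefore_some_of_ne {x : X} (h : σ x ≠ a) :
    insertBefore a σ (some x) = some (σ x) := by
  rw [insertBefore, Perm.mul_apply]
  let := Classical.decEq X
  exact swap_apply_of_ne_of_ne (by simp) (by simpa using h)

theorem insertBefore_inv_mul :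
    (insertBefore a σ)⁻¹ * insertBefore a τ = optionCongr (σ⁻¹ * τ) := by
  let := Classical.decEq X
  rw [insertBefore, insertBefore, mul_inv_rev, mul_assoc, ← mul_assoc _ (Equiv.swap _ _), swap_inv,
    swap_mul_self, one_mul]
  ext x
  cases x <;> rfl

theorem insertBefore_sameCycle_step (x : X) :
    (insertBefore a σ).SameCycle (some x) (some (σ x)) := by
  by_cases h : σ x = a
  · refine ⟨2, ?_⟩
    rw [zpow_ofNat, pow_two, Perm.mul_apply, insertBefore_some_of_eq a σ h, insertBefore_none, h]
  · exact ⟨1, by rw [zpow_one, insertBefore_some_of_ne a σ h]⟩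

theorem sameCycle_insertBefore_step (x : Option X) :
    σ.SameCycle (x.getD a) ((insertBefore a σ x).getD a) := by
  cases x with
  | none => rw [insertBefore_none]; exact Perm.SameCycle.refl _ _
  | some x =>
    by_cases h : σ x = a
    · rw [insertBefore_some_of_eq a σ h]; exact ⟨1, h⟩
    · rw [insertBefore_some_of_ne a σ h]; exact ⟨1, rfl⟩

theorem sameCycle_insertBefore {x y : X} :
    (insertBefore a σ).SameCycle (some x) (some y) ↔ σ.SameCycle x y :=
  ⟨fun h => sameCycle_map (fun z => z.getD a) (sameCycle_insertBefore_step a σ) h,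
    fun h => sameCycle_map some (insertBefore_sameCycle_step a σ) h⟩

theorem sameCycle_insertBefore_none {y : X} :
    (insertBefore a σ).SameCycle none (some y) ↔ σ.SameCycle a y := by
  rw [← sameCycle_insertBefore a]
  have : (insertBefore a σ).SameCycle none (some a) := ⟨1, insertBefore_none a σ⟩
  exact ⟨fun h => this.symm.trans h, fun h => this.trans h⟩

theorem numCycles_insertBefore : numCycles (insertBefore a σ) = numCycles σ := by
  refine numCycles_eq_of_retract (fun z => z.getD a) some (sameCycle_insertBefore_step a σ)
    (insertBefore_sameCycle_step a σ) (fun y => Perm.SameCycle.refl _ _) fun x => ?_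
  cases x with
  | none => exact ((sameCycle_insertBefore_none a σ).2 (Perm.SameCycle.refl _ _)).symm
  | some x => exact Perm.SameCycle.refl _ _

theorem hasTrivialCycle_insertBefore :
    HasTrivialCycle (insertBefore a τ) (insertBefore a σ) ↔ HasTrivialCycle τ σ := by
  unfold HasTrivialCycle
  rw [insertBefore_inv_mul]
  constructor
  · rintro ⟨l, hl⟩
    cases l with
    | none =>
      refine ⟨a, fun y hy _ => ?_⟩
      simpa using hl (some y) ((sameCycle_insertBefore_none a σ).2 hy) (by simp)
    | some l =>
      refine ⟨l, fun y hy hne => ?_⟩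
      simpa using hl (some y) ((sameCycle_insertBefore a σ).2 hy) (by simpa using hne)
  · rintro ⟨l, hl⟩
    refine ⟨some l, fun y hy hne => ?_⟩
    cases y with
    | none => rfl
    | some y =>
      simpa using hl y ((sameCycle_insertBefore a σ).1 hy) (by simpa using hne)

theorem card_fixed_optionCongr [Finite X] :
    Nat.card {x // optionCongr σ x = x} = Nat.card {x // σ x = x} + 1 := by
  rw [← Finite.card_option]
  refine (Nat.card_congr (Equiv.ofBijective (fun z : Option {x // σ x = x} =>
    (⟨z.map Subtype.val, ?_⟩ : {x // optionCongr σ x = x})) ⟨?_, ?_⟩)).symm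
  · cases z with
    | none => rfl
    | some z => simp [z.2]
  · rintro (_ | x) (_ | y) h
    · rfl
    · simp at h
    · simp at h
    · simpa [Subtype.ext_iff] using h
  · rintro ⟨_ | x, hx⟩
    · exact ⟨none, rfl⟩
    · exact ⟨some ⟨x, by simpa using hx⟩, rfl⟩

theorem isReducedGenusOne_insertBefore [Finite X] {k f : ℕ} :
    IsReducedGenusOne (insertBefore a τ) (insertBefore a σ) k (f + 1) ↔
      IsReducedGenusOne τ σ k f := by
  constructor
  · rintro ⟨h1, h2, h3, h4⟩
    rw [insertBefore_inv_mul] at h2 h4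
    rw [numCycles_insertBefore] at h1 h2
    rw [numCycles_optionCongr, Finite.card_option] at h2
    rw [card_fixed_optionCongr] at h4
    exact ⟨h1, by omega, fun h => h3 ((hasTrivialCycle_insertBefore a σ τ).2 h), by omega⟩
  · rintro ⟨h1, h2, h3, h4⟩
    refine ⟨by rwa [numCycles_insertBefore], ?_,
      fun h => h3 ((hasTrivialCycle_insertBefore a σ τ).1 h), ?_⟩
    · rw [insertBefore_inv_mul, numCycles_insertBefore, numCycles_optionCongr, Finite.card_option]
      omega
    · rw [insertBefore_inv_mul, card_fixed_optionCongr, h4]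

theorem exists_eq_insertBefore (α : Perm (Option X))
    (h : (α⁻¹ * insertBefore a τ) none = none) : ∃ σ, α = insertBefore a σ := by
  classical
  set δ := α⁻¹ * insertBefore a τ with hδ
  obtain ⟨ρ, hρ⟩ : ∃ ρ, δ = optionCongr ρ := by
    refine ⟨removeNone δ, ?_⟩
    ext1 x
    cases x with
    | none => exact h
    | some x =>
      refine (removeNone_some δ (Option.ne_none_iff_exists'.1 fun h' => ?_)).symm
      have := δ.injective (h'.trans h.symm)
      simp at this
  have h2 : α = insertBefore a τ * δ⁻¹ := by rw [hδ]; group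
  refine ⟨τ * ρ⁻¹, ?_⟩
  rw [h2, hρ, insertBefore, insertBefore, mul_assoc]
  congr 1
  ext1 x
  cases x <;> rfl

theorem insertBefore_injective : Injective (insertBefore a : Perm X → Perm (Option X)) := by
  intro σ τ h
  exact optionCongr_injective (mul_left_cancel h)

theorem card_isReducedGenusOne_insertBefore [Finite X] (k f : ℕ) :
    Nat.card {α // IsReducedGenusOne (insertBefore a τ) α k (f + 1) ∧
      (α⁻¹ * insertBefore a τ) none = none} = Nat.card {α // IsReducedGenusOne τ α k f} := by
  refine (Nat.card_congr (Equiv.ofBijective (fun α => ⟨insertBefore a α.1,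
    (isReducedGenusOne_insertBefore a α.1 τ).2 α.2,
    by rw [insertBefore_inv_mul]; rfl⟩) ⟨?_, ?_⟩)).symm
  · intro α β h
    simp only [Subtype.mk.injEq] at h
    exact Subtype.ext (insertBefore_injective a h)
  · rintro ⟨α, h1, h2⟩
    obtain ⟨σ, rfl⟩ := exists_eq_insertBefore a τ α h2
    exact ⟨⟨σ, (isReducedGenusOne_insertBefore a σ τ).1 h1⟩, rfl⟩

end insertBefore

theorem finSuccEquivLast_permCongr_finRotate (n : ℕ) :
    finSuccEquivLast.permCongr (finRotate (n + 2)) = insertBefore 0 (finRotate (n + 1)) := by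
  ext1 x
  cases x with
  | none => simp [insertBefore_none, Equiv.permCongr_apply]; rfl
  | some x =>
    rw [Equiv.permCongr_apply, finSuccEquivLast_symm_some]
    induction x using Fin.lastCases with
    | last =>
      rw [insertBefore_some_of_eq _ _ finRotate_last, finRotate_apply]
      have : (Fin.last n).castSucc + 1 = Fin.last (n + 1) := by
        ext; simp
      rw [this, finSuccEquivLast_last]
    | cast x =>
      have h : finRotate (n + 1) x.castSucc = x.succ := by simp
      rw [insertBefore_some_of_ne _ _ (by rw [h]; exact Fin.succ_ne_zero x), h]
      have : finRotate (n + 2) x.castSucc.castSucc = x.succ.castSucc := by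
        rw [finRotate_apply]; ext; simp
      rw [this, finSuccEquivLast_castSucc]

/-- The number of reduced permutations of genus one with `k` cycles agreeing with the rotation at
exactly `f` points. -/
noncomputable def reducedCount (k n f : ℕ) : ℕ :=
  Nat.card {α : Perm (Fin n) // IsReducedGenusOne (finRotate n) α k f}

theorem card_fixed_last_eq (k n f : ℕ) (i : Fin (n + 1)) :
    Nat.card {α // IsReducedGenusOne (finRotate (n + 1)) α k f ∧
      (α⁻¹ * finRotate (n + 1)) i = i} =
    Nat.card {α // IsReducedGenusOne (finRotate (n + 1)) α k f ∧
      (α⁻¹ * finRotate (n + 1)) (Fin.last n) = Fin.last n} := by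
  have hadd : Equiv.permCongr (Equiv.addRight (Fin.last n - i)) (finRotate (n + 1)) =
      finRotate (n + 1) := by
    ext1 x
    simp only [Equiv.permCongr_apply, finRotate_apply, Equiv.coe_addRight]
    rw [Equiv.addRight_symm, Equiv.coe_addRight]
    simp only [add_right_comm, add_neg_cancel_right]
  refine Nat.card_congr
    ((Equiv.permCongr (Equiv.addRight (Fin.last n - i))).subtypeEquiv fun α => ?_)
  refine and_congr ?_ ?_
  · conv_rhs => rw [← hadd]
    exact (isReducedGenusOne_permCongr _).symm
  · conv_rhs => rw [← hadd, permCongr_inv_mul]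
    rw [Equiv.permCongr_apply]
    have : (Equiv.addRight (Fin.last n - i)).symm (Fin.last n) = i := by
      rw [Equiv.addRight_symm, Equiv.coe_addRight]
      simp only [neg_sub, add_sub_cancel]
    rw [← Equiv.eq_symm_apply (Equiv.addRight (Fin.last n - i)), this]

theorem reducedCount_recursion (k n f : ℕ) :
    (f + 1) * reducedCount k (n + 2) (f + 1) = (n + 2) * reducedCount k (n + 1) f := by
  classical
  have h1 : ∀ i : Fin (n + 2), (Finset.univ.filter fun α : Perm (Fin (n + 2)) =>
      IsReducedGenusOne (finRotate (n + 2)) α k (f + 1) ∧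
        (α⁻¹ * finRotate (n + 2)) i = i).card = reducedCount k (n + 1) f := by
    intro i
    rw [← Fintype.card_subtype, ← Nat.card_eq_fintype_card, card_fixed_last_eq, reducedCount,
      ← card_isReducedGenusOne_insertBefore 0 (finRotate (n + 1)),
      ← finSuccEquivLast_permCongr_finRotate]
    refine Nat.card_congr (finSuccEquivLast.permCongr.subtypeEquiv fun α => ?_)
    rw [isReducedGenusOne_permCongr, permCongr_inv_mul]
    simp [Equiv.permCongr_apply, ← finSuccEquivLast.eq_symm_apply]
  have h2 : ∀ α : Perm (Fin (n + 2)), IsReducedGenusOne (finRotate (n + 2)) α k (f + 1) →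
      (Finset.univ.filter fun i => (α⁻¹ * finRotate (n + 2)) i = i).card = f + 1 := by
    intro α hα
    rw [← hα.card_fixed, Nat.card_eq_fintype_card, Fintype.card_subtype]
  have h3 := Finset.sum_card_bipartiteAbove_eq_sum_card_bipartiteBelow
    (s := Finset.univ.filter fun α : Perm (Fin (n + 2)) =>
      IsReducedGenusOne (finRotate (n + 2)) α k (f + 1))
    (t := Finset.univ) fun (α : Perm (Fin (n + 2))) i => (α⁻¹ * finRotate (n + 2)) i = i
  simp only [Finset.bipartiteAbove, Finset.bipartiteBelow, Finset.filter_filter] at h3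
  rw [Finset.sum_congr rfl fun α hα => h2 α (Finset.mem_filter.1 hα).2] at h3
  rw [Finset.sum_congr rfl fun i _ => h1 i] at h3
  simp only [Finset.sum_const, Finset.card_univ, Fintype.card_fin, smul_eq_mul] at h3
  rw [← h3, reducedCount, Nat.card_eq_fintype_card, Fintype.card_subtype, mul_comm]

theorem numCycles_pos {n : ℕ} (α : Perm (Fin (n + 1))) : 0 < numCycles α :=
  have : Nonempty (Quotient (Perm.SameCycle.setoid α)) := ⟨Quotient.mk _ 0⟩
  Nat.card_pos

theorem reducedCount_of_le_one (k f : ℕ) {n : ℕ} (hn : n ≤ 1) : reducedCount k n f = 0 := by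
  rw [reducedCount, Nat.card_eq_zero]
  refine Or.inl ⟨fun ⟨α, hα⟩ => ?_⟩
  have := hα.genus
  interval_cases n
  · simp at this
  · have h1 := numCycles_pos (n := 0) α
    simp at this
    omega

theorem reducedCount_eq_choose_mul (k n f : ℕ) (hf : f ≤ n) :
    reducedCount k n f = n.choose f * reducedCount k (n - f) 0 := by
  induction f generalizing n with
  | zero => simp
  | succ f ih =>
    match n with
    | 0 => omega
    | 1 => rw [reducedCount_of_le_one _ _ le_rfl, reducedCount_of_le_one _ _ (by omega), mul_zero]
    | n + 2 =>
      have h := reducedCount_recursion k n f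
      rw [ih (n + 1) (by omega), ← mul_assoc, Nat.add_one_mul_choose_eq (n + 1) f] at h
      rw [show n + 2 - (f + 1) = n + 1 - f by omega]
      refine Nat.eq_of_mul_eq_mul_left (Nat.succ_pos f) ?_
      rw [h, Nat.succ_eq_add_one]
      ring

theorem card_reduced_eq_sum (n k : ℕ) :
    Nat.card {α : Perm (Fin n) // IsGenusOne α ∧ IsReducedPerm α ∧ zPerm α = k} =
      ∑ m ∈ Finset.range (n + 1), n.choose m * reducedCount k m 0 := by
  classical
  have h1 : ∀ f, reducedCount k n f = (Finset.univ.filter fun α : Perm (Fin n) =>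
      (IsGenusOne α ∧ IsReducedPerm α ∧ zPerm α = k) ∧
        Nat.card {x // (α⁻¹ * finRotate n) x = x} = f).card := by
    intro f
    rw [reducedCount, Nat.card_eq_fintype_card, Fintype.card_subtype]
    congr 1
    ext α
    simp only [Finset.mem_filter, Finset.mem_univ, true_and]
    rw [isReducedPerm_iff, IsGenusOne, zPerm_eq_numCycles, zPerm_eq_numCycles]
    constructor
    · rintro ⟨h1, h2, h3, h4⟩
      rw [Nat.card_fin] at h2
      exact ⟨⟨by omega, h3, h1⟩, h4⟩
    · rintro ⟨⟨h2, h3, h1⟩, h4⟩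
      exact ⟨h1, by rw [Nat.card_fin]; omega, h3, h4⟩
  have h2 : Nat.card {α : Perm (Fin n) // IsGenusOne α ∧ IsReducedPerm α ∧ zPerm α = k} =
      ∑ f ∈ Finset.range (n + 1), reducedCount k n f := by
    rw [Finset.sum_congr rfl fun f _ => h1 f, Nat.card_eq_fintype_card, Fintype.card_subtype]
    rw [Finset.card_eq_sum_card_fiberwise
      (f := fun α : Perm (Fin n) => Nat.card {x // (α⁻¹ * finRotate n) x = x})
      (t := Finset.range (n + 1))]
    · simp only [Finset.filter_filter]
    · intro α _
      have := Finite.card_subtype_le fun x => (α⁻¹ * finRotate n) x = x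
      rw [Nat.card_fin] at this
      simpa using Nat.lt_succ_of_le this
  rw [h2, ← Finset.sum_range_reflect]
  refine Finset.sum_congr rfl fun m hm => ?_
  have hm : m ≤ n := by simpa [Nat.lt_succ_iff] using hm
  rw [show n + 1 - 1 - m = n - m by omega, reducedCount_eq_choose_mul _ _ _ (Nat.sub_le n m),
    Nat.choose_symm hm, Nat.sub_sub_self hm]

section next

variable {N : ℕ} (B : Finset (ZMod N)) (x : ZMod N)

/-- The least positive `r` such that `x + r ∈ B`. -/
noncomputable def nextDist : ℕ := sInf {r : ℕ | 0 < r ∧ x + r ∈ B}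

/-- The least `t` such that `x - t ∈ B`. -/
noncomputable def prevDist : ℕ := sInf {t : ℕ | x - t ∈ B}

/-- The element of `B` that cyclically follows `x`. -/
noncomputable def next : ZMod N := x + nextDist B x

variable {B x}

theorem nextDist_le {r : ℕ} (hr : 0 < r) (h : x + r ∈ B) : nextDist B x ≤ r :=
  Nat.sInf_le ⟨hr, h⟩

theorem prevDist_le {t : ℕ} (h : x - t ∈ B) : prevDist B x ≤ t :=
  Nat.sInf_le h

theorem nextDist_eq {r : ℕ} (hr : 0 < r) (h : x + r ∈ B)
    (h' : ∀ s : ℕ, 0 < s → s < r → x + s ∉ B) : nextDist B x = r := by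
  have h1 : 0 < nextDist B x ∧ x + nextDist B x ∈ B :=
    Nat.sInf_mem (s := {r : ℕ | 0 < r ∧ x + r ∈ B}) ⟨r, hr, h⟩
  refine le_antisymm (nextDist_le hr h) (not_lt.1 fun h2 => h' _ h1.1 h2 h1.2)

theorem prevDist_eq {t : ℕ} (h : x - t ∈ B) (h' : ∀ s : ℕ, s < t → x - s ∉ B) :
    prevDist B x = t := by
  have h1 : x - prevDist B x ∈ B := Nat.sInf_mem (s := {t : ℕ | x - t ∈ B}) ⟨t, h⟩
  refine le_antisymm (prevDist_le h) (not_lt.1 fun h2 => h' _ h2 h1)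

theorem add_notMem_of_lt_nextDist {s : ℕ} (hs : 0 < s) (h : s < nextDist B x) : x + s ∉ B :=
  fun h' => (nextDist_le hs h').not_gt h

theorem sub_notMem_of_lt_prevDist {s : ℕ} (h : s < prevDist B x) : x - s ∉ B :=
  fun h' => (prevDist_le h').not_gt h

theorem prevDist_of_mem (h : x ∈ B) : prevDist B x = 0 :=
  Nat.le_zero.1 (prevDist_le (by simpa using h))

theorem sub_prevDist_add_notMem {j : ℕ} (h0 : 0 < j)
    (hj : j < prevDist B x + nextDist B x) : x - prevDist B x + j ∉ B := by
  rcases le_or_gt j (prevDist B x) with h | h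
  · have := sub_notMem_of_lt_prevDist (B := B) (x := x) (s := prevDist B x - j) (by omega)
    rwa [Nat.cast_sub h, ← sub_add] at this
  · have := add_notMem_of_lt_nextDist (B := B) (x := x) (s := j - prevDist B x) (by omega)
      (by omega)
    rw [Nat.cast_sub h.le] at this
    convert this using 2
    ring

variable [NeZero N]

theorem nextDist_pos_and_next_mem (hB : B.Nonempty) (x : ZMod N) :
    0 < nextDist B x ∧ next B x ∈ B := by
  obtain ⟨b, hb⟩ := hB
  refine Nat.sInf_mem (s := {r : ℕ | 0 < r ∧ x + r ∈ B})
    ⟨(b - x).val + N, by have := NeZero.pos N; omega, ?_⟩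
  simpa using hb

theorem nextDist_pos (hB : B.Nonempty) (x : ZMod N) : 0 < nextDist B x :=
  (nextDist_pos_and_next_mem hB x).1

theorem next_mem (hB : B.Nonempty) (x : ZMod N) : next B x ∈ B :=
  (nextDist_pos_and_next_mem hB x).2

theorem sub_prevDist_mem (hB : B.Nonempty) (x : ZMod N) : x - prevDist B x ∈ B := by
  obtain ⟨b, hb⟩ := hB
  exact Nat.sInf_mem (s := {t : ℕ | x - t ∈ B}) ⟨(x - b).val, by simpa using hb⟩

theorem mem_of_closed_next {C : Set (ZMod N)} {c : ZMod N} (hc : c ∈ C)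
    (hC : ∀ x ∈ C, next B x ∈ C) {b : ZMod N} (hb : b ∈ B) : b ∈ C := by
  have key : ∀ d : ℕ, ∀ c ∈ C, c + d = b → b ∈ C := by
    intro d
    induction d using Nat.strong_induction_on with
    | _ d ih =>
      intro c hc h
      rcases Nat.eq_zero_or_pos d with rfl | hd
      · rw [← h]; simpa using hc
      · have h1 : nextDist B c ≤ d := nextDist_le hd (h ▸ hb)
        refine ih (d - nextDist B c) ?_ _ (hC c hc) ?_
        · have := nextDist_pos ⟨b, hb⟩ c
          omega
        · rw [next, Nat.cast_sub h1, ← h]; ring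
  exact key (b - c).val c hc (by simp)

theorem exists_iterate_next_eq (x : ZMod N) {y : ZMod N} (hy : y ∈ B) :
    ∃ i, (next B)^[i] x = y :=
  mem_of_closed_next (B := B) (C := {y | ∃ i, (next B)^[i] x = y}) (c := x) ⟨0, rfl⟩
    (by rintro _ ⟨i, rfl⟩; exact ⟨i + 1, iterate_succ_apply' _ _ _⟩) hy

end next

section weight

variable {X : Type*} [Fintype X] {σ : Perm X}

/-- The excess of `1 / 2` over the reciprocal of the length of the cycle of `x`. -/
noncomputable def weight (σ : Perm X) (x : X) : ℚ := 1 / 2 - 1 / minimalPeriod σ x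

theorem two_le_minimalPeriod (h : ∀ x, σ x ≠ x) (x : X) : 2 ≤ minimalPeriod σ x := by
  have h1 := minimalPeriod_pos σ x
  have h2 : minimalPeriod σ x ≠ 1 := fun h' => h x (minimalPeriod_eq_one_iff_isFixedPt.1 h')
  omega

theorem minimalPeriod_eq_two_iff (h : ∀ x, σ x ≠ x) (x : X) :
    minimalPeriod σ x = 2 ↔ σ (σ x) = x := by
  constructor
  · intro h'
    have := iterate_minimalPeriod (f := σ) (x := x)
    rwa [h'] at this
  · intro h'
    exact le_antisymm (IsPeriodicPt.minimalPeriod_le two_pos h') (two_le_minimalPeriod h x)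

theorem weight_nonneg (h : ∀ x, σ x ≠ x) (x : X) : 0 ≤ weight σ x := by
  have h1 : (2 : ℚ) ≤ minimalPeriod σ x := by exact_mod_cast two_le_minimalPeriod h x
  exact sub_nonneg.2 (one_div_le_one_div_of_le two_pos h1)

theorem weight_eq_zero_iff (h : ∀ x, σ x ≠ x) (x : X) : weight σ x = 0 ↔ σ (σ x) = x := by
  rw [← minimalPeriod_eq_two_iff h, weight, sub_eq_zero, eq_comm, one_div, one_div, inv_inj]
  exact_mod_cast Iff.rfl

/-- The points in cycles of length greater than two of a permutation without fixed points. -/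
def nonInvolutive [DecidableEq X] (σ : Perm X) : Finset X := {x | σ (σ x) ≠ x}

variable [DecidableEq X]

theorem mem_nonInvolutive {x : X} : x ∈ nonInvolutive σ ↔ σ (σ x) ≠ x := by
  simp [nonInvolutive]

theorem apply_mem_nonInvolutive {x : X} (h : x ∈ nonInvolutive σ) : σ x ∈ nonInvolutive σ := by
  rw [mem_nonInvolutive] at h ⊢
  exact fun h' => h (σ.injective h')

theorem sum_weight_nonInvolutive (h : ∀ x, σ x ≠ x) :
    ∑ x ∈ nonInvolutive σ, weight σ x = ∑ x, weight σ x := by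
  refine Finset.sum_subset (Finset.subset_univ _) fun x _ hx => ?_
  rw [weight_eq_zero_iff h]
  by_contra h'
  exact hx (mem_nonInvolutive.2 h')

theorem nonInvolutive_eq_orbit (h : ∀ x, σ x ≠ x) (hw : ∑ x, weight σ x = 1) {b : X}
    (h4 : 4 ≤ minimalPeriod σ b) : minimalPeriod σ b = 4 ∧
      nonInvolutive σ = (Finset.range 4).image fun i => σ^[i] b := by
  set p := minimalPeriod σ b with hp
  set O := (Finset.range p).image fun i => σ^[i] b with hO
  have hper : ∀ x ∈ O, minimalPeriod σ x = p := by
    intro x hx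
    obtain ⟨i, -, rfl⟩ := Finset.mem_image.1 hx
    exact minimalPeriod_apply_iterate
      (minimalPeriod_pos_iff_mem_periodicPts.1 (minimalPeriod_pos σ b)) i
  have hcard : O.card = p := by
    rw [hO, Finset.card_image_of_injOn, Finset.card_range]
    intro i hi j hj hij
    exact iterate_injOn_Iio_minimalPeriod (by simpa using hi) (by simpa using hj) hij
  have hsum : ∑ x ∈ O, weight σ x = p / 2 - 1 := by
    rw [Finset.sum_congr rfl fun x hx => show weight σ x = 1 / 2 - 1 / p by
      rw [weight, hper x hx], Finset.sum_const, hcard, nsmul_eq_mul]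
    have : (p : ℚ) ≠ 0 := by exact_mod_cast (show p ≠ 0 by omega)
    field_simp
  have hle : ∑ x ∈ O, weight σ x ≤ 1 := by
    rw [← hw]
    exact Finset.sum_le_sum_of_subset_of_nonneg (Finset.subset_univ _)
      fun x _ _ => weight_nonneg h x
  have hp4 : p = 4 := by
    have : (p : ℚ) ≤ 4 := by linarith
    have : p ≤ 4 := by exact_mod_cast this
    omega
  refine ⟨hp4, ?_⟩
  rw [← hp4, ← hO]
  refine subset_antisymm (fun x hx => ?_) fun x hx => ?_
  · by_contra hxO
    have h1 : ∑ y ∈ insert x O, weight σ y ≤ 1 := by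
      rw [← hw]
      exact Finset.sum_le_sum_of_subset_of_nonneg (Finset.subset_univ _)
        fun x _ _ => weight_nonneg h x
    rw [Finset.sum_insert hxO, hsum, hp4] at h1
    have h2 := weight_nonneg h x
    rw [mem_nonInvolutive, Ne, ← weight_eq_zero_iff h] at hx
    refine hx (le_antisymm ?_ h2)
    push_cast at h1
    linarith
  · rw [mem_nonInvolutive, Ne, ← minimalPeriod_eq_two_iff h, hper x hx]
    omega

/-- A permutation without fixed points and of total weight one has, apart from its transpositions,
either one cycle of length four or two cycles of length three. -/
theorem cycleType_of_sum_weight_eq_one (h : ∀ x, σ x ≠ x) (hw : ∑ x, weight σ x = 1) :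
    ((nonInvolutive σ).card = 4 ∧ ∀ x ∈ nonInvolutive σ, σ (σ (σ (σ x))) = x ∧
      ∀ y ∈ nonInvolutive σ, y = x ∨ y = σ x ∨ y = σ (σ x) ∨ y = σ (σ (σ x))) ∨
    ((nonInvolutive σ).card = 6 ∧ ∀ x ∈ nonInvolutive σ, σ (σ (σ x)) = x) := by
  by_cases h3 : ∀ x ∈ nonInvolutive σ, minimalPeriod σ x = 3
  · right
    constructor
    · have h1 := sum_weight_nonInvolutive h
      rw [Finset.sum_congr rfl fun x hx => show weight σ x = 1 / 6 by
        rw [weight, h3 x hx]; norm_num, Finset.sum_const, nsmul_eq_mul, hw] at h1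
      have h2 : ((nonInvolutive σ).card : ℚ) = 6 := by linarith
      exact_mod_cast h2
    · intro x hx
      have := iterate_minimalPeriod (f := σ) (x := x)
      rwa [h3 x hx] at this
  · left
    push Not at h3
    obtain ⟨b, hb, hb3⟩ := h3
    have hge : ∀ x ∈ nonInvolutive σ, 3 ≤ minimalPeriod σ x := by
      intro x hx
      have h1 := two_le_minimalPeriod h x
      rw [mem_nonInvolutive, Ne, ← minimalPeriod_eq_two_iff h] at hx
      omega
    obtain ⟨h4, hB⟩ := nonInvolutive_eq_orbit h hw (b := b) (by have := hge b hb; omega)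
    have hper : ∀ x ∈ nonInvolutive σ, minimalPeriod σ x = 4 := by
      intro x hx
      rw [hB] at hx
      obtain ⟨i, -, rfl⟩ := Finset.mem_image.1 hx
      rw [minimalPeriod_apply_iterate
        (minimalPeriod_pos_iff_mem_periodicPts.1 (minimalPeriod_pos σ b)) i, h4]
    constructor
    · rw [hB, Finset.card_image_of_injOn, Finset.card_range]
      intro i hi j hj hij
      refine iterate_injOn_Iio_minimalPeriod (f := σ) (x := b) ?_ ?_ hij
      · rw [h4]; simpa using hi
      · rw [h4]; simpa using hj
    · intro x hx
      have h5 := hper x hx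
      refine ⟨?_, fun y hy => ?_⟩
      · have := iterate_minimalPeriod (f := σ) (x := x)
        rwa [h5] at this
      · rw [(nonInvolutive_eq_orbit h hw h5.ge).2] at hy
        obtain ⟨i, hi, rfl⟩ := Finset.mem_image.1 hy
        have : i < 4 := Finset.mem_range.1 hi
        interval_cases i
        · exact Or.inl rfl
        · exact Or.inr (Or.inl rfl)
        · exact Or.inr (Or.inr (Or.inl rfl))
        · exact Or.inr (Or.inr (Or.inr rfl))

end weight

section interleaving

/-- The parity of an element of `ZMod (2 * m)`. -/
def parity (m : ℕ) : ZMod (2 * m) →+* ZMod 2 := ZMod.castHom (dvd_mul_right 2 m) (ZMod 2)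

theorem two_mul_natCast_self {m : ℕ} : (2 * m : ZMod (2 * m)) = 0 := by
  exact_mod_cast ZMod.natCast_self (2 * m)

variable {m : ℕ} [NeZero m]

/-- The properties of the permutation of `ZMod (2 * m)` obtained by interleaving a permutation
`α` of `ZMod m` with `α⁻¹ * ζ`, for `α` of genus one, if neither of these has a fixed point. -/
structure IsInterleaving (γ : Perm (ZMod (2 * m))) : Prop where
  apply_sub_one : ∀ x, γ (γ x - 1) = x + 1
  ne : ∀ x, γ x ≠ x
  parity_apply : ∀ x, parity m (γ x) = parity m x
  sum_weight : ∑ x, weight γ x = 1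

theorem natCast_ne_zero : (m : ZMod (2 * m)) ≠ 0 := by
  rw [Ne, ZMod.natCast_eq_zero_iff]
  intro h
  have := Nat.le_of_dvd (NeZero.pos m) h
  have := NeZero.pos m
  omega

theorem eq_natCast_of_two_mul_eq_zero {x : ZMod (2 * m)} (h : 2 * x = 0) (hx : x ≠ 0) :
    x = m := by
  have h1 : ((2 * x.val : ℕ) : ZMod (2 * m)) = 0 := by push_cast; simpa using h
  rw [ZMod.natCast_eq_zero_iff] at h1
  obtain ⟨c, hc⟩ := h1
  have h2 := ZMod.val_lt x
  have h3 : x.val ≠ 0 := by rwa [Ne, ZMod.val_eq_zero]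
  have h4 : c = 1 := by
    have : 2 * (m * c) < 2 * (2 * m) := by rw [← mul_assoc, ← hc]; omega
    have hc0 : c ≠ 0 := by rintro rfl; omega
    have : m * c < m * 2 := by omega
    have := Nat.lt_of_mul_lt_mul_left this
    omega
  have h5 : x.val = m := by rw [h4] at hc; omega
  rw [← ZMod.natCast_zmod_val x, h5]

namespace IsInterleaving

variable {γ : Perm (ZMod (2 * m))} (hγ : IsInterleaving γ)
include hγ

theorem apply_of_notMem {x : ZMod (2 * m)} (hx : x ∉ nonInvolutive γ) :
    γ x = γ (x - 1) - 1 := by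
  rw [mem_nonInvolutive, not_not] at hx
  apply γ.injective
  rw [hx, hγ.apply_sub_one, sub_add_cancel]

theorem nonempty : (nonInvolutive γ).Nonempty := by
  by_contra h
  rw [Finset.not_nonempty_iff_eq_empty] at h
  have h1 := sum_weight_nonInvolutive hγ.ne
  rw [h, hγ.sum_weight] at h1
  simp at h1

theorem apply_add {x : ZMod (2 * m)} (t : ℕ) (ht : t < nextDist (nonInvolutive γ) x) :
    γ (x + t) = γ x - t := by
  induction t with
  | zero => simp
  | succ t ih =>
    rw [hγ.apply_of_notMem (add_notMem_of_lt_nextDist t.succ_pos ht), Nat.cast_succ,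
      show x + (t + 1) - 1 = x + t by ring, ih (by omega)]
    ring

theorem apply_sub_nextDist (x : ZMod (2 * m)) :
    γ (γ x - nextDist (nonInvolutive γ) x) = next (nonInvolutive γ) x := by
  have h1 := nextDist_pos hγ.nonempty x
  have h2 := hγ.apply_add (x := x) (nextDist (nonInvolutive γ) x - 1) (by omega)
  have h3 := hγ.apply_sub_one (x + (nextDist (nonInvolutive γ) x - 1 : ℕ))
  rw [h2, Nat.cast_pred h1] at h3
  rw [sub_sub, sub_add_cancel] at h3
  rw [h3, next]
  ring

theorem apply_add_sub_next (x : ZMod (2 * m)) :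
    γ (γ x + x - next (nonInvolutive γ) x) = next (nonInvolutive γ) x := by
  conv_rhs => rw [← hγ.apply_sub_nextDist x]
  rw [next]
  congr 1
  ring

theorem next_ne_apply (x : ZMod (2 * m)) : next (nonInvolutive γ) x ≠ γ x := by
  intro h
  have h1 := nextDist_pos hγ.nonempty x
  have h2 := congrArg (parity m) h
  rw [hγ.parity_apply, next, map_add, add_eq_left, map_natCast,
    ZMod.natCast_eq_zero_iff_even] at h2
  obtain ⟨t, ht⟩ := h2
  have h3 := hγ.apply_add (x := x) t (by omega)
  rw [← h, next, ht] at h3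
  refine hγ.ne _ (h3.trans ?_)
  push_cast
  ring

theorem next_ne_apply_apply {x : ZMod (2 * m)} (hx : x ∈ nonInvolutive γ) :
    next (nonInvolutive γ) x ≠ γ (γ x) := by
  intro h
  have h1 := γ.injective ((hγ.apply_add_sub_next x).trans h)
  have h2 : next (nonInvolutive γ) x = x := by linear_combination -h1
  exact mem_nonInvolutive.1 hx (h.symm.trans h2)

theorem next_ne_self {x : ZMod (2 * m)} (hx : x ∈ nonInvolutive γ) :
    next (nonInvolutive γ) x ≠ x := by
  intro h
  have := mem_of_closed_next (C := {x}) rfl (by rintro y rfl; exact h)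
    (apply_mem_nonInvolutive hx)
  exact hγ.ne x this

theorem next_next_ne_self {x : ZMod (2 * m)} (hx : x ∈ nonInvolutive γ) :
    next (nonInvolutive γ) (next (nonInvolutive γ) x) ≠ x := by
  intro h
  have := mem_of_closed_next (C := {x, next (nonInvolutive γ) x}) (c := x) (by simp)
    (by rintro y (rfl | rfl) <;> simp [h]) (apply_mem_nonInvolutive hx)
  rcases this with h' | h'
  · exact hγ.ne x h'
  · exact hγ.next_ne_apply x h'.symm

theorem add_mem_and_apply_of_card_four
    (h4 : ∀ x ∈ nonInvolutive γ, γ (γ (γ (γ x))) = x ∧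
      ∀ y ∈ nonInvolutive γ, y = x ∨ y = γ x ∨ y = γ (γ x) ∨ y = γ (γ (γ x)))
    {x : ZMod (2 * m)} (hx : x ∈ nonInvolutive γ) :
    x + m ∈ nonInvolutive γ ∧ γ x = next (nonInvolutive γ) x + m := by
  have hnext : ∀ x ∈ nonInvolutive γ, next (nonInvolutive γ) x = γ (γ (γ x)) := by
    intro x hx
    rcases (h4 x hx).2 _ (next_mem hγ.nonempty x) with h | h | h | h
    · exact absurd h (hγ.next_ne_self hx)
    · exact absurd h (hγ.next_ne_apply x)
    · exact absurd h (hγ.next_ne_apply_apply hx)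
    · exact h
  have hsum : ∀ x ∈ nonInvolutive γ, γ x + x = γ (γ (γ x)) + γ (γ x) := by
    intro x hx
    have h := hγ.apply_add_sub_next x
    rw [hnext x hx] at h
    linear_combination γ.injective h
  have hsq : ∀ x ∈ nonInvolutive γ, γ (γ x) = x + m := by
    intro x hx
    have h1 := hsum x hx
    have h2 := hsum _ (apply_mem_nonInvolutive hx)
    rw [(h4 x hx).1] at h2
    have h3 : γ (γ x) - x = m := eq_natCast_of_two_mul_eq_zero
      (by linear_combination h2 - h1) (sub_ne_zero.2 (mem_nonInvolutive.1 hx))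
    linear_combination h3
  have h3 := apply_mem_nonInvolutive (apply_mem_nonInvolutive hx)
  refine ⟨hsq x hx ▸ h3, ?_⟩
  rw [hnext x hx, hsq _ (apply_mem_nonInvolutive hx)]
  linear_combination -two_mul_natCast_self (m := m)

theorem add_mem_and_apply_of_card_six (h6 : (nonInvolutive γ).card = 6)
    (h3 : ∀ x ∈ nonInvolutive γ, γ (γ (γ x)) = x)
    {x : ZMod (2 * m)} (hx : x ∈ nonInvolutive γ) :
    x + m ∈ nonInvolutive γ ∧ γ x = next (nonInvolutive γ) x + m := by
  set B := nonInvolutive γ with hB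
  have hcover : ∀ x ∈ B, ∀ y ∈ B, (y = x ∨ y = γ x ∨ y = γ (γ x)) ∨
      (y = next B x ∨ y = γ (next B x) ∨ y = γ (γ (next B x))) := by
    intro x hx
    have hc : next B x ∈ B := next_mem hγ.nonempty x
    have e1 : next B x ≠ x := hγ.next_ne_self hx
    have e2 : next B x ≠ γ x := hγ.next_ne_apply x
    have e3 : next B x ≠ γ (γ x) := hγ.next_ne_apply_apply hx
    have hsub : ({x, γ x, γ (γ x), next B x, γ (next B x), γ (γ (next B x))} : Finset _) ⊆ B := by
      intro y hy
      simp only [Finset.mem_insert, Finset.mem_singleton] at hy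
      rcases hy with rfl | rfl | rfl | rfl | rfl | rfl
      exacts [hx, apply_mem_nonInvolutive hx,
        apply_mem_nonInvolutive (apply_mem_nonInvolutive hx), hc, apply_mem_nonInvolutive hc,
        apply_mem_nonInvolutive (apply_mem_nonInvolutive hc)]
    have n1 : ∀ y ∈ B, y ≠ γ y := fun y _ h => hγ.ne y h.symm
    have n2 : ∀ y ∈ B, y ≠ γ (γ y) := fun y hy h => mem_nonInvolutive.1 hy h.symm
    have hcard : ({x, γ x, γ (γ x), next B x, γ (next B x), γ (γ (next B x))} :
        Finset (ZMod (2 * m))).card = 6 := by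
      have i1 := n1 x hx
      have i2 := n2 x hx
      have i4 := n1 _ hc
      have i5 := n2 _ hc
      have j1 : x ≠ γ (next B x) := fun h => e3 (by
        rw [← h3 _ hc, ← h])
      have j2 : x ≠ γ (γ (next B x)) := fun h => e2 (by
        rw [← h3 _ hc, ← h])
      have j3 : γ x ≠ γ (γ (next B x)) := fun h => j1 (γ.injective h)
      have j4 : γ (γ x) ≠ γ (next B x) := fun h => e2 (γ.injective h).symm
      repeat rw [Finset.card_insert_of_notMem]
      all_goals simp [i1, i2, i4, i5, j1, j2, j3, j4, e1.symm, e2.symm, e3.symm, γ.injective.eq_iff]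
    have heq := Finset.eq_of_subset_of_card_le hsub (by rw [h6, hcard])
    intro y hy
    rw [← heq] at hy
    simp only [Finset.mem_insert, Finset.mem_singleton] at hy
    tauto
  have hnn : ∀ x ∈ B, next B (next B x) = γ (γ x) := by
    intro x hx
    have hc : next B x ∈ B := next_mem hγ.nonempty x
    rcases hcover x hx _ (next_mem hγ.nonempty (next B x)) with (h | h | h) | (h | h | h)
    · exact absurd h (hγ.next_next_ne_self hx)
    · exfalso
      have h1 := hγ.apply_add_sub_next x
      have h2 := hγ.apply_add_sub_next (next B x)
      rw [← hB, h] at h2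
      rw [← hB] at h1
      have h1' : γ x + x - next B x = γ (γ (next B x)) := by
        apply γ.injective; rw [h1, h3 _ hc]
      have h2' := γ.injective h2
      refine hγ.ne (γ (next B x)) ?_
      linear_combination -h1' - h2'
    · exact h
    · exact absurd h (hγ.next_ne_self hc)
    · exact absurd h (hγ.next_ne_apply _)
    · exact absurd h (hγ.next_ne_apply_apply hc)
  have hc : next B x ∈ B := next_mem hγ.nonempty x
  set c := next B x with hcdef
  have h1 : γ x + x - c = γ (γ c) := by
    apply γ.injective; rw [h3 _ hc]; exact hγ.apply_add_sub_next x
  have h2 : γ c + c - γ (γ x) = γ x := by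
    have := hγ.apply_add_sub_next c
    rw [← hB, hnn x hx] at this
    exact γ.injective this
  have h5 : x + γ (γ x) - γ (γ c) = γ c := by
    have := hγ.apply_add_sub_next (next B c)
    rw [← hB, hnn c hc, hnn x hx, h3 x hx] at this
    exact γ.injective this
  have h7 : γ (γ c) - x = m := by
    refine eq_natCast_of_two_mul_eq_zero (by linear_combination -h1 - h2 - h5) fun h => ?_
    refine hγ.next_ne_apply x ?_
    rw [← hB, ← hcdef, ← h3 c hc, sub_eq_zero.1 h]
  refine ⟨?_, by linear_combination h1 + h7⟩
  rw [← h7, add_sub_cancel]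
  exact apply_mem_nonInvolutive (apply_mem_nonInvolutive hc)

theorem card_and_add_mem_and_apply : ((nonInvolutive γ).card = 4 ∨ (nonInvolutive γ).card = 6) ∧
    ∀ x ∈ nonInvolutive γ, x + m ∈ nonInvolutive γ ∧ γ x = next (nonInvolutive γ) x + m := by
  rcases cycleType_of_sum_weight_eq_one hγ.ne hγ.sum_weight with ⟨h, h'⟩ | ⟨h, h'⟩
  · exact ⟨Or.inl h, fun x hx => hγ.add_mem_and_apply_of_card_four h' hx⟩
  · exact ⟨Or.inr h, fun x hx => hγ.add_mem_and_apply_of_card_six h h' hx⟩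

end IsInterleaving

/-- An interleaving is determined by its set of points in long cycles. -/
theorem IsInterleaving.ext {γ γ' : Perm (ZMod (2 * m))} (hγ : IsInterleaving γ)
    (hγ' : IsInterleaving γ') (h : nonInvolutive γ = nonInvolutive γ') : γ = γ' := by
  have key : ∀ (t : ℕ) (x : ZMod (2 * m)), x - t ∈ nonInvolutive γ → γ x = γ' x := by
    have hB : ∀ x ∈ nonInvolutive γ, γ x = γ' x := by
      intro x hx
      rw [(hγ.card_and_add_mem_and_apply.2 x hx).2,
        (hγ'.card_and_add_mem_and_apply.2 x (h ▸ hx)).2, h]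
    intro t
    induction t with
    | zero => intro x hx; exact hB x (by simpa using hx)
    | succ t ih =>
      intro x hx
      by_cases hx' : x ∈ nonInvolutive γ
      · exact hB x hx'
      · rw [hγ.apply_of_notMem hx', hγ'.apply_of_notMem (h ▸ hx'), ih]
        rwa [sub_sub, add_comm, ← Nat.cast_succ]
  ext1 x
  exact key _ x (sub_prevDist_mem hγ.nonempty x)

end interleaving

section admissible

variable {m : ℕ}

/-- The properties of the set of points in long cycles of an interleaving. -/
structure IsAdmissible (B : Finset (ZMod (2 * m))) : Prop where
  add_mem : ∀ x ∈ B, x + m ∈ B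
  card : B.card = 4 ∨ B.card = 6
  parity_next : ∀ x ∈ B, parity m (next B x) = parity m x + m

/-- The map sending the point at distance `t` after `b ∈ B`, before the next element `b'` of `B`,
to the point at distance `t` before `b' + m`. -/
noncomputable def reflectFun (B : Finset (ZMod (2 * m))) (x : ZMod (2 * m)) : ZMod (2 * m) :=
  x + nextDist B x + m - prevDist B x

theorem reflectFun_of_mem {B : Finset (ZMod (2 * m))} {x : ZMod (2 * m)} (hx : x ∈ B) :
    reflectFun B x = next B x + m := by
  simp [reflectFun, prevDist_of_mem hx, next]

theorem IsInterleaving.isAdmissible [NeZero m] {γ : Perm (ZMod (2 * m))} (hγ : IsInterleaving γ) :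
    IsAdmissible (nonInvolutive γ) := by
  obtain ⟨h1, h2⟩ := hγ.card_and_add_mem_and_apply
  refine ⟨fun x hx => (h2 x hx).1, h1, fun x hx => ?_⟩
  rw [← hγ.parity_apply x, (h2 x hx).2, map_add, map_natCast, add_assoc, CharTwo.add_self_eq_zero,
    add_zero]

namespace IsAdmissible

variable {B : Finset (ZMod (2 * m))} (hB : IsAdmissible B)
include hB

theorem nonempty : B.Nonempty := by
  rw [← Finset.card_pos]
  rcases hB.card with h | h <;> omega

theorem add_mem_iff {x : ZMod (2 * m)} : x + m ∈ B ↔ x ∈ B := by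
  refine ⟨fun h => ?_, hB.add_mem x⟩
  have := hB.add_mem _ h
  rwa [add_assoc, ← two_mul, two_mul_natCast_self, add_zero] at this

variable [NeZero m]

theorem nextDist_add (x : ZMod (2 * m)) : nextDist B (x + m) = nextDist B x := by
  refine nextDist_eq (nextDist_pos hB.nonempty x) ?_ fun s h1 h2 => ?_
  · rw [add_right_comm]
    exact hB.add_mem _ (next_mem hB.nonempty x)
  · rw [add_right_comm, hB.add_mem_iff]
    exact add_notMem_of_lt_nextDist h1 h2

theorem next_add (x : ZMod (2 * m)) : next B (x + m) = next B x + m := by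
  rw [next, hB.nextDist_add, next, add_right_comm]

theorem nextDist_lt (x : ZMod (2 * m)) : nextDist B x < m := by
  have hm := NeZero.pos m
  have h1 : nextDist B x ≤ m := by
    by_contra! h
    refine add_notMem_of_lt_nextDist (B := B) (x := x) (s := nextDist B x - m) (by omega)
      (by omega) ?_
    rw [← hB.add_mem_iff, Nat.cast_sub h.le]
    convert next_mem hB.nonempty x using 1
    rw [next]
    ring
  refine lt_of_le_of_ne h1 fun h => ?_
  have hn : next B x = x + m := by rw [next, h]
  have hx : x ∈ B := by
    rw [← hB.add_mem_iff, ← hn]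
    exact next_mem hB.nonempty x
  have hsub : B ⊆ {x, x + (m : ZMod (2 * m))} := by
    intro y hy
    have := mem_of_closed_next (C := {x, x + (m : ZMod (2 * m))}) (c := x) (by simp)
      (by
        rintro y (rfl | rfl)
        · simp [hn]
        · left
          rw [hB.next_add, hn, add_assoc, ← two_mul, two_mul_natCast_self, add_zero]) hy
    simpa using this
  have h2 := (Finset.card_le_card hsub).trans Finset.card_le_two
  rcases hB.card with h | h <;> omega

theorem prevDist_lt (x : ZMod (2 * m)) : prevDist B x < m := by
  by_contra! h
  refine sub_notMem_of_lt_prevDist (B := B) (x := x) (s := prevDist B x - m) ?_ ?_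
  · have hm := NeZero.pos m
    omega
  · rw [Nat.cast_sub h, ← sub_add, hB.add_mem_iff]
    exact sub_prevDist_mem hB.nonempty x

theorem next_sub_prevDist (x : ZMod (2 * m)) : next B (x - prevDist B x) = next B x := by
  have h := nextDist_pos hB.nonempty x
  have h1 : nextDist B (x - prevDist B x) = prevDist B x + nextDist B x := by
    refine nextDist_eq (by omega) ?_ fun s h1 h2 => sub_prevDist_add_notMem h1 h2
    convert next_mem hB.nonempty x using 1
    rw [next]
    push_cast
    ring
  rw [next, h1, next]
  push_cast
  ring

theorem reflectFun_sub_one (x : ZMod (2 * m)) :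
    reflectFun B (reflectFun B x - 1) = x + 1 := by
  have h := nextDist_pos hB.nonempty x
  have h1 : nextDist B (reflectFun B x - 1) = prevDist B x + 1 := by
    refine nextDist_eq (by omega) ?_ fun s h1 h2 => ?_
    · convert hB.add_mem _ (next_mem hB.nonempty x) using 1
      rw [next, reflectFun]
      push_cast
      ring
    · have := sub_prevDist_add_notMem (B := B) (x := x) (j := nextDist B x + s - 1) (by omega)
        (by omega)
      rw [← hB.add_mem_iff, Nat.cast_pred (by omega)] at this
      convert this using 2
      rw [reflectFun]
      push_cast
      ring
  have h2 : prevDist B (reflectFun B x - 1) = nextDist B x - 1 := by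
    refine prevDist_eq ?_ fun s h1 => ?_
    · convert hB.add_mem _ (sub_prevDist_mem hB.nonempty x) using 1
      rw [reflectFun, Nat.cast_pred h]
      ring
    · have := sub_prevDist_add_notMem (B := B) (x := x) (j := nextDist B x - 1 - s) (by omega)
        (by omega)
      rw [← hB.add_mem_iff, Nat.cast_sub (by omega), Nat.cast_pred h] at this
      convert this using 2
      rw [reflectFun]
      ring
  rw [reflectFun, h1, h2, Nat.cast_pred h, reflectFun]
  push_cast
  linear_combination two_mul_natCast_self (m := m)

theorem reflectFun_surjective : Surjective (reflectFun B) := fun x =>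
  ⟨reflectFun B (x - 1) - 1, by rw [hB.reflectFun_sub_one, sub_add_cancel]⟩

theorem reflectFun_ne (x : ZMod (2 * m)) : reflectFun B x ≠ x := by
  intro h
  have h1 := hB.nextDist_lt x
  have h2 := hB.prevDist_lt x
  have h3 : ((nextDist B x + m - prevDist B x : ℕ) : ZMod (2 * m)) = 0 := by
    rw [Nat.cast_sub (by omega)]
    rw [reflectFun] at h
    push_cast
    linear_combination h
  rw [ZMod.natCast_eq_zero_iff] at h3
  have := Nat.le_of_dvd (by omega) h3
  omega

theorem parity_reflectFun (x : ZMod (2 * m)) : parity m (reflectFun B x) = parity m x := by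
  have h := hB.parity_next _ (sub_prevDist_mem hB.nonempty x)
  rw [hB.next_sub_prevDist, next] at h
  rw [reflectFun]
  simp only [map_add, map_sub, map_natCast] at h ⊢
  linear_combination h + (m - prevDist B x) * CharTwo.two_eq_zero (R := ZMod 2)

theorem reflectFun_of_notMem {x : ZMod (2 * m)} (hx : x ∉ B) :
    reflectFun B x = reflectFun B (x - 1) - 1 := by
  have h1 : nextDist B (x - 1) = nextDist B x + 1 := by
    refine nextDist_eq (by omega) ?_ fun s h1 h2 => ?_
    · convert next_mem hB.nonempty x using 1
      rw [next]
      push_cast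
      ring
    · obtain ⟨s, rfl⟩ : ∃ t, s = t + 1 := ⟨s - 1, by omega⟩
      rw [Nat.cast_succ, show x - 1 + (s + 1) = x + (s : ZMod (2 * m)) by ring]
      rcases Nat.eq_zero_or_pos s with rfl | hs
      · simpa using hx
      · exact add_notMem_of_lt_nextDist hs (by omega)
  have h0 : 0 < prevDist B x := by
    rw [Nat.pos_iff_ne_zero]
    intro h
    have := sub_prevDist_mem hB.nonempty x
    rw [h] at this
    exact hx (by simpa using this)
  have h2 : prevDist B (x - 1) = prevDist B x - 1 := by
    refine prevDist_eq ?_ fun s h1 => ?_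
    · convert sub_prevDist_mem hB.nonempty x using 1
      rw [Nat.cast_pred h0]
      ring
    · have := sub_notMem_of_lt_prevDist (B := B) (x := x) (s := s + 1) (by omega)
      convert this using 2
      push_cast
      ring
  rw [reflectFun, reflectFun, h1, h2, Nat.cast_pred h0]
  push_cast
  ring

theorem reflectFun_reflectFun_of_notMem {x : ZMod (2 * m)} (hx : x ∉ B) :
    reflectFun B (reflectFun B x) = x := by
  rw [hB.reflectFun_of_notMem hx, hB.reflectFun_sub_one, sub_add_cancel]

theorem reflectFun_mem {x : ZMod (2 * m)} (hx : x ∈ B) : reflectFun B x ∈ B := by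
  rw [reflectFun_of_mem hx]
  exact hB.add_mem _ (next_mem hB.nonempty x)

theorem minimalPeriod_next {x : ZMod (2 * m)} (hx : x ∈ B) :
    0 < minimalPeriod (next B) x ∧ minimalPeriod (next B) x = B.card := by
  have hpos : 0 < minimalPeriod (next B) x := by
    obtain ⟨i, hi⟩ := exists_iterate_next_eq (next B x) hx
    exact IsPeriodicPt.minimalPeriod_pos i.succ_pos hi
  refine ⟨hpos, ?_⟩
  have h : B = (Finset.range (minimalPeriod (next B) x)).image fun i => (next B)^[i] x := by
    refine subset_antisymm (fun y hy => ?_) fun y hy => ?_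
    · obtain ⟨i, rfl⟩ := exists_iterate_next_eq x hy
      exact Finset.mem_image.2 ⟨i % minimalPeriod (next B) x,
        Finset.mem_range.2 (Nat.mod_lt _ hpos), iterate_mod_minimalPeriod_eq⟩
    · obtain ⟨i, -, rfl⟩ := Finset.mem_image.1 hy
      cases i with
      | zero => exact hx
      | succ i =>
        rw [iterate_succ_apply']
        exact next_mem hB.nonempty _
  conv_rhs => rw [h]
  rw [Finset.card_image_of_injOn, Finset.card_range]
  intro i hi j hj hij
  exact iterate_injOn_Iio_minimalPeriod (by simpa using hi) (by simpa using hj) hij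

theorem iterate_next_half {x : ZMod (2 * m)} (hx : x ∈ B) :
    (next B)^[B.card / 2] x = x + m := by
  obtain ⟨hpos, hcard⟩ := hB.minimalPeriod_next hx
  obtain ⟨i, hi⟩ := exists_iterate_next_eq x (hB.add_mem x hx)
  rw [← iterate_mod_minimalPeriod_eq] at hi
  have hlt := Nat.mod_lt i hpos
  set j := i % minimalPeriod (next B) x
  have hcomm : (next B)^[j] (x + m) = (next B)^[j] x + m :=
    Commute.iterate_left (f := next B) (g := fun z => z + (m : ZMod (2 * m))) hB.next_add j x
  have hper : IsPeriodicPt (next B) (j + j) x := by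
    rw [IsPeriodicPt, IsFixedPt, iterate_add_apply, hi, hcomm, hi, add_assoc, ← two_mul,
      two_mul_natCast_self, add_zero]
  have hj0 : j ≠ 0 := by
    intro h
    rw [h] at hi
    exact natCast_ne_zero (left_eq_add.1 hi)
  obtain ⟨c, hc⟩ := hper.minimalPeriod_dvd
  have hc1 : c = 1 := by
    have : c ≠ 0 := by rintro rfl; omega
    have : minimalPeriod (next B) x * c < minimalPeriod (next B) x * 2 := by omega
    have := Nat.lt_of_mul_lt_mul_left this
    omega
  rw [hc1, mul_one] at hc
  rw [← hcard, ← hc, ← two_mul, Nat.mul_div_cancel_left _ two_pos, hi]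

theorem reflectFun_reflectFun_of_mem {x : ZMod (2 * m)} (hx : x ∈ B) :
    reflectFun B (reflectFun B x) = next B (next B x) := by
  rw [reflectFun_of_mem (hB.reflectFun_mem hx), reflectFun_of_mem hx, hB.next_add]
  linear_combination two_mul_natCast_self (m := m)

/-- The permutation `reflectFun B`. -/
noncomputable def reflect : Perm (ZMod (2 * m)) :=
  Equiv.ofBijective (reflectFun B) (Finite.surjective_iff_bijective.1 hB.reflectFun_surjective)

theorem minimalPeriod_reflect {x : ZMod (2 * m)} (hx : x ∈ B) :
    (B.card = 4 → minimalPeriod hB.reflect x = 4) ∧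
      (B.card = 6 → minimalPeriod hB.reflect x = 3) := by
  have hm := two_mul_natCast_self (m := m)
  constructor
  · intro h
    have h1 : ∀ y ∈ B, reflectFun B (reflectFun B y) = y + m := by
      intro y hy
      rw [hB.reflectFun_reflectFun_of_mem hy, ← hB.iterate_next_half hy, h]
      rfl
    refine minimalPeriod_eq_prime_pow (p := 2) (k := 1) (fun h2 => ?_) ?_
    · have h2 : reflectFun B (reflectFun B x) = x := h2
      rw [h1 x hx] at h2
      exact natCast_ne_zero (add_eq_left.1 h2)
    · change reflectFun B (reflectFun B (reflectFun B (reflectFun B x))) = x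
      rw [h1 x hx, h1 _ (hB.add_mem x hx)]
      linear_combination hm
  · intro h
    refine minimalPeriod_eq_prime (p := 3) ?_ (hB.reflectFun_ne x)
    change reflectFun B (reflectFun B (reflectFun B x)) = x
    rw [hB.reflectFun_reflectFun_of_mem (hB.reflectFun_mem hx), reflectFun_of_mem hx,
      hB.next_add, hB.next_add]
    have := hB.iterate_next_half hx
    rw [h] at this
    change next B (next B (next B x)) = x + m at this
    rw [this]
    linear_combination hm

theorem nonInvolutive_reflect : nonInvolutive hB.reflect = B := by
  ext x
  rw [mem_nonInvolutive]
  constructor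
  · intro h
    by_contra h'
    exact h (hB.reflectFun_reflectFun_of_notMem h')
  · intro hx h
    obtain ⟨h4, h6⟩ := hB.minimalPeriod_reflect hx
    have := (minimalPeriod_eq_two_iff hB.reflectFun_ne x).2 h
    rcases hB.card with h' | h'
    · have := h4 h'; omega
    · have := h6 h'; omega

theorem isInterleaving_reflect : IsInterleaving hB.reflect := by
  refine ⟨hB.reflectFun_sub_one, hB.reflectFun_ne, hB.parity_reflectFun, ?_⟩
  rw [← sum_weight_nonInvolutive hB.reflectFun_ne, hB.nonInvolutive_reflect]
  rcases hB.card with h | h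
  · rw [Finset.sum_congr rfl fun x hx => show weight hB.reflect x = 1 / 4 by
      rw [weight, (hB.minimalPeriod_reflect hx).1 h]; norm_num, Finset.sum_const, h]
    norm_num
  · rw [Finset.sum_congr rfl fun x hx => show weight hB.reflect x = 1 / 6 by
      rw [weight, (hB.minimalPeriod_reflect hx).2 h]; norm_num, Finset.sum_const, h]
    norm_num

end IsAdmissible

end admissible

section interleave

variable {m : ℕ}

/-- Doubling, as a map from `ZMod m` to `ZMod (2 * m)`. -/
def double (m : ℕ) : ZMod m →+ ZMod (2 * m) :=
  ZMod.lift m ⟨(AddMonoidHom.mulLeft 2).comp (Int.castAddHom (ZMod (2 * m))), by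
    simpa using two_mul_natCast_self (m := m)⟩

theorem double_natCast (n : ℕ) : double m n = 2 * n := by
  have := ZMod.lift_coe m ⟨(AddMonoidHom.mulLeft 2).comp (Int.castAddHom (ZMod (2 * m))), by
    simpa using two_mul_natCast_self (m := m)⟩ n
  simpa [double] using this

theorem double_one : double m 1 = 2 := by
  simpa using double_natCast (m := m) 1

variable [NeZero m]

theorem parity_double (y : ZMod m) : parity m (double m y) = 0 := by
  rw [← ZMod.natCast_zmod_val y, double_natCast, map_mul, map_ofNat]
  exact mul_eq_zero_of_left CharTwo.two_eq_zero _

/-- The partition of `ZMod (2 * m)` into even and odd elements. -/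
noncomputable def evenOddEquiv (m : ℕ) [NeZero m] : ZMod m ⊕ ZMod m ≃ ZMod (2 * m) :=
  Equiv.ofBijective (Sum.elim (double m) (fun y => double m y + 1)) <| by
    rw [Fintype.bijective_iff_surjective_and_card]
    constructor
    · intro x
      rcases Nat.even_or_odd' x.val with ⟨q, h | h⟩
      · refine ⟨Sum.inl q, ?_⟩
        rw [Sum.elim_inl, double_natCast, ← ZMod.natCast_zmod_val x, h]
        push_cast
        rfl
      · refine ⟨Sum.inr q, ?_⟩
        rw [Sum.elim_inr, double_natCast, ← ZMod.natCast_zmod_val x, h]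
        push_cast
        rfl
    · rw [Fintype.card_sum, ZMod.card, ZMod.card, two_mul]

theorem evenOddEquiv_inl (y : ZMod m) : evenOddEquiv m (Sum.inl y) = double m y := rfl

theorem evenOddEquiv_inr (y : ZMod m) : evenOddEquiv m (Sum.inr y) = double m y + 1 := rfl

theorem double_injective : Injective (double m) :=
  (evenOddEquiv m).injective.comp Sum.inl_injective

/-- The permutation of `ZMod (2 * m)` acting as `α` on the even elements and as `α⁻¹ * ζ` on the
odd ones. -/
noncomputable def interleave (α : Perm (ZMod m)) : Perm (ZMod (2 * m)) :=
  (evenOddEquiv m).permCongr (Perm.sumCongr α (α⁻¹ * Equiv.addRight 1))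

theorem interleave_double (α : Perm (ZMod m)) (y : ZMod m) :
    interleave α (double m y) = double m (α y) := by
  rw [← evenOddEquiv_inl, interleave, Equiv.permCongr_apply, symm_apply_apply]
  rfl

theorem interleave_double_add_one (α : Perm (ZMod m)) (y : ZMod m) :
    interleave α (double m y + 1) = double m ((α⁻¹ * Equiv.addRight 1 : Perm (ZMod m)) y) + 1 := by
  rw [← evenOddEquiv_inr, interleave, Equiv.permCongr_apply, symm_apply_apply]
  rfl

theorem interleave_injective : Injective (interleave : Perm (ZMod m) → _) := by
  intro α β h
  ext1 y
  apply double_injective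
  rw [← interleave_double, h, interleave_double]

theorem forall_zmod_two_mul {P : ZMod (2 * m) → Prop} :
    (∀ x, P x) ↔ (∀ y, P (double m y)) ∧ ∀ y, P (double m y + 1) := by
  rw [← (evenOddEquiv m).forall_congr_right, Sum.forall]
  rfl

theorem sum_zmod_two_mul (f : ZMod (2 * m) → ℚ) :
    ∑ x, f x = ∑ y, f (double m y) + ∑ y, f (double m y + 1) := by
  rw [← (evenOddEquiv m).sum_comp, Fintype.sum_sum_type]
  rfl

theorem interleave_apply_sub_one (α : Perm (ZMod m)) (x : ZMod (2 * m)) :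
    interleave α (interleave α x - 1) = x + 1 := by
  revert x
  rw [forall_zmod_two_mul]
  constructor
  · intro y
    have h : double m (α y) - 1 = double m (α y - 1) + 1 := by
      rw [map_sub, double_one]; ring
    rw [interleave_double, h, interleave_double_add_one]
    simp
  · intro y
    rw [interleave_double_add_one, add_sub_cancel_right, interleave_double]
    simp only [Perm.mul_apply, Perm.inv_def, apply_symm_apply, Equiv.coe_addRight, map_add,
      double_one]
    ring

theorem parity_interleave (α : Perm (ZMod m)) (x : ZMod (2 * m)) :
    parity m (interleave α x) = parity m x := by
  revert x
  rw [forall_zmod_two_mul]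
  constructor
  · intro y
    rw [interleave_double, parity_double, parity_double]
  · intro y
    rw [interleave_double_add_one, map_add, map_add, parity_double, parity_double]

theorem sum_weight_double (α : Perm (ZMod m)) :
    ∑ y, weight (interleave α) (double m y) = m / 2 - numCycles α := by
  rw [numCycles_eq_sum]
  simp only [weight, minimalPeriod_semiconj (double m) double_injective (interleave_double α)]
  rw [Finset.sum_sub_distrib, Finset.sum_const, Finset.card_univ, ZMod.card, nsmul_eq_mul]
  ring

theorem sum_weight_double_add_one (α : Perm (ZMod m)) :
    ∑ y, weight (interleave α) (double m y + 1) =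
      m / 2 - numCycles (α⁻¹ * Equiv.addRight 1 : Perm (ZMod m)) := by
  rw [numCycles_eq_sum]
  simp only [weight, minimalPeriod_semiconj (fun y => double m y + 1)
    ((add_left_injective 1).comp double_injective) (interleave_double_add_one α)]
  rw [Finset.sum_sub_distrib, Finset.sum_const, Finset.card_univ, ZMod.card, nsmul_eq_mul]
  ring

theorem isInterleaving_interleave_iff (α : Perm (ZMod m)) : IsInterleaving (interleave α) ↔
    (∀ y, α y ≠ y) ∧ (∀ y, (α⁻¹ * Equiv.addRight 1 : Perm (ZMod m)) y ≠ y) ∧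
      numCycles α + numCycles (α⁻¹ * Equiv.addRight 1 : Perm (ZMod m)) + 1 = m := by
  have hne : (∀ x, interleave α x ≠ x) ↔
      (∀ y, α y ≠ y) ∧ ∀ y, (α⁻¹ * Equiv.addRight 1 : Perm (ZMod m)) y ≠ y := by
    rw [forall_zmod_two_mul]
    refine and_congr (forall_congr' fun y => ?_) (forall_congr' fun y => ?_)
    · rw [interleave_double, double_injective.ne_iff]
    · rw [interleave_double_add_one, add_left_injective 1 |>.ne_iff, double_injective.ne_iff]
  have hw : ∑ x, weight (interleave α) x = 1 ↔
      numCycles α + numCycles (α⁻¹ * Equiv.addRight 1 : Perm (ZMod m)) + 1 = m := by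
    rw [sum_zmod_two_mul, sum_weight_double, sum_weight_double_add_one, ← Nat.cast_inj (R := ℚ)]
    push_cast
    constructor <;> intro h <;> linarith
  constructor
  · intro h
    exact ⟨(hne.1 h.ne).1, (hne.1 h.ne).2, hw.1 h.sum_weight⟩
  · rintro ⟨h1, h2, h3⟩
    exact ⟨interleave_apply_sub_one α, hne.2 ⟨h1, h2⟩, parity_interleave α, hw.2 h3⟩

theorem exists_eq_interleave {γ : Perm (ZMod (2 * m))} (hγ : IsInterleaving γ) :
    ∃ α, interleave α = γ := by
  have hmaps : Set.MapsTo ((evenOddEquiv m).symm.permCongr γ) (Set.range Sum.inl)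
      (Set.range Sum.inl) := by
    rintro _ ⟨y, rfl⟩
    rw [Equiv.permCongr_apply, Equiv.symm_symm, evenOddEquiv_inl]
    have hp := hγ.parity_apply (double m y)
    rw [parity_double] at hp
    obtain ⟨z | z, hz⟩ := (evenOddEquiv m).surjective (γ (double m y))
    · rw [← hz, symm_apply_apply]; exact ⟨z, rfl⟩
    · rw [← hz, evenOddEquiv_inr, map_add, parity_double, map_one] at hp
      simp at hp
  obtain ⟨⟨α, δ⟩, h⟩ := Perm.mem_sumCongrHom_range_of_perm_mapsTo_inl hmaps
  have hγ' : γ = (evenOddEquiv m).permCongr (Perm.sumCongr α δ) := by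
    change Perm.sumCongr α δ = _ at h
    rw [h]
    ext1 x
    simp [Equiv.permCongr_apply]
  have hγ1 : ∀ y, γ (double m y) = double m (α y) := by
    intro y
    rw [← evenOddEquiv_inl, hγ', Equiv.permCongr_apply, symm_apply_apply]
    rfl
  have hγ2 : ∀ y, γ (double m y + 1) = double m (δ y) + 1 := by
    intro y
    rw [← evenOddEquiv_inr, hγ', Equiv.permCongr_apply, symm_apply_apply]
    rfl
  have hδ : δ = α⁻¹ * Equiv.addRight 1 := by
    rw [eq_inv_mul_iff_mul_eq]
    ext1 y
    apply double_injective
    have := hγ.apply_sub_one (double m y + 1)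
    rw [hγ2, add_sub_cancel_right, hγ1] at this
    rw [Perm.mul_apply, this, Equiv.coe_addRight, map_add, double_one]
    ring
  exact ⟨α, by rw [hγ', hδ, interleave]⟩

theorem isReducedGenusOne_zero_iff (α : Perm (ZMod m)) (k : ℕ) :
    IsReducedGenusOne (Equiv.addRight 1) α k 0 ↔
      IsInterleaving (interleave α) ∧ numCycles α = k := by
  rw [isInterleaving_interleave_iff]
  constructor
  · rintro ⟨h1, h2, h3, h4⟩
    rw [Nat.card_zmod] at h2
    rw [Finite.card_eq_zero_iff, isEmpty_subtype] at h4
    refine ⟨⟨fun y hy => h3 ⟨y, fun z hz hne => absurd ?_ hne⟩, h4, h2⟩, h1⟩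
    exact (Perm.SameCycle.eq_of_left hz hy).symm
  · rintro ⟨⟨h1, h2, h3⟩, h4⟩
    refine ⟨h4, by rwa [Nat.card_zmod], ?_, ?_⟩
    · rintro ⟨l, hl⟩
      exact h2 (α l) (hl (α l) ⟨1, rfl⟩ (h1 l))
    · rw [Finite.card_eq_zero_iff, isEmpty_subtype]
      exact h2

theorem reducedCount_zero_eq (k n : ℕ) {P : Finset (ZMod (2 * (n + 1))) → Prop}
    (hP : ∀ α : Perm (ZMod (n + 1)), IsInterleaving (interleave α) →
      (numCycles α = k ↔ P (nonInvolutive (interleave α)))) :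
    reducedCount k (n + 1) 0 =
      Nat.card {B : Finset (ZMod (2 * (n + 1))) // IsAdmissible B ∧ P B} := by
  have h1 : reducedCount k (n + 1) 0 = Nat.card {α : Perm (ZMod (n + 1)) //
      IsInterleaving (interleave α) ∧ numCycles α = k} := by
    simp only [← isReducedGenusOne_zero_iff]
    have : (finRotate (n + 1) : Perm (Fin (n + 1))) =
        (Equiv.addRight 1 : Perm (ZMod (n + 1))) := by
      ext1 x
      exact finRotate_apply x
    rw [reducedCount, this]
    rfl
  rw [h1]
  refine Nat.card_congr (Equiv.ofBijective (fun α => ⟨nonInvolutive (interleave α.1),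
    α.2.1.isAdmissible, (hP α.1 α.2.1).1 α.2.2⟩) ⟨?_, ?_⟩)
  · intro α β h
    exact Subtype.ext (interleave_injective (α.2.1.ext β.2.1 (Subtype.ext_iff.1 h)))
  · rintro ⟨B, hB, hPB⟩
    obtain ⟨α, hα⟩ := exists_eq_interleave hB.isInterleaving_reflect
    have hα' : IsInterleaving (interleave α) := hα ▸ hB.isInterleaving_reflect
    have hαB : nonInvolutive (interleave α) = B := by rw [hα, hB.nonInvolutive_reflect]
    exact ⟨⟨α, hα', (hP α hα').2 (hαB ▸ hPB)⟩, Subtype.ext hαB⟩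

section parity

variable {α : Perm (ZMod m)} (hα : IsInterleaving (interleave α))
include hα

theorem two_mul_numCycles_le : 2 * numCycles α ≤ m := by
  have h := sum_weight_double α
  have h1 : 0 ≤ ∑ y, weight (interleave α) (double m y) :=
    Finset.sum_nonneg fun y _ => weight_nonneg hα.ne _
  have : (2 * numCycles α : ℚ) ≤ m := by linarith
  exact_mod_cast this

theorem two_mul_numCycles_eq_iff :
    2 * numCycles α = m ↔ ∀ b ∈ nonInvolutive (interleave α), parity m b = 1 := by
  have h := sum_weight_double α
  have h1 : 2 * numCycles α = m ↔ ∑ y, weight (interleave α) (double m y) = 0 := by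
    rw [h, ← Nat.cast_inj (R := ℚ)]
    push_cast
    constructor <;> intro h <;> linarith
  rw [h1, Finset.sum_eq_zero_iff_of_nonneg fun y _ => weight_nonneg hα.ne _, forall_zmod_two_mul]
  simp [weight_eq_zero_iff hα.ne, mem_nonInvolutive, parity_double]

theorem le_two_mul_numCycles_add_two : m ≤ 2 * numCycles α + 2 := by
  have h := sum_weight_double_add_one α
  have h0 := ((isInterleaving_interleave_iff α).1 hα).2.2
  have h1 : 0 ≤ ∑ y, weight (interleave α) (double m y + 1) :=
    Finset.sum_nonneg fun y _ => weight_nonneg hα.ne _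
  have : (2 * numCycles (α⁻¹ * Equiv.addRight 1 : Perm (ZMod m)) : ℚ) ≤ m := by linarith
  have : 2 * numCycles (α⁻¹ * Equiv.addRight 1 : Perm (ZMod m)) ≤ m := by exact_mod_cast this
  omega

theorem two_mul_numCycles_add_two_eq_iff :
    2 * numCycles α + 2 = m ↔ ∀ b ∈ nonInvolutive (interleave α), parity m b = 0 := by
  have h := sum_weight_double_add_one α
  have h0 := ((isInterleaving_interleave_iff α).1 hα).2.2
  have h1 : 2 * numCycles α + 2 = m ↔ ∑ y, weight (interleave α) (double m y + 1) = 0 := by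
    rw [h, show 2 * numCycles α + 2 = m ↔
      2 * numCycles (α⁻¹ * Equiv.addRight 1 : Perm (ZMod m)) = m by omega,
      ← Nat.cast_inj (R := ℚ)]
    push_cast
    constructor <;> intro h <;> linarith
  rw [h1, Finset.sum_eq_zero_iff_of_nonneg fun y _ => weight_nonneg hα.ne _, forall_zmod_two_mul]
  simp [weight_eq_zero_iff hα.ne, mem_nonInvolutive, parity_double]

end parity

end interleave

section periodicSet

variable {m : ℕ} [NeZero m] {S : Finset ℕ}

/-- The set of elements of `ZMod (2 * m)` with residue modulo `m` in `S`. -/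
def periodicSet (m : ℕ) [NeZero m] (S : Finset ℕ) : Finset (ZMod (2 * m)) :=
  Finset.univ.filter fun x => x.val % m ∈ S

theorem mem_periodicSet {x : ZMod (2 * m)} : x ∈ periodicSet m S ↔ x.val % m ∈ S := by
  simp [periodicSet]

theorem natCast_mem_periodicSet {i : ℕ} : (i : ZMod (2 * m)) ∈ periodicSet m S ↔ i % m ∈ S := by
  rw [mem_periodicSet, ZMod.val_natCast, Nat.mod_mod_of_dvd _ (dvd_mul_left m 2)]

theorem add_mem_periodicSet {x : ZMod (2 * m)} (hx : x ∈ periodicSet m S) :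
    x + m ∈ periodicSet m S := by
  rw [← ZMod.natCast_zmod_val x] at hx ⊢
  rw [← Nat.cast_add]
  rw [natCast_mem_periodicSet] at hx ⊢
  rwa [Nat.add_mod_right]

theorem card_periodicSet (hS : S ⊆ Finset.range m) : (periodicSet m S).card = 2 * S.card := by
  have h : (S ×ˢ Finset.range 2).card = (periodicSet m S).card := by
    have hm : 0 < m := NeZero.pos m
    refine Finset.card_nbij' (fun p => ((p.1 + m * p.2 : ℕ) : ZMod (2 * m)))
      (fun x => (x.val % m, x.val / m)) ?_ ?_ ?_ ?_
    · rintro ⟨s, e⟩ h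
      simp only [Finset.coe_product, Set.mem_prod, Finset.mem_coe] at h ⊢
      rw [natCast_mem_periodicSet, Nat.add_mul_mod_self_left,
        Nat.mod_eq_of_lt (Finset.mem_range.1 (hS h.1))]
      exact h.1
    · intro x hx
      simp only [Finset.coe_product, Set.mem_prod, Finset.mem_coe] at hx ⊢
      refine ⟨mem_periodicSet.1 hx, ?_⟩
      rw [Finset.mem_range, Nat.div_lt_iff_lt_mul hm]
      exact ZMod.val_lt x
    · rintro ⟨s, e⟩ h
      simp only [Finset.coe_product, Set.mem_prod, Finset.mem_coe] at h ⊢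
      have h1 := Finset.mem_range.1 (hS h.1)
      have h2 := Finset.mem_range.1 h.2
      have h3 : s + m * e < 2 * m := by nlinarith
      rw [ZMod.val_natCast, Nat.mod_eq_of_lt h3, Nat.add_mul_mod_self_left, Nat.mod_eq_of_lt h1,
        Nat.add_mul_div_left _ _ hm, Nat.div_eq_of_lt h1, zero_add]
    · intro x _
      simp only [Nat.mod_add_div, ZMod.natCast_zmod_val]
  rw [← h, Finset.card_product, Finset.card_range, mul_comm]

theorem periodicSet_filter {B : Finset (ZMod (2 * m))} (hB : ∀ x ∈ B, x + m ∈ B) :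
    periodicSet m ((Finset.range m).filter fun j : ℕ => (j : ZMod (2 * m)) ∈ B) = B := by
  have hm : 0 < m := NeZero.pos m
  have hB' : ∀ x : ZMod (2 * m), x + m ∈ B ↔ x ∈ B := fun x => ⟨fun h => by
    simpa [add_assoc, ← two_mul, two_mul_natCast_self] using hB _ h, hB x⟩
  ext x
  rw [mem_periodicSet, Finset.mem_filter, Finset.mem_range, and_iff_right (Nat.mod_lt _ hm)]
  conv_rhs => rw [← ZMod.natCast_zmod_val x]
  have h1 := Nat.mod_add_div x.val m
  have h2 : x.val / m < 2 := (Nat.div_lt_iff_lt_mul hm).2 (ZMod.val_lt x)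
  interval_cases h : x.val / m
  · rw [show x.val % m = x.val by omega]
  · conv_rhs => rw [← h1, mul_one, Nat.cast_add]
    exact (hB' _).symm

theorem filter_periodicSet (hS : S ⊆ Finset.range m) :
    ((Finset.range m).filter fun j : ℕ => (j : ZMod (2 * m)) ∈ periodicSet m S) = S := by
  ext j
  rw [Finset.mem_filter, natCast_mem_periodicSet]
  constructor
  · rintro ⟨h1, h2⟩
    rwa [Nat.mod_eq_of_lt (Finset.mem_range.1 h1)] at h2
  · intro h
    refine ⟨hS h, ?_⟩
    rwa [Nat.mod_eq_of_lt (Finset.mem_range.1 (hS h))]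

theorem card_isAdmissible_eq {P : Finset (ZMod (2 * m)) → Prop} {Q : Finset ℕ → Prop}
    [DecidablePred Q]
    (hPQ : ∀ S ⊆ Finset.range m,
      (IsAdmissible (periodicSet m S) ∧ P (periodicSet m S) ↔ Q S)) :
    Nat.card {B : Finset (ZMod (2 * m)) // IsAdmissible B ∧ P B} =
      ((Finset.range m).powerset.filter Q).card := by
  rw [← Fintype.card_coe, ← Nat.card_eq_fintype_card]
  refine Nat.card_congr
    ⟨fun B => ⟨(Finset.range m).filter fun j : ℕ => (j : ZMod (2 * m)) ∈ B.1, ?_⟩,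
    fun S => ⟨periodicSet m S.1, ?_⟩, ?_, ?_⟩
  · rw [Finset.mem_filter, Finset.mem_powerset]
    refine ⟨Finset.filter_subset _ _, ?_⟩
    rw [← hPQ _ (Finset.filter_subset _ _), periodicSet_filter B.2.1.add_mem]
    exact B.2
  · have := S.2
    rw [Finset.mem_filter, Finset.mem_powerset] at this
    exact (hPQ _ this.1).2 this.2
  · exact fun B => Subtype.ext (periodicSet_filter B.2.1.add_mem)
  · exact fun S => Subtype.ext (filter_periodicSet
      (Finset.mem_powerset.1 (Finset.mem_filter.1 S.2).1))

theorem nextDist_periodicSet {i r : ℕ} (hr : 0 < r) (h : (i + r) % m ∈ S)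
    (h' : ∀ s, 0 < s → s < r → (i + s) % m ∉ S) :
    nextDist (periodicSet m S) (i : ZMod (2 * m)) = r := by
  refine nextDist_eq hr ?_ fun s hs hsr => ?_
  · rwa [← Nat.cast_add, natCast_mem_periodicSet]
  · rw [← Nat.cast_add, natCast_mem_periodicSet]
    exact h' s hs hsr

theorem isAdmissible_periodicSet_iff (hS : S ⊆ Finset.range m) :
    IsAdmissible (periodicSet m S) ↔ (S.card = 2 ∨ S.card = 3) ∧
      ∀ i ∈ S, (nextDist (periodicSet m S) (i : ZMod (2 * m)) : ZMod 2) = m := by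
  have hc := card_periodicSet hS
  constructor
  · intro h
    refine ⟨by have := h.card; omega, fun i hi => ?_⟩
    have := h.parity_next i (by
      rwa [natCast_mem_periodicSet, Nat.mod_eq_of_lt (Finset.mem_range.1 (hS hi))])
    rw [next, map_add, map_natCast, map_natCast] at this
    exact add_left_cancel this
  · rintro ⟨h1, h2⟩
    refine ⟨fun x => add_mem_periodicSet, by omega, fun x hx => ?_⟩
    rw [next, map_add, map_natCast, ← h2 _ (mem_periodicSet.1 hx)]
    congr 2
    have h3 (x : ZMod (2 * m)) :
        nextDist (periodicSet m S) (x + m) = nextDist (periodicSet m S) x := by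
      rw [nextDist, nextDist]
      congr 1
      ext r
      refine and_congr_right fun _ => ?_
      rw [add_right_comm]
      refine ⟨fun h => ?_, add_mem_periodicSet⟩
      simpa [add_assoc, ← two_mul, two_mul_natCast_self] using add_mem_periodicSet h
    have hm : 0 < m := NeZero.pos m
    conv_lhs => rw [← ZMod.natCast_zmod_val x]
    have h1 := Nat.mod_add_div x.val m
    have h2 : x.val / m < 2 := (Nat.div_lt_iff_lt_mul hm).2 (ZMod.val_lt x)
    interval_cases h : x.val / m
    · rw [show x.val % m = x.val by omega]
    · conv_lhs => rw [← h1, mul_one, Nat.cast_add]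
      exact h3 _

end periodicSet

theorem card_filter_natCast_eq (l : ℕ) (e : ZMod 2) :
    ((Finset.range (2 * l)).filter fun i : ℕ => (i : ZMod 2) = e).card = l := by
  induction l with
  | zero => simp
  | succ l ih =>
    have h2 : (2 : ZMod 2) = 0 := rfl
    rw [show 2 * (l + 1) = 2 * l + 1 + 1 by ring, Finset.range_add_one, Finset.range_add_one,
      Finset.filter_insert, Finset.filter_insert]
    push_cast
    rw [h2, zero_mul, zero_add]
    obtain rfl | rfl := (by decide : ∀ e : ZMod 2, e = 0 ∨ e = 1) e
    · simp [ih]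
    · simp [ih]

theorem card_isAdmissible_of_even {l : ℕ} (hl : 0 < l) (e : ZMod 2) :
    Nat.card {B : Finset (ZMod (2 * (2 * l))) //
      IsAdmissible B ∧ ∀ b ∈ B, parity (2 * l) b = e} = (l + 1).choose 3 := by
  classical
  have : NeZero (2 * l) := ⟨by omega⟩
  have h2 : ((2 * l : ℕ) : ZMod 2) = 0 := (ZMod.natCast_eq_zero_iff _ _).2 (dvd_mul_right 2 l)
  rw [card_isAdmissible_eq
    (Q := fun S => (∀ i ∈ S, ((i : ℕ) : ZMod 2) = e) ∧ (S.card = 2 ∨ S.card = 3))]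
  · have h : ((Finset.range (2 * l)).powerset.filter
        fun S : Finset ℕ => (∀ i ∈ S, ((i : ℕ) : ZMod 2) = e) ∧ (S.card = 2 ∨ S.card = 3)) =
        ((Finset.range (2 * l)).filter fun i : ℕ => (i : ZMod 2) = e).powersetCard 2 ∪
        ((Finset.range (2 * l)).filter fun i : ℕ => (i : ZMod 2) = e).powersetCard 3 := by
      ext S
      simp only [Finset.mem_filter, Finset.mem_powerset, Finset.mem_union, Finset.mem_powersetCard,
        Finset.subset_iff]
      grind
    rw [h, Finset.card_union_of_disjoint, Finset.card_powersetCard, Finset.card_powersetCard,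
      card_filter_natCast_eq, Nat.choose_succ_succ' l 2]
    exact Finset.pairwise_disjoint_powersetCard _ (by simp : 2 ≠ 3)
  · intro S hS
    have h4 : (∀ b ∈ periodicSet (2 * l) S, parity (2 * l) b = e) ↔
        ∀ i ∈ S, ((i : ℕ) : ZMod 2) = e := by
      constructor
      · intro h i hi
        have := h i (by rwa [natCast_mem_periodicSet,
          Nat.mod_eq_of_lt (Finset.mem_range.1 (hS hi))])
        rwa [map_natCast] at this
      · intro h b hb
        rw [← h _ (mem_periodicSet.1 hb)]
        conv_lhs => rw [← ZMod.natCast_zmod_val b, map_natCast, ← Nat.mod_add_div b.val (2 * l),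
          Nat.cast_add, Nat.cast_mul, h2, zero_mul, add_zero]
    rw [h4, isAdmissible_periodicSet_iff hS, and_comm]
    refine and_congr_right fun h5 => and_iff_left_of_imp fun h6 i hi => ?_
    have hne : (periodicSet (2 * l) S).Nonempty := by
      rw [← Finset.card_pos, card_periodicSet hS]
      omega
    have h7 := h4.2 h5 _ (next_mem hne i)
    rw [next, map_add, map_natCast, map_natCast, h5 i hi] at h7
    rw [h2]
    simpa using h7


theorem exists_lt_lt_of_card_eq_three {S : Finset ℕ} (h : S.card = 3) :
    ∃ a b c, a < b ∧ b < c ∧ S = {a, b, c} := by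
  refine ⟨S.orderEmbOfFin h 0, S.orderEmbOfFin h 1, S.orderEmbOfFin h 2, ?_, ?_, ?_⟩
  · simp
  · simp
  · conv_lhs => rw [← Finset.image_orderEmbOfFin_univ S h]
    simp [Fin.univ_succ]

theorem isAdmissible_periodicSet_iff_of_odd {m : ℕ} [NeZero m] (hm : m % 2 = 1) {S : Finset ℕ}
    (hS : S ⊆ Finset.range m) : IsAdmissible (periodicSet m S) ↔
      ∃ a b c, a < b ∧ b < c ∧ (b - a) % 2 = 1 ∧ (c - b) % 2 = 1 ∧ S = {a, b, c} := by
  have hmod (a s : ℕ) (ha : a < m) (hs : s ≤ m) :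
      (a + s < m ∧ (a + s) % m = a + s) ∨ (m ≤ a + s ∧ (a + s) % m = a + s - m) := by
    rcases lt_or_ge (a + s) m with h | h
    · exact .inl ⟨h, Nat.mod_eq_of_lt h⟩
    · refine .inr ⟨h, ?_⟩
      rw [Nat.mod_eq_sub_mod h, Nat.mod_eq_of_lt (by omega)]
  rw [isAdmissible_periodicSet_iff hS]
  simp only [ZMod.natCast_eq_natCast_iff', hm]
  have key {a b c : ℕ} (hab : a < b) (hbc : b < c) (h : S = {a, b, c}) :
      nextDist (periodicSet m S) a = b - a ∧ nextDist (periodicSet m S) b = c - b ∧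
        nextDist (periodicSet m S) c = a + m - c := by
    have hc : c < m := Finset.mem_range.1 (hS (by simp [h]))
    subst h
    refine ⟨nextDist_periodicSet (by omega) ?_ fun s h1 h2 => ?_,
      nextDist_periodicSet (by omega) ?_ fun s h1 h2 => ?_,
      nextDist_periodicSet (by omega) ?_ fun s h1 h2 => ?_⟩ <;>
    simp only [Finset.mem_insert, Finset.mem_singleton]
    · have := hmod a (b - a) (by omega) (by omega)
      omega
    · have := hmod a s (by omega) (by omega)
      omega
    · have := hmod b (c - b) (by omega) (by omega)
      omega
    · have := hmod b s (by omega) (by omega)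
      omega
    · have := hmod c (a + m - c) (by omega) (by omega)
      omega
    · have := hmod c s (by omega) (by omega)
      omega
  constructor
  · rintro ⟨h | h, h'⟩
    · obtain ⟨a, b, hab, rfl⟩ : ∃ a b, a < b ∧ S = {a, b} := by
        obtain ⟨a, b, hab, rfl⟩ := Finset.card_eq_two.1 h
        rcases hab.lt_or_gt with h | h
        · exact ⟨a, b, h, rfl⟩
        · exact ⟨b, a, h, Finset.pair_comm a b⟩
      have hb : b < m := Finset.mem_range.1 (hS (by simp))
      have h1 : nextDist (periodicSet m {a, b}) a = b - a := by
        refine nextDist_periodicSet (by omega) ?_ fun s h1 h2 => ?_ <;>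
        simp only [Finset.mem_insert, Finset.mem_singleton]
        · have := hmod a (b - a) (by omega) (by omega)
          omega
        · have := hmod a s (by omega) (by omega)
          omega
      have h2 : nextDist (periodicSet m {a, b}) b = a + m - b := by
        refine nextDist_periodicSet (by omega) ?_ fun s h1 h2 => ?_ <;>
        simp only [Finset.mem_insert, Finset.mem_singleton]
        · have := hmod b (a + m - b) (by omega) (by omega)
          omega
        · have := hmod b s (by omega) (by omega)
          omega
      have h3 := h' a (by simp)
      have h4 := h' b (by simp)
      omega
    · obtain ⟨a, b, c, hab, hbc, rfl⟩ := exists_lt_lt_of_card_eq_three h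
      obtain ⟨h1, h2, h3⟩ := key hab hbc rfl
      refine ⟨a, b, c, hab, hbc, ?_, ?_, rfl⟩
      · rw [← h1]
        exact h' a (by simp)
      · rw [← h2]
        exact h' b (by simp)
  · rintro ⟨a, b, c, hab, hbc, h4, h5, rfl⟩
    obtain ⟨h1, h2, h3⟩ := key hab hbc rfl
    refine ⟨.inr (Finset.card_eq_three.2 ⟨a, b, c, hab.ne, (hab.trans hbc).ne, hbc.ne, rfl⟩), ?_⟩
    simp only [Finset.mem_insert, Finset.mem_singleton, forall_eq_or_imp, forall_eq]
    have hc : c < m := Finset.mem_range.1 (hS (by simp))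
    omega

theorem card_filter_odd_sub (c : ℕ) :
    ((Finset.range c).filter fun b => (c - b) % 2 = 1).card = (c + 1) / 2 := by
  induction c using Nat.strong_induction_on with
  | _ c ih =>
    rcases c with _ | _ | c
    · simp
    · simp [Finset.filter_singleton]
    · rw [Finset.range_add_one, Finset.range_add_one, Finset.filter_insert, Finset.filter_insert,
        if_pos (by omega), if_neg (by omega), Finset.card_insert_of_notMem (by simp)]
      rw [Finset.filter_congr (q := fun b => (c - b) % 2 = 1), ih c (by omega)]
      · omega
      · intro b hb
        rw [Finset.mem_range] at hb
        omega

theorem sum_filter_odd_sub (c : ℕ) :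
    ∑ b ∈ (Finset.range c).filter (fun b => (c - b) % 2 = 1), (b + 1) / 2 =
      (c / 2 + 1).choose 2 := by
  induction c using Nat.strong_induction_on with
  | _ c ih =>
    rcases c with _ | _ | c
    · simp
    · simp [Finset.filter_singleton]
    · rw [Finset.range_add_one, Finset.range_add_one, Finset.filter_insert, Finset.filter_insert,
        if_pos (by omega), if_neg (by omega), Finset.sum_insert (by simp)]
      rw [Finset.filter_congr (q := fun b => (c - b) % 2 = 1), ih c (by omega)]
      · rw [show (c + 2) / 2 = c / 2 + 1 by omega, Nat.choose_succ_succ' (c / 2 + 1) 1,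
          Nat.choose_one_right]
      · intro b hb
        rw [Finset.mem_range] at hb
        omega

theorem sum_range_choose_two (k : ℕ) :
    ∑ c ∈ Finset.range (2 * k + 1), (c / 2 + 1).choose 2 =
      (k + 1).choose 3 + (k + 2).choose 3 := by
  induction k with
  | zero => rfl
  | succ k ih =>
    rw [show 2 * (k + 1) + 1 = 2 * k + 1 + 1 + 1 by ring, Finset.sum_range_succ,
      Finset.sum_range_succ, ih, show (2 * k + 1) / 2 = k by omega,
      show (2 * k + 1 + 1) / 2 = k + 1 by omega, show k + 1 + 1 = k + 2 by rfl,
      show k + 1 + 2 = k + 3 by rfl, Nat.choose_succ_succ' (k + 2) 2,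
      Nat.choose_succ_succ' (k + 1) 2]
    ring

theorem card_isAdmissible_of_odd (k : ℕ) :
    Nat.card {B : Finset (ZMod (2 * (2 * k + 1))) // IsAdmissible B ∧ True} =
      (k + 1).choose 3 + (k + 2).choose 3 := by
  classical
  rw [card_isAdmissible_eq (Q := fun S => ∃ a b c, a < b ∧ b < c ∧ (b - a) % 2 = 1 ∧
    (c - b) % 2 = 1 ∧ S = {a, b, c}) fun S hS => by
      rw [and_true, isAdmissible_periodicSet_iff_of_odd (by omega) hS], ← sum_range_choose_two]
  simp_rw [← sum_filter_odd_sub, ← card_filter_odd_sub]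
  simp_rw [← Finset.card_sigma]
  symm
  refine Finset.card_bij (fun p _ => {p.2.2, p.2.1, p.1}) ?_ ?_ ?_
  · rintro ⟨c, b, a⟩ h
    simp only [Finset.mem_sigma, Finset.mem_filter, Finset.mem_range, Finset.mem_powerset,
      Finset.subset_iff, Finset.mem_insert, Finset.mem_singleton] at h ⊢
    exact ⟨by omega, a, b, c, h.2.2.1, h.2.1.1, h.2.2.2, h.2.1.2, rfl⟩
  · rintro ⟨c, b, a⟩ h ⟨c', b', a'⟩ h' he
    simp only [Finset.mem_sigma, Finset.mem_filter, Finset.mem_range] at h h'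
    simp only [Finset.ext_iff, Finset.mem_insert, Finset.mem_singleton] at he
    have h1 := he a
    have h2 := he b
    have h3 := he c
    have h4 := he a'
    have h5 := he b'
    have h6 := he c'
    obtain ⟨rfl, rfl, rfl⟩ : c = c' ∧ b = b' ∧ a = a' := by omega
    rfl
  · intro S hS
    obtain ⟨hS, a, b, c, h1, h2, h3, h4, rfl⟩ := Finset.mem_filter.1 hS
    refine ⟨⟨c, b, a⟩, ?_, rfl⟩
    have hc := Finset.mem_powerset.1 hS (show c ∈ {a, b, c} by simp)
    simp only [Finset.mem_sigma, Finset.mem_filter, Finset.mem_range]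
    exact ⟨Finset.mem_range.1 hc, ⟨h2, h4⟩, h1, h3⟩

theorem reducedCount_two_mul {k : ℕ} (hk : 1 ≤ k) :
    reducedCount k (2 * k) 0 = (k + 1).choose 3 := by
  rw [← card_isAdmissible_of_even hk 1]
  obtain ⟨n, hn⟩ := Nat.exists_eq_add_of_le' (show 1 ≤ 2 * k by omega)
  rw [hn]
  exact reducedCount_zero_eq k n fun α hα => by
    rw [← two_mul_numCycles_eq_iff hα]
    omega

theorem reducedCount_two_mul_add_two (k : ℕ) :
    reducedCount k (2 * k + 2) 0 = (k + 2).choose 3 := by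
  rw [← card_isAdmissible_of_even k.succ_pos 0]
  exact reducedCount_zero_eq k (2 * k + 1) fun α hα =>
    Iff.trans (by omega) (two_mul_numCycles_add_two_eq_iff hα)

theorem reducedCount_two_mul_add_one (k : ℕ) :
    reducedCount k (2 * k + 1) 0 = (k + 1).choose 3 + (k + 2).choose 3 := by
  rw [← card_isAdmissible_of_odd]
  exact reducedCount_zero_eq k (2 * k) fun α hα => iff_true_intro <| by
    have h1 := two_mul_numCycles_le hα
    have h2 := le_two_mul_numCycles_add_two hα
    omega

theorem reducedCount_eq_zero {k m : ℕ} (h : m < 2 * k ∨ 2 * k + 2 < m) :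
    reducedCount k m 0 = 0 := by
  rcases m with _ | n
  · exact reducedCount_of_le_one k 0 zero_le_one
  · rw [reducedCount_zero_eq k n (P := fun _ => False) fun α hα => iff_of_false ?_ not_false]
    · simp
    · have h1 := two_mul_numCycles_le hα
      have h2 := le_two_mul_numCycles_add_two hα
      omega

theorem sum_choose_mul_reducedCount {k : ℕ} (hk : 1 ≤ k) (n : ℕ) :
    ∑ m ∈ Finset.range (n + 1), n.choose m * reducedCount k m 0 =
      (n + 2).choose (2 * k + 2) * (k + 1).choose 3 +
        (n + 1).choose (2 * k + 2) * (k + 1).choose 2 := by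
  have h : ∑ m ∈ Finset.range (n + 1), n.choose m * reducedCount k m 0 =
      ∑ m ∈ {2 * k, 2 * k + 1, 2 * k + 2}, n.choose m * reducedCount k m 0 := by
    have h1 (m : ℕ) (hm : m ∉ Finset.range (n + 1)) : n.choose m * reducedCount k m 0 = 0 := by
      rw [Nat.choose_eq_zero_of_lt (by simpa using hm), zero_mul]
    have h2 (m : ℕ) (hm : m ∉ ({2 * k, 2 * k + 1, 2 * k + 2} : Finset ℕ)) :
        n.choose m * reducedCount k m 0 = 0 := by
      simp only [Finset.mem_insert, Finset.mem_singleton] at hm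
      rw [reducedCount_eq_zero (by omega), mul_zero]
    rw [← finsum_eq_sum_of_support_subset _ (fun m hm => by_contra fun h => hm (h1 m h)),
      ← finsum_eq_sum_of_support_subset _ (fun m hm => by_contra fun h => hm (h2 m h))]
  rw [h, Finset.sum_insert (by simp), Finset.sum_insert (by simp), Finset.sum_singleton,
    reducedCount_two_mul hk, reducedCount_two_mul_add_one, reducedCount_two_mul_add_two,
    Nat.choose_succ_succ' (n + 1) (2 * k + 1), Nat.choose_succ_succ' n (2 * k + 1),
    Nat.choose_succ_succ' n (2 * k), Nat.choose_succ_succ' (k + 1) 2]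
  ring

end GenusOne

/-- For `n ≥ 0` and `k ≥ 1`, the number of reduced genus-one permutations of `{1,…,n}`
with exactly `k` cycles is `C(n+2,2k+2)·C(k+1,3) + C(n+1,2k+2)·C(k+1,2)`. -/
theorem reduced_genus_one_permutation_count (n k : ℕ) (hk : 1 ≤ k) :
    Nat.card {α : Equiv.Perm (Fin n) // IsGenusOne α ∧ IsReducedPerm α ∧ zPerm α = k} =
      (n + 2).choose (2 * k + 2) * (k + 1).choose 3 +
        (n + 1).choose (2 * k + 2) * (k + 1).choose 2 := by
  rw [GenusOne.card_reduced_eq_sum, GenusOne.sum_choose_mul_reducedCount hk]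
end
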